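/- If x, y ∈ ℂ satisfy y² = x⁶ + 2x⁵ + x⁴ + 2x³ + 6x² + 4x + 1 and [ℚ(x,y) : ℚ] = 2, then x ∈ ℚ. (Every quadratic point on this affine model of the modular curve X₁(13) is an obvious quadratic point.) -/

import Mathlib

section
open Polynomial
namespace X113
open NumberField
noncomputable def fZ : ℤ[X] := X^6 + 2*X^5 + X^4 + 2*X^3 + 6*X^2 + 4*X + 1

theorem fZ_natDegree : fZ.natDegree = 6 := by unfold fZ; compute_degree!
theorem fZ_monic : fZ.Monic := by unfold fZ; monicity!

theorem key1 : ∀ a : ZMod 3, a^6 + 2*a^5 + a^4 + 2*a^3 + 6*a^2 + 4*a + 1 ≠ 0 := by decide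

theorem key2 : ∀ a b c d e f: ZMod 3, a + c = 2 → b + a*c+d = 1 → b*c+a*d+e = 2 → b*d+a*e+f=0 → b*e+a*f = 1 → b*f=1 → False := by
  decide

theorem key3 : ∀ a b c d e f: ZMod 3, a + d = 2 → b + a*d+e = 1 → c+b*d+a*e+f = 2 → c*d+b*e+a*f=0 → c*e+b*f = 1 → c*f=1 → False := by
  decide

theorem monic_form {R : Type*} [CommRing R] [Nontrivial R] (p : R[X]) (hp : p.Monic) :
   (p.natDegree = 2 → p = X^2 + C (p.coeff 1) * X + C (p.coeff 0)) ∧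
   (p.natDegree = 3 → p = X^3 + C (p.coeff 2) * X^2 + C (p.coeff 1) * X + C (p.coeff 0)) ∧
   (p.natDegree = 1 → p = X + C (p.coeff 0)) ∧
   (p.natDegree = 4 → p = X^4 + C (p.coeff 3) * X^3 + C (p.coeff 2) * X^2 + C (p.coeff 1) * X + C (p.coeff 0)) := by
  refine ⟨fun h => ?_, fun h => ?_, fun h => ?_, fun h => ?_⟩
  all_goals
    conv_lhs => rw [hp.as_sum, h]
    simp [Finset.sum_range_succ]
    try ring

theorem coeff_aux {R : Type*} [CommRing R] (a5 a4 a3 a2 a1 a0 b5 b4 b3 b2 b1 b0 : R)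
    (h : (X^6 + C b5*X^5 + C b4*X^4 + C b3*X^3 + C b2*X^2 + C b1*X + C b0 : R[X]) =
      X^6 + C a5*X^5 + C a4*X^4 + C a3*X^3 + C a2*X^2 + C a1*X + C a0) :
    a5 = b5 ∧ a4 = b4 ∧ a3 = b3 ∧ a2 = b2 ∧ a1 = b1 ∧ a0 = b0 := by
  have hc : ∀ k, _ := fun k => congrArg (fun p : R[X] => p.coeff k) h
  have c5 := hc 5; have c4 := hc 4; have c3 := hc 3; have c2 := hc 2; have c1 := hc 1; have c0 := hc 0
  simp [coeff_X, coeff_one, coeff_C] at c0 c1 c2 c3 c4 c5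
  exact ⟨c5.symm, c4.symm, c3.symm, c2.symm, c1.symm, c0.symm⟩

theorem fZ3_irr : Irreducible (fZ.map (Int.castRingHom (ZMod 3))) := by
  haveI : Fact (Nat.Prime 3) := ⟨by norm_num⟩
  have hm : (fZ.map (Int.castRingHom (ZMod 3))).Monic := fZ_monic.map _
  have hd : (fZ.map (Int.castRingHom (ZMod 3))).natDegree = 6 := by
    rw [fZ_monic.natDegree_map, fZ_natDegree]
  have hne : fZ.map (Int.castRingHom (ZMod 3)) ≠ 1 := by
    intro h; rw [h] at hd; simp at hd
  rw [hm.irreducible_iff_lt_natDegree_lt hne]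
  intro p hp hpd hdvd
  rw [hd] at hpd
  obtain ⟨r, hr⟩ := hdvd
  have hrm : r.Monic := hp.of_mul_monic_left (hr ▸ hm)
  have hdeg : p.natDegree + r.natDegree = 6 := by
    rw [← hp.natDegree_mul hrm, ← hr, hd]
  have hF : fZ.map (Int.castRingHom (ZMod 3)) = X^6 + 2*X^5 + X^4 + 2*X^3 + 6*X^2 + 4*X + 1 := by
    simp [fZ, Polynomial.map_ofNat]
  rw [hF] at hr
  simp only [Finset.mem_Ioc] at hpd
  obtain ⟨h2, h3, h1, h4⟩ := monic_form p hp
  obtain ⟨g2, g3, g1, g4⟩ := monic_form r hrm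
  have hcases : p.natDegree = 1 ∨ p.natDegree = 2 ∨ p.natDegree = 3 := by omega
  rcases hcases with h | h | h
  · have h0 : Polynomial.eval (-(p.coeff 0)) p = 0 := by
      conv_lhs => rw [h1 h]
      simp
    generalize -(p.coeff 0) = a at h0
    have h5 := congrArg (Polynomial.eval a) hr
    rw [eval_mul, h0, zero_mul] at h5
    simp only [eval_add, eval_mul, eval_pow, eval_X, eval_one, eval_ofNat] at h5
    exact key1 a h5
  · have hp' := h2 h
    have hr' := g4 (by omega)
    generalize p.coeff 1 = a at *
    generalize p.coeff 0 = b at *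
    generalize r.coeff 3 = c at *
    generalize r.coeff 2 = d at *
    generalize r.coeff 1 = e at *
    generalize r.coeff 0 = f at *
    have hm : p * r = X^6 + C (a+c)*X^5 + C (b+a*c+d)*X^4 + C (b*c+a*d+e)*X^3 + C (b*d+a*e+f)*X^2 + C (b*e+a*f)*X + C (b*f) := by
      rw [hp', hr']; simp only [map_add, map_mul]; ring
    rw [hm] at hr
    obtain ⟨c5, c4, c3, c2, c1, c0⟩ := coeff_aux _ _ _ _ _ _ (2 : ZMod 3) 1 2 6 4 1
      (by simpa only [map_ofNat, map_one, one_mul] using hr)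
    exact key2 a b c d e f c5 c4 c3 c2 c1 c0
  · have hp' := h3 h
    have hr' := g3 (by omega)
    generalize p.coeff 2 = a at *
    generalize p.coeff 1 = b at *
    generalize p.coeff 0 = c at *
    generalize r.coeff 2 = d at *
    generalize r.coeff 1 = e at *
    generalize r.coeff 0 = f at *
    have hm : p * r = X^6 + C (a+d)*X^5 + C (b+a*d+e)*X^4 + C (c+b*d+a*e+f)*X^3 + C (c*d+b*e+a*f)*X^2 + C (c*e+b*f)*X + C (c*f) := by
      rw [hp', hr']; simp only [map_add, map_mul]; ring
    rw [hm] at hr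
    obtain ⟨c5, c4, c3, c2, c1, c0⟩ := coeff_aux _ _ _ _ _ _ (2 : ZMod 3) 1 2 6 4 1
      (by simpa only [map_ofNat, map_one, one_mul] using hr)
    exact key3 a b c d e f c5 c4 c3 c2 c1 c0

theorem fZ_irr : Irreducible fZ :=
  Polynomial.Monic.irreducible_of_irreducible_map (Int.castRingHom (ZMod 3)) fZ fZ_monic fZ3_irr

noncomputable def fQ : ℚ[X] := X^6 + 2*X^5 + X^4 + 2*X^3 + 6*X^2 + 4*X + 1

theorem fQ_eq : fZ.map (Int.castRingHom ℚ) = fQ := by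
  simp [fZ, fQ, Polynomial.map_ofNat]

theorem fQ_irr : Irreducible fQ := by
  rw [← fQ_eq]
  exact (fZ_monic.irreducible_iff_irreducible_map_fraction_map (K := ℚ)).1 fZ_irr



structure Setup (L : Type) [Field L] [NumberField L] (θ ι : 𝓞 L) : Prop where
  hfin : Module.finrank ℚ L = 6
  hι : ι ^ 2 = -1
  hcub : θ ^ 3 = -(1 - 2 * ι) * θ ^ 2 + (2 + 2 * ι) * θ + 1
  hind : ∀ a0 a1 a2 a3 a4 a5 : ℚ, (a0 : L) + a1 * (θ : L) + a2 * (θ : L) ^ 2 + a3 * (θ : L) ^ 3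
    + a4 * (θ : L) ^ 4 + a5 * (θ : L) ^ 5 = 0 → a0 = 0 ∧ a1 = 0 ∧ a2 = 0 ∧ a3 = 0 ∧ a4 = 0 ∧ a5 = 0

theorem fQ_natDegree : fQ.natDegree = 6 := by unfold fQ; compute_degree!
theorem fQ_monic : fQ.Monic := by unfold fQ; monicity!

theorem exists_setup : ∃ (L : Type) (_ : Field L) (_ : NumberField L) (θ ι : 𝓞 L), Setup L θ ι := by
  haveI : Fact (Irreducible fQ) := ⟨fQ_irr⟩
  have hfin : Module.finrank ℚ (AdjoinRoot fQ) = 6 := by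
    rw [(AdjoinRoot.powerBasis fQ_irr.ne_zero).finrank, AdjoinRoot.powerBasis_dim, fQ_natDegree]
  haveI : FiniteDimensional ℚ (AdjoinRoot fQ) := FiniteDimensional.of_finrank_pos (by omega)
  haveI : NumberField (AdjoinRoot fQ) := ⟨⟩
  have hroot : (AdjoinRoot.root fQ)^6 + 2 * (AdjoinRoot.root fQ)^5 + (AdjoinRoot.root fQ)^4
      + 2 * (AdjoinRoot.root fQ)^3 + 6 * (AdjoinRoot.root fQ)^2 + 4 * (AdjoinRoot.root fQ) + 1 = 0 := by
    have h : AdjoinRoot.mk fQ (X^6 + 2*X^5 + X^4 + 2*X^3 + 6*X^2 + 4*X + 1) = 0 := AdjoinRoot.mk_self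
    simp only [map_add, map_mul, map_pow, AdjoinRoot.mk_X, map_one, map_ofNat] at h
    exact h
  have hind : ∀ a0 a1 a2 a3 a4 a5 : ℚ, (a0 : AdjoinRoot fQ) + a1 * (AdjoinRoot.root fQ)
    + a2 * (AdjoinRoot.root fQ) ^ 2 + a3 * (AdjoinRoot.root fQ) ^ 3
    + a4 * (AdjoinRoot.root fQ) ^ 4 + a5 * (AdjoinRoot.root fQ) ^ 5 = 0
    → a0 = 0 ∧ a1 = 0 ∧ a2 = 0 ∧ a3 = 0 ∧ a4 = 0 ∧ a5 = 0 := by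
    intro a0 a1 a2 a3 a4 a5 h
    have h1 : AdjoinRoot.mk fQ (C a0 + C a1 * X + C a2 * X ^ 2 + C a3 * X ^ 3 + C a4 * X ^ 4 + C a5 * X ^ 5) = 0 := by
      have hc : ∀ q : ℚ, AdjoinRoot.mk fQ (C q) = (q : AdjoinRoot fQ) := by
        intro q
        exact eq_ratCast ((AdjoinRoot.mk fQ).comp C) q
      simp only [map_add, map_mul, map_pow, hc, AdjoinRoot.mk_X]
      exact h
    rw [AdjoinRoot.mk_eq_zero] at h1
    have h2 := Polynomial.eq_zero_of_dvd_of_natDegree_lt h1 (by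
      rw [fQ_natDegree]
      refine lt_of_le_of_lt (b := 5) ?_ (by norm_num)
      compute_degree)
    have hc : ∀ k, _ := fun k => congrArg (fun p : ℚ[X] => p.coeff k) h2
    have c5 := hc 5; have c4 := hc 4; have c3 := hc 3; have c2 := hc 2; have c1 := hc 1; have c0 := hc 0
    simp [coeff_X, coeff_C] at c0 c1 c2 c3 c4 c5
    exact ⟨c0, c1, c2, c3, c4, c5⟩
  generalize AdjoinRoot.root fQ = t at hroot hind
  have h0 : t ≠ 0 := by
    intro h; have := hind 0 1 0 0 0 0 (by simp [h]); simp at this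
  have h1 : t + 1 ≠ 0 := by
    intro h; have := hind 1 1 0 0 0 0 (by simp; rw [add_comm]; exact h); simp at this
  have hD : 2 * t * (t + 1) ≠ 0 := mul_ne_zero (mul_ne_zero two_ne_zero h0) h1
  obtain ⟨i, hi⟩ : ∃ i, i = (t^3+t^2-2*t-1) / (2*t*(t+1)) := ⟨_, rfl⟩
  have hi' : i * (2*t*(t+1)) = t^3+t^2-2*t-1 := by rw [hi]; field_simp
  have hi2 : i^2 = -1 := by
    have : (i^2 + 1) * (2*t*(t+1))^2 = 0 := by
      have : (i^2 + 1) * (2*t*(t+1))^2 = (i * (2*t*(t+1)))^2 + (2*t*(t+1))^2 := by ring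
      rw [this, hi']; linear_combination hroot
    rcases mul_eq_zero.1 this with h | h
    · linear_combination h
    · exact absurd (pow_eq_zero_iff two_ne_zero |>.1 h) hD
  have it : IsIntegral ℤ t := by
    refine ⟨X^6 + 2*X^5 + X^4 + 2*X^3 + 6*X^2 + 4*X + 1, by monicity!, ?_⟩
    simp only [eval₂_add, eval₂_mul, eval₂_pow, eval₂_X, eval₂_one, eval₂_ofNat]
    exact hroot
  have ii : IsIntegral ℤ i := by
    refine ⟨X^2 + 1, by monicity!, ?_⟩
    simp only [eval₂_add, eval₂_pow, eval₂_X, eval₂_one]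
    rw [hi2]; ring
  refine ⟨AdjoinRoot fQ, inferInstance, inferInstance, ⟨t, it⟩, ⟨i, ii⟩, hfin, ?_, ?_, hind⟩
  · exact RingOfIntegers.ext hi2
  · have : t ^ 3 = -(1 - 2 * i) * t ^ 2 + (2 + 2 * i) * t + 1 := by linear_combination -hi'
    exact RingOfIntegers.ext this

section S3
variable {L : Type} [Field L] [NumberField L] {θ ι : 𝓞 L}

theorem Setup.hιL (S : Setup L θ ι) : (ι : L) ^ 2 = -1 := by
  have := congrArg (fun x : 𝓞 L => (x : L)) S.hι
  simpa using this

theorem Setup.hcubL (S : Setup L θ ι) : (θ : L) ^ 3 = -(1 - 2 * ι) * (θ : L) ^ 2 + (2 + 2 * (ι : L)) * θ + 1 := by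
  exact congrArg (fun x : 𝓞 L => (x : L)) S.hcub

theorem Setup.indb (S : Setup L θ ι) (a0 a1 a2 b0 b1 b2 : ℚ)
    (h : (a0 : L) + a1 * θ + a2 * (θ : L) ^ 2 + b0 * ι + b1 * (ι * θ) + b2 * (ι * (θ : L) ^ 2) = 0) :
    a0 = 0 ∧ a1 = 0 ∧ a2 = 0 ∧ b0 = 0 ∧ b1 = 0 ∧ b2 = 0 := by
  have hc := S.hcubL
  have h1 := S.hind (-b0) (2*a0 - 2 * b0 - b1) (2 * a0 + 2 * a1 + b0 - 2 * b1 - b2)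
    (2 * a1 + 2 * a2 + b0 + b1 - 2 * b2) (2 * a2 + b1 + b2) b2 (by
    push_cast
    linear_combination (2 * (θ : L) * (θ + 1)) * h + ((b0 : L) + b1 * θ + b2 * (θ : L) ^ 2) * hc)
  obtain ⟨h0, h1, h2, h3, h4, h5⟩ := h1
  refine ⟨?_, ?_, ?_, ?_, ?_, ?_⟩ <;> linarith

noncomputable def bfam (θ ι : 𝓞 L) : Fin 6 → 𝓞 L := ![1, θ, θ ^ 2, ι, ι * θ, ι * θ ^ 2]
noncomputable def bfamL (θ ι : 𝓞 L) : Fin 6 → L := ![1, θ, (θ : L) ^ 2, ι, ι * θ, ι * (θ : L) ^ 2]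

theorem Setup.linInd (S : Setup L θ ι) : LinearIndependent ℚ (bfamL θ ι) := by
  rw [Fintype.linearIndependent_iff]
  intro g hg
  simp only [Fin.sum_univ_six, bfamL, Algebra.smul_def, eq_ratCast] at hg
  simp at hg
  obtain ⟨h0, h1, h2, h3, h4, h5⟩ := S.indb (g 0) (g 1) (g 2) (g 3) (g 4) (g 5) hg
  intro i; fin_cases i <;> assumption

noncomputable def Setup.bas (S : Setup L θ ι) : Module.Basis (Fin 6) ℚ L :=
  basisOfLinearIndependentOfCardEqFinrank S.linInd (by rw [S.hfin]; simp)

theorem Setup.bas_coe (S : Setup L θ ι) : ⇑S.bas = bfamL θ ι := by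
  simp [Setup.bas]

theorem Setup.repr_of (S : Setup L θ ι) (v : L) (c : Fin 6 → ℚ)
   (h : v = c 0 + c 1 * θ + c 2 * (θ : L) ^ 2 + c 3 * ι + c 4 * (ι * θ) + c 5 * (ι * (θ : L) ^ 2)) (i : Fin 6) :
    S.bas.repr v i = c i := by
  have : v = ∑ i, c i • S.bas i := by
    rw [h, S.bas_coe]
    simp [Fin.sum_univ_six, bfamL, Algebra.smul_def]
  rw [this, S.bas.repr_sum_self]

def Mθ : Matrix (Fin 6) (Fin 6) ℤ := !![0, 0, 1, 0, 0, 0; 1, 0, 2, 0, 0, -2; 0, 1, -1, 0, 0, -2; 0, 0, 0, 0, 0, 1; 0, 0, 2, 1, 0, 2; 0, 0, 2, 0, 1, -1]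
def Mι : Matrix (Fin 6) (Fin 6) ℤ := !![0, 0, 0, -1, 0, 0; 0, 0, 0, 0, -1, 0; 0, 0, 0, 0, 0, -1; 1, 0, 0, 0, 0, 0; 0, 1, 0, 0, 0, 0; 0, 0, 1, 0, 0, 0]
def MT : Matrix (Fin 6) (Fin 6) ℤ := !![6, -2, 2, 0, -4, 0; -2, 2, -8, -4, 0, -8; 2, -8, -6, 0, -8, 16; 0, -4, 0, -6, 2, -2; -4, 0, -8, 2, -2, 8; 0, -8, 16, -2, 8, 6]
def MP : Matrix (Fin 6) (Fin 6) ℤ := !![1, 1, 3, 14, 132, 0; 0, 3, 11, 20, -70, 14; 0, 0, 2, -22, -104, 4; 0, 0, 0, 47, 107, -13; 0, 0, 0, 0, 181, -5; 0, 0, 0, 0, 0, 6]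
def MD : Matrix (Fin 6) (Fin 6) ℤ := !![6, 0, 0, 0, 0, 0; -2, 4, 0, 0, 0, 0; 2, -22, -94, 0, 0, 0; 0, -12, -44, -362, 0, 0; -4, -4, -28, 214, 156, 0; 0, -24, -56, -606, 130, -26]

theorem MT_det : MT.det = -10816 := by
  have h1 : MT * MP = MD := by decide +kernel
  have h2 : MP.det = 3 * 2 * 47 * 181 * 6 := by
    rw [Matrix.det_of_upperTriangular]
    · simp [Fin.prod_univ_six, MP]
    · intro i j hij
      have h : (Matrix.of fun i j => if j < i then MP i j else 0) = 0 := by decide +kernel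
      have h2 := congrFun (congrFun h i) j
      rw [Matrix.of_apply, if_pos (show j < i from hij)] at h2
      exact h2
  have h3 : MD.det = 6 * 4 * (-94) * (-362) * 156 * (-26) := by
    rw [Matrix.det_of_lowerTriangular]
    · simp [Fin.prod_univ_six, MD]
    · intro i j hij
      have h : (Matrix.of fun i j => if i < j then MD i j else 0) = 0 := by decide +kernel
      have h2 := congrFun (congrFun h i) j
      rw [Matrix.of_apply, if_pos (OrderDual.toDual_lt_toDual.1 hij)] at h2
      exact h2
  have := congrArg Matrix.det h1
  rw [Matrix.det_mul, h2, h3] at this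
  omega

theorem Setup.matθ (S : Setup L θ ι) : Algebra.leftMulMatrix S.bas (θ : L) = Mθ.map (fun n : ℤ => (n : ℚ)) := by
  have hc := S.hcubL
  have hi := S.hιL
  ext i j
  rw [Algebra.leftMulMatrix_eq_repr_mul, S.bas_coe]
  apply S.repr_of _ (fun i => ((Mθ i j : ℤ) : ℚ))
  fin_cases j <;> simp [bfamL, Mθ]
  · ring
  · linear_combination hc
  · ring
  · ring
  · linear_combination (ι : L) * hc + (2 * (θ : L) ^ 2 + 2 * θ) * hi

theorem Setup.matι (S : Setup L θ ι) : Algebra.leftMulMatrix S.bas (ι : L) = Mι.map (fun n : ℤ => (n : ℚ)) := by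
  have hi := S.hιL
  ext i j
  rw [Algebra.leftMulMatrix_eq_repr_mul, S.bas_coe]
  apply S.repr_of _ (fun i => ((Mι i j : ℤ) : ℚ))
  fin_cases j <;> simp [bfamL, Mι]
  · linear_combination hi
  · linear_combination (θ : L) * hi
  · linear_combination (θ : L) ^ 2 * hi

def Mfam : Fin 6 → Matrix (Fin 6) (Fin 6) ℤ := ![1, Mθ, Mθ ^ 2, Mι, Mι * Mθ, Mι * Mθ ^ 2]

theorem Setup.matfam (S : Setup L θ ι) (i : Fin 6) :
    Algebra.leftMulMatrix S.bas (bfamL θ ι i) = (Int.castRingHom ℚ).mapMatrix (Mfam i) := by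
  have h1 : Algebra.leftMulMatrix S.bas (θ : L) = (Int.castRingHom ℚ).mapMatrix Mθ := S.matθ
  have h2 : Algebra.leftMulMatrix S.bas (ι : L) = (Int.castRingHom ℚ).mapMatrix Mι := S.matι
  fin_cases i
  · simp only [bfamL, Mfam]; simp
  · exact h1
  · change Algebra.leftMulMatrix S.bas ((θ : L) ^ 2) = (Int.castRingHom ℚ).mapMatrix (Mθ ^ 2)
    rw [map_pow, map_pow, h1]
  · exact h2
  · change Algebra.leftMulMatrix S.bas ((ι : L) * θ) = (Int.castRingHom ℚ).mapMatrix (Mι * Mθ)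
    rw [map_mul, map_mul, h1, h2]
  · change Algebra.leftMulMatrix S.bas ((ι : L) * (θ : L) ^ 2) = (Int.castRingHom ℚ).mapMatrix (Mι * Mθ ^ 2)
    rw [map_mul, map_mul, map_pow, map_pow, h1, h2]

theorem Mfam_tr (i j : Fin 6) : (Mfam i * Mfam j).trace = MT i j := by
  have h : (Matrix.of fun i j => (Mfam i * Mfam j).trace) = MT := by decide +kernel
  exact congrFun (congrFun h i) j

theorem bfam_coe (i : Fin 6) : ((bfam θ ι i : 𝓞 L) : L) = bfamL θ ι i := by
  fin_cases i <;> simp [bfam, bfamL]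

theorem Setup.discr_fam (S : Setup L θ ι) : Algebra.discr ℤ (bfam θ ι) = -10816 := by
  rw [Algebra.discr_def, ← MT_det]
  congr 1
  ext i j
  rw [Algebra.traceMatrix_apply, Algebra.traceForm_apply]
  have h := Algebra.coe_trace_int (K := L) (bfam θ ι i * bfam θ ι j)
  have h0 : ((bfam θ ι i * bfam θ ι j : 𝓞 L) : L) = bfamL θ ι i * bfamL θ ι j := by
    rw [← bfam_coe, ← bfam_coe]; rfl
  rw [h0, Algebra.trace_eq_matrix_trace S.bas, map_mul (Algebra.leftMulMatrix S.bas), S.matfam, S.matfam, ← map_mul (Int.castRingHom ℚ).mapMatrix] at h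
  have h2 : ((Int.castRingHom ℚ).mapMatrix (Mfam i * Mfam j)).trace = (((Mfam i * Mfam j).trace : ℤ) : ℚ) := by
    exact (AddMonoidHom.map_trace (Int.castRingHom ℚ) (Mfam i * Mfam j)).symm
  rw [h2, Mfam_tr] at h
  exact_mod_cast h

theorem Setup.discr_le (S : Setup L θ ι) : |discr L| ≤ 10816 := by
  have hr : Module.finrank ℤ (𝓞 L) = 6 := by rw [RingOfIntegers.rank, S.hfin]
  obtain ⟨B⟩ : Nonempty (Module.Basis (Fin 6) ℤ (𝓞 L)) := ⟨Module.finBasisOfFinrankEq ℤ _ hr⟩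
  have h1 : Algebra.discr ℤ (bfam θ ι) = (Matrix.of fun i j => B.repr (bfam θ ι j) i).det ^ 2 * Algebra.discr ℤ B := by
    rw [← Algebra.discr_of_matrix_vecMul]
    congr 1
    ext j
    congr 1
    have := B.sum_repr (bfam θ ι j)
    conv_lhs => rw [← this]
    simp [Matrix.vecMul, dotProduct, Algebra.smul_def, mul_comm]
  rw [NumberField.discr_eq_discr, S.discr_fam] at h1
  generalize (Matrix.of fun i j => B.repr (bfam θ ι j) i).det = d at h1
  have hd : d ≠ 0 := by rintro rfl; simp at h1
  have : 1 ≤ d ^ 2 := by have := sq_nonneg d; have : d ^ 2 ≠ 0 := pow_ne_zero 2 hd; omega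
  have h2 : (10816 : ℤ) = d ^ 2 * |discr L| := by
    rw [← abs_of_nonneg (sq_nonneg d), ← abs_mul, ← h1]; rfl
  nlinarith [abs_nonneg (discr L)]

theorem Setup.tc (S : Setup L θ ι) : IsTotallyComplex L := by
  refine ⟨fun v => ?_⟩
  rw [InfinitePlace.isComplex_iff]
  intro hre
  have h := ComplexEmbedding.IsReal.coe_embedding_apply hre (ι : L)
  have h2 := congrArg (InfinitePlace.embedding v) S.hιL
  rw [map_pow, map_neg, map_one, ← h] at h2
  have h3 : (hre.embedding (ι : L)) ^ 2 = -1 := by exact_mod_cast h2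
  nlinarith [sq_nonneg (hre.embedding (ι : L))]

theorem Setup.nrc (S : Setup L θ ι) : InfinitePlace.nrComplexPlaces L = 3 ∧ InfinitePlace.nrRealPlaces L = 0 := by
  haveI := S.tc
  have h1 := IsTotallyComplex.finrank (K := L)
  have h2 := IsTotallyComplex.nrRealPlaces_eq_zero L
  rw [S.hfin] at h1
  omega
end S3
section S4
variable {L : Type} [Field L] [NumberField L] {θ ι : 𝓞 L}

theorem Setup.froot (S : Setup L θ ι) : θ ^ 6 + 2 * θ ^ 5 + θ ^ 4 + 2 * θ ^ 3 + 6 * θ ^ 2 + 4 * θ + 1 = 0 := by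
  have h1 := S.hι
  have h2 := S.hcub
  linear_combination (θ ^ 3 + (1 + 2 * ι) * θ ^ 2 - (2 - 2 * ι) * θ - 1) * h2 + (4 * θ ^ 4 + 8 * θ ^ 3 + 4 * θ ^ 2) * h1

theorem zmodroot2 : ∀ a : ZMod 2, a ^ 6 + 2 * a ^ 5 + a ^ 4 + 2 * a ^ 3 + 6 * a ^ 2 + 4 * a + 1 ≠ 0 := by decide
theorem zmodroot3 : ∀ a : ZMod 3, a ^ 6 + 2 * a ^ 5 + a ^ 4 + 2 * a ^ 3 + 6 * a ^ 2 + 4 * a + 1 ≠ 0 := by decide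

theorem Setup.noNorm (S : Setup L θ ι) (p : ℕ) [hp : Fact p.Prime]
    (hr : ∀ a : ZMod p, a ^ 6 + 2 * a ^ 5 + a ^ 4 + 2 * a ^ 3 + 6 * a ^ 2 + 4 * a + 1 ≠ 0)
    (I : Ideal (𝓞 L)) (hI : Ideal.absNorm I = p) : False := by
  have hc : Nat.card (𝓞 L ⧸ I) = p := hI
  haveI : Finite (𝓞 L ⧸ I) := Nat.finite_of_card_ne_zero (by rw [hc]; exact hp.out.ne_zero)
  haveI := Fintype.ofFinite (𝓞 L ⧸ I)
  rw [Nat.card_eq_fintype_card] at hc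
  let e := ZMod.ringEquivOfPrime (𝓞 L ⧸ I) hp.out hc
  have h := congrArg (fun x => e.symm (Ideal.Quotient.mk I x)) S.froot
  simp only [map_add, map_mul, map_pow, map_one, map_ofNat, map_zero] at h
  exact hr _ h

theorem Setup.pid (S : Setup L θ ι) : IsPrincipalIdealRing (𝓞 L) := by
  apply RingOfIntegers.isPrincipalIdealRing_of_isPrincipal_of_norm_le
  intro I hI
  have hM : (Ideal.absNorm (I : Ideal (𝓞 L)) : ℝ) < 4 := by
    refine lt_of_le_of_lt hI ?_
    rw [S.nrc.1, S.hfin]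
    have h1 : √|((discr L : ℤ) : ℝ)| ≤ 104 := by
      rw [show (104 : ℝ) = √10816 by
        rw [show (10816 : ℝ) = 104 ^ 2 by norm_num, Real.sqrt_sq (by norm_num)]]
      apply Real.sqrt_le_sqrt
      have := S.discr_le
      exact_mod_cast this
    have h2 : 4 / Real.pi ≤ 4 / 3 := by
      apply div_le_div_of_nonneg_left <;> linarith [Real.pi_gt_three]
    have h3 : (4 / Real.pi) ^ 3 ≤ (4 / 3) ^ 3 := by
      apply pow_le_pow_left₀ _ h2
      have := Real.pi_pos; positivity
    have h4 : ((Nat.factorial 6 : ℕ) : ℝ) / ((6 : ℕ) : ℝ) ^ 6 * √|((discr L : ℤ) : ℝ)| ≤ 1.61 := by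
      have : ((Nat.factorial 6 : ℕ) : ℝ) / ((6 : ℕ) : ℝ) ^ 6 = 720 / 46656 := by norm_num [Nat.factorial]
      rw [this]; nlinarith
    calc _ ≤ (4 / 3 : ℝ) ^ 3 * 1.61 := by
          apply mul_le_mul h3 h4 (by positivity) (by norm_num)
      _ < 4 := by norm_num
  have hM2 : Ideal.absNorm (I : Ideal (𝓞 L)) < 4 := by exact_mod_cast hM
  have h0 : Ideal.absNorm (I : Ideal (𝓞 L)) ≠ 0 := (Ideal.absNorm_pos_of_nonZeroDivisors I).ne'
  haveI : Fact (Nat.Prime 2) := ⟨by norm_num⟩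
  haveI : Fact (Nat.Prime 3) := ⟨by norm_num⟩
  have h2 := S.noNorm 2 zmodroot2 I
  have h3 := S.noNorm 3 zmodroot3 I
  have h1 : Ideal.absNorm (I : Ideal (𝓞 L)) = 1 := by
    by_contra h
    have : Ideal.absNorm (I : Ideal (𝓞 L)) = 2 ∨ Ideal.absNorm (I : Ideal (𝓞 L)) = 3 := by omega
    tauto
  rw [Ideal.absNorm_eq_one_iff] at h1
  rw [h1]
  exact inferInstance
end S4

section S5
variable {L : Type} [Field L] [NumberField L] {θ ι : 𝓞 L}

structure Z6 where
  a0 : ℤ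
  a1 : ℤ
  a2 : ℤ
  b0 : ℤ
  b1 : ℤ
  b2 : ℤ

def Z6.ev (θ ι : 𝓞 L) (v : Z6) : 𝓞 L :=
  v.a0 + v.a1 * θ + v.a2 * θ ^ 2 + v.b0 * ι + v.b1 * (ι * θ) + v.b2 * (ι * θ ^ 2)

def Z6.sub (u v : Z6) : Z6 := ⟨u.a0 - v.a0, u.a1 - v.a1, u.a2 - v.a2, u.b0 - v.b0, u.b1 - v.b1, u.b2 - v.b2⟩

def Z6.mulθ (v : Z6) : Z6 :=
  ⟨v.a2, v.a0 + 2 * v.a2 - 2 * v.b2, v.a1 - v.a2 - 2 * v.b2, v.b2, v.b0 + 2 * v.b2 + 2 * v.a2, v.b1 - v.b2 + 2 * v.a2⟩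
def Z6.mulι (v : Z6) : Z6 := ⟨-v.b0, -v.b1, -v.b2, v.a0, v.a1, v.a2⟩
def Z6.lin (k : ℤ) (v w : Z6) : Z6 := ⟨k * v.a0 + w.a0, k * v.a1 + w.a1, k * v.a2 + w.a2, k * v.b0 + w.b0, k * v.b1 + w.b1, k * v.b2 + w.b2⟩
def Z6.mul (u v : Z6) : Z6 :=
  Z6.lin u.a0 v (Z6.lin u.a1 v.mulθ (Z6.lin u.a2 v.mulθ.mulθ (Z6.lin u.b0 v.mulι
    (Z6.lin u.b1 v.mulθ.mulι (Z6.lin u.b2 v.mulθ.mulθ.mulι ⟨0,0,0,0,0,0⟩)))))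

theorem Z6.ev_sub (u v : Z6) : (u.sub v).ev θ ι = u.ev θ ι - v.ev θ ι := by
  simp only [Z6.ev, Z6.sub]; push_cast; ring

theorem Z6.ev_lin (k : ℤ) (u v : Z6) : (Z6.lin k u v).ev θ ι = k * u.ev θ ι + v.ev θ ι := by
  simp only [Z6.ev, Z6.lin]; push_cast; ring

theorem Z6.ev_mulθ (S : Setup L θ ι) (v : Z6) : v.mulθ.ev θ ι = θ * v.ev θ ι := by
  have h1 := S.hι
  have h2 := S.hcub
  simp only [Z6.ev, Z6.mulθ]; push_cast
  linear_combination (-(v.a2 : 𝓞 L) - v.b2 * ι) * h2 - (v.b2 * (2 * θ ^ 2 + 2 * θ)) * h1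

theorem Z6.ev_mulι (S : Setup L θ ι) (v : Z6) : v.mulι.ev θ ι = ι * v.ev θ ι := by
  have h1 := S.hι
  simp only [Z6.ev, Z6.mulι]; push_cast
  linear_combination (-(v.b0 : 𝓞 L) - v.b1 * θ - v.b2 * θ ^ 2) * h1

theorem Z6.ev_mul (S : Setup L θ ι) (u v : Z6) : (u.mul v).ev θ ι = u.ev θ ι * v.ev θ ι := by
  rw [Z6.mul]
  simp only [Z6.ev_lin, Z6.ev_mulθ S, Z6.ev_mulι S]
  simp only [Z6.ev]; push_cast; ring

theorem normpi (S : Setup L θ ι) : Ideal.absNorm (Ideal.span {(1 + ι : 𝓞 L)}) = 8 := by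
  rw [Ideal.absNorm_span_singleton]
  have hr : Module.finrank ℤ (𝓞 L) = 6 := by rw [RingOfIntegers.rank, S.hfin]
  have h1 : (1 + ι) ^ 2 = algebraMap ℤ (𝓞 L) 2 * ι := by
    have := S.hι
    simp only [map_ofNat]
    linear_combination this
  have h2 := congrArg (Algebra.norm ℤ) h1
  rw [map_pow, map_mul, Algebra.norm_algebraMap, hr] at h2
  have h3 := congrArg (Algebra.norm ℤ) S.hι
  have h4 : (Algebra.norm ℤ (ι : 𝓞 L)) ^ 2 = 1 := by
    rw [← map_pow, S.hι, show (-1 : 𝓞 L) = algebraMap ℤ (𝓞 L) (-1) by simp, Algebra.norm_algebraMap, hr]; norm_num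
  generalize Algebra.norm ℤ (1 + ι : 𝓞 L) = n at *
  generalize Algebra.norm ℤ (ι : 𝓞 L) = m at *
  rcases (by have h5 : (m - 1) * (m + 1) = 0 := by linear_combination h4
             rcases mul_eq_zero.1 h5 with h | h <;> omega : m = 1 ∨ m = -1) with rfl | rfl
  · have h5 : (n - 8) * (n + 8) = 0 := by linear_combination h2
    rcases mul_eq_zero.1 h5 with h | h
    · rw [show n = 8 by omega]; rfl
    · rw [show n = -8 by omega]; rfl
  · nlinarith [sq_nonneg n]

theorem pi_not_unit (S : Setup L θ ι) : ¬ IsUnit (1 + ι : 𝓞 L) := by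
  intro h
  have := normpi S
  rw [Ideal.span_singleton_eq_top.2 h] at this
  simp at this

/-- nonzero classes mod 2 are coprime to 2 -/
theorem inv_mod2 (S : Setup L θ ι) (a0 a1 a2 : ℤ) (h : ¬ (2 ∣ a0 ∧ 2 ∣ a1 ∧ 2 ∣ a2)) :
    ∃ u v : 𝓞 L, ((a0 : 𝓞 L) + a1 * θ + a2 * θ ^ 2) * u = 1 + 2 * v := by
  have hc := S.hcub
  obtain ⟨k0, e0, rfl, h0⟩ : ∃ k e : ℤ, a0 = 2 * k + e ∧ (e = 0 ∨ e = 1) := ⟨a0 / 2, a0 % 2, by omega, by omega⟩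
  obtain ⟨k1, e1, rfl, h1⟩ : ∃ k e : ℤ, a1 = 2 * k + e ∧ (e = 0 ∨ e = 1) := ⟨a1 / 2, a1 % 2, by omega, by omega⟩
  obtain ⟨k2, e2, rfl, h2⟩ : ∃ k e : ℤ, a2 = 2 * k + e ∧ (e = 0 ∨ e = 1) := ⟨a2 / 2, a2 % 2, by omega, by omega⟩
  suffices hs : ∃ u v : 𝓞 L, ((e0 : 𝓞 L) + e1 * θ + e2 * θ ^ 2) * u = 1 + 2 * v by
    obtain ⟨u, v, huv⟩ := hs
    refine ⟨u, v + (k0 + k1 * θ + k2 * θ ^ 2) * u, ?_⟩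
    push_cast
    linear_combination huv
  have hh : θ ^ 3 + θ ^ 2 + 1 = 2 * (ι * θ ^ 2 + (1 + ι) * θ + 1) := by linear_combination hc
  rcases h0 with rfl | rfl <;> rcases h1 with rfl | rfl <;> rcases h2 with rfl | rfl
  · exfalso; apply h; omega
  · refine ⟨1 + θ, (ι * θ ^ 2 + (1 + ι) * θ + 1) - 1, ?_⟩
    push_cast; linear_combination hh
  · refine ⟨θ + θ ^ 2, (ι * θ ^ 2 + (1 + ι) * θ + 1) - 1, ?_⟩
    push_cast; linear_combination hh
  · refine ⟨θ, (ι * θ ^ 2 + (1 + ι) * θ + 1) - 1, ?_⟩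
    push_cast; linear_combination hh
  · exact ⟨1, 0, by push_cast; ring⟩
  · refine ⟨1 + θ + θ ^ 2, θ * (ι * θ ^ 2 + (1 + ι) * θ + 1) + θ ^ 2, ?_⟩
    push_cast; linear_combination θ * hh
  · refine ⟨θ ^ 2, (ι * θ ^ 2 + (1 + ι) * θ + 1) - 1, ?_⟩
    push_cast; linear_combination hh
  · refine ⟨1 + θ ^ 2, θ * (ι * θ ^ 2 + (1 + ι) * θ + 1) + θ ^ 2, ?_⟩
    push_cast; linear_combination θ * hh

theorem two_eq_pi (S : Setup L θ ι) : (2 : 𝓞 L) = (1 + ι) * (1 - ι) := by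
  linear_combination S.hι

theorem pi_dvd (S : Setup L θ ι) (v : Z6) (h : (1 + ι) ∣ v.ev θ ι) :
    2 ∣ v.a0 + v.b0 ∧ 2 ∣ v.a1 + v.b1 ∧ 2 ∣ v.a2 + v.b2 := by
  by_contra hn
  obtain ⟨u, w, huw⟩ := inv_mod2 S _ _ _ hn
  obtain ⟨t, ht⟩ := h
  apply pi_not_unit S
  refine IsUnit.of_mul_eq_one ((t - ι * (v.b0 + v.b1 * θ + v.b2 * θ ^ 2)) * u - (1 - ι) * w) ?_
  have hi := S.hι
  rw [Z6.ev] at ht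
  push_cast at huw
  linear_combination huw - u * ht - ((v.b0 + v.b1 * θ + v.b2 * θ ^ 2) * u - w) * hi

theorem two_dvd (S : Setup L θ ι) (v : Z6) (h : 2 ∣ v.ev θ ι) :
    (2 ∣ v.a0 ∧ 2 ∣ v.a1 ∧ 2 ∣ v.a2) ∧ (2 ∣ v.b0 ∧ 2 ∣ v.b1 ∧ 2 ∣ v.b2) := by
  have hi := S.hι
  have h1 := pi_dvd S v ((Dvd.intro _ (two_eq_pi S).symm).trans h)
  obtain ⟨⟨k0, h0⟩, ⟨k1, h1⟩, ⟨k2, h2⟩⟩ := h1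
  have hpi : (1 + ι : 𝓞 L) ≠ 0 := by
    intro h0
    have := two_eq_pi S
    rw [h0, zero_mul] at this
    exact two_ne_zero this
  have h0' : (v.a0 : 𝓞 L) = 2 * k0 - v.b0 := by rw [show v.a0 = 2 * k0 - v.b0 by omega]; push_cast; ring
  have h1' : (v.a1 : 𝓞 L) = 2 * k1 - v.b1 := by rw [show v.a1 = 2 * k1 - v.b1 by omega]; push_cast; ring
  have h2' : (v.a2 : 𝓞 L) = 2 * k2 - v.b2 := by rw [show v.a2 = 2 * k2 - v.b2 by omega]; push_cast; ring
  obtain ⟨t, ht⟩ := h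
  have h3 : Z6.ev θ ι ⟨k0, k1, k2, v.b0 - k0, v.b1 - k1, v.b2 - k2⟩ = (1 + ι) * (-ι * t) := by
    apply mul_left_cancel₀ hpi
    rw [Z6.ev] at ht ⊢
    rw [h0', h1', h2'] at ht
    push_cast
    linear_combination ht + ((v.b0 - k0 : 𝓞 L) + (v.b1 - k1) * θ + (v.b2 - k2) * θ ^ 2 + ι * t + 2 * t) * hi
  have h4 := pi_dvd S _ (Dvd.intro _ h3.symm)
  dsimp only at h4
  omega

def cv (c : Fin 2 × Fin 2 × Fin 2) : Z6 := ⟨(c.1.val : ℤ), (c.2.1.val : ℤ), (c.2.2.val : ℤ), 0, 0, 0⟩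

theorem repr_pi (S : Setup L θ ι) (s : 𝓞 L) : ∃ c, (1 + ι) ∣ s - (cv c).ev θ ι := by
  have hc : Nat.card (𝓞 L ⧸ Ideal.span {(1 + ι : 𝓞 L)}) = 8 := normpi S
  haveI : Finite (𝓞 L ⧸ Ideal.span {(1 + ι : 𝓞 L)}) := Nat.finite_of_card_ne_zero (by rw [hc]; norm_num)
  let φ : Fin 2 × Fin 2 × Fin 2 → 𝓞 L ⧸ Ideal.span {(1 + ι : 𝓞 L)} := fun c => Ideal.Quotient.mk _ ((cv c).ev θ ι)
  have hinj : Function.Injective φ := by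
    intro c d hcd
    have h1 := Ideal.Quotient.eq.1 hcd
    rw [Ideal.mem_span_singleton, ← Z6.ev_sub] at h1
    have h2 := pi_dvd S _ h1
    obtain ⟨c0, c1, c2⟩ := c
    obtain ⟨d0, d1, d2⟩ := d
    simp only [Z6.sub, cv] at h2
    ext <;> simp <;> omega
  have hb : Function.Bijective φ := hinj.bijective_of_nat_card_le (by rw [hc]; simp)
  obtain ⟨c, hc⟩ := hb.2 (Ideal.Quotient.mk _ s)
  refine ⟨c, ?_⟩
  rw [← Ideal.mem_span_singleton]
  exact Ideal.Quotient.eq.1 hc.symm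

theorem sq_mod2 (S : Setup L θ ι) (s : 𝓞 L) : ∃ c t, s ^ 2 = ((cv c).mul (cv c)).ev θ ι + 2 * t := by
  obtain ⟨c, t, h⟩ := repr_pi S s
  have hi := S.hι
  refine ⟨c, (cv c).ev θ ι * (1 + ι) * t + ι * t ^ 2, ?_⟩
  rw [Z6.ev_mul S, show s = (cv c).ev θ ι + (1 + ι) * t by linear_combination h]
  linear_combination t ^ 2 * hi

def zone : Z6 := ⟨1, 0, 0, 0, 0, 0⟩
def ziota : Z6 := ⟨0, 0, 0, 1, 0, 0⟩
def zeps : Z6 := ⟨1, 1, 0, 0, 1, 1⟩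
def zeps2 : Z6 := ⟨1, 0, -1, 1, 1, 0⟩
def zpow (b : Fin 2) (z : Z6) : Z6 := if b = 0 then zone else z
def uv (x : Fin 2 × Fin 2 × Fin 2) : Z6 := ((zpow x.1 ziota).mul (zpow x.2.1 zeps)).mul (zpow x.2.2 zeps2)

def allEven (v : Z6) : Bool := v.a0 % 2 == 0 && v.a1 % 2 == 0 && v.a2 % 2 == 0 && v.b0 % 2 == 0 && v.b1 % 2 == 0 && v.b2 % 2 == 0

theorem uv_dec : ∀ x y c : Fin 2 × Fin 2 × Fin 2, allEven ((uv x).sub ((uv y).mul ((cv c).mul (cv c)))) = true → x = y := by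
  decide +kernel

theorem uv_inj (S : Setup L θ ι) (x y : Fin 2 × Fin 2 × Fin 2) (s t : 𝓞 L)
    (h : (uv x).ev θ ι = (uv y).ev θ ι * (s ^ 2 + 2 * t)) : x = y := by
  obtain ⟨c, r, hr⟩ := sq_mod2 S s
  apply uv_dec x y c
  have h1 := two_dvd S ((uv x).sub ((uv y).mul ((cv c).mul (cv c)))) ⟨(uv y).ev θ ι * (r + t), by
    rw [Z6.ev_sub, Z6.ev_mul S, h, hr]; ring⟩
  obtain ⟨⟨h0, h1, h2⟩, h3, h4, h5⟩ := h1
  simp [allEven, Int.emod_eq_zero_of_dvd h0, Int.emod_eq_zero_of_dvd h1, Int.emod_eq_zero_of_dvd h2,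
    Int.emod_eq_zero_of_dvd h3, Int.emod_eq_zero_of_dvd h4, Int.emod_eq_zero_of_dvd h5]

theorem uv_unit (S : Setup L θ ι) (x : Fin 2 × Fin 2 × Fin 2) : IsUnit ((uv x).ev θ ι) := by
  have hi := S.hι
  have hc := S.hcub
  have h1 : zone.ev θ ι = 1 := by simp [zone, Z6.ev]
  have hz : ∀ b z, IsUnit (z.ev θ ι) → IsUnit ((zpow b z).ev θ ι) := by
    intro b z hz
    unfold zpow; split_ifs
    · rw [h1]; exact isUnit_one
    · exact hz
  have key : ∀ u v : Z6, u.mul v = zone → IsUnit (u.ev θ ι) := fun u v huv =>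
    IsUnit.of_mul_eq_one (v.ev θ ι) (by rw [← Z6.ev_mul S, huv, h1])
  rw [uv, Z6.ev_mul S, Z6.ev_mul S]
  refine ((hz _ _ ?_).mul (hz _ _ ?_)).mul (hz _ _ ?_)
  · exact key _ ⟨0, 0, 0, -1, 0, 0⟩ rfl
  · exact key _ ⟨2, -1, -1, 1, 2, 0⟩ rfl
  · exact key _ ⟨1, 1, 0, -1, 0, 0⟩ rfl

theorem zpow_mod2 {G : Type*} [CommGroup G] (g : G) (k : ℤ) : ∃ (b : Fin 2) (w : G), g ^ k = g ^ b.val * w ^ 2 := by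
  obtain ⟨m, rfl | rfl⟩ := Int.even_or_odd' k
  · exact ⟨0, g ^ m, by rw [zpow_mul, zpow_ofNat]; simp; rw [← zpow_natCast, ← zpow_natCast, ← zpow_mul, ← zpow_mul, mul_comm]⟩
  · refine ⟨1, g ^ m, ?_⟩
    rw [zpow_add, zpow_one, mul_comm, mul_comm 2 m, zpow_mul]
    simp

theorem unit_classes (S : Setup L θ ι) : ∃ M : Fin 2 × Fin 2 × Fin 2 → (𝓞 L)ˣ, ∀ u, ∃ τ w, u = M τ * w ^ 2 := by
  have hrank : Units.rank L = 2 := by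
    rw [Units.rank, InfinitePlace.card_eq_nrRealPlaces_add_nrComplexPlaces, S.nrc.1, S.nrc.2]
  obtain ⟨g, hg⟩ := IsCyclic.exists_generator (α := Units.torsion L)
  refine ⟨fun τ => (g : (𝓞 L)ˣ) ^ τ.1.val * (Units.fundSystem L (Fin.cast hrank.symm 0)) ^ τ.2.1.val *
    (Units.fundSystem L (Fin.cast hrank.symm 1)) ^ τ.2.2.val, fun u => ?_⟩
  obtain ⟨⟨z, e⟩, hz, -⟩ := Units.exist_unique_eq_mul_prod L u
  dsimp only at hz
  obtain ⟨k, hk⟩ := hg z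
  have hp : ∏ i, (Units.fundSystem L i) ^ (e i) = (Units.fundSystem L (Fin.cast hrank.symm 0)) ^ (e (Fin.cast hrank.symm 0))
     * (Units.fundSystem L (Fin.cast hrank.symm 1)) ^ (e (Fin.cast hrank.symm 1)) := by
    rw [← (finCongr hrank.symm).prod_comp, Fin.prod_univ_two]
    rfl
  rw [hp, ← hk] at hz
  obtain ⟨b0, w0, h0⟩ := zpow_mod2 (g : (𝓞 L)ˣ) k
  obtain ⟨b1, w1, h1⟩ := zpow_mod2 (Units.fundSystem L (Fin.cast hrank.symm 0)) (e (Fin.cast hrank.symm 0))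
  obtain ⟨b2, w2, h2⟩ := zpow_mod2 (Units.fundSystem L (Fin.cast hrank.symm 1)) (e (Fin.cast hrank.symm 1))
  dsimp only at hz
  rw [Subgroup.coe_zpow] at hz
  refine ⟨(b0, b1, b2), w0 * w1 * w2, ?_⟩
  rw [hz, h0, h1, h2]
  rw [mul_pow, mul_pow]
  ac_rfl

theorem unit_sq (S : Setup L θ ι) (u : (𝓞 L)ˣ) (s t : 𝓞 L) (h : (u : 𝓞 L) = s ^ 2 + 2 * t) :
    ∃ w : (𝓞 L)ˣ, u = w ^ 2 := by
  obtain ⟨M, hM⟩ := unit_classes S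
  choose U hU using fun x => (uv_unit S x)
  choose τ w hw using hM
  have hinj : Function.Injective (fun x => τ (U x)) := by
    intro x y hxy
    dsimp only at hxy
    have h1 := hw (U x)
    have h2 := hw (U y)
    rw [hxy] at h1
    have h3 : U x = U y * (w (U x) * (w (U y))⁻¹) ^ 2 := by
      rw [mul_pow, inv_pow]
      calc U x = M (τ (U y)) * w (U x) ^ 2 := h1
        _ = (M (τ (U y)) * w (U y) ^ 2) * (w (U x) ^ 2 * (w (U y) ^ 2)⁻¹) := by
          rw [mul_comm (w (U x) ^ 2), ← mul_assoc, mul_inv_cancel_right]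
        _ = _ := by rw [← h2]
    apply uv_inj S x y ((w (U x) * (w (U y))⁻¹ : (𝓞 L)ˣ) : 𝓞 L) 0
    rw [← hU, ← hU]
    have := congrArg (fun z : (𝓞 L)ˣ => (z : 𝓞 L)) h3
    simp only [Units.val_mul, Units.val_pow_eq_pow_val] at this ⊢
    rw [mul_zero, add_zero]
    exact this
  obtain ⟨x, hx⟩ := Finite.surjective_of_injective hinj (τ u)
  dsimp only at hx
  have h1 := hw u
  have h2 := hw (U x)
  rw [hx] at h2
  have h3 : U x = u * (w (U x) * (w u)⁻¹) ^ 2 := by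
    rw [mul_pow, inv_pow]
    calc U x = M (τ u) * w (U x) ^ 2 := h2
      _ = (M (τ u) * w u ^ 2) * (w (U x) ^ 2 * (w u ^ 2)⁻¹) := by
        rw [mul_comm (w (U x) ^ 2), ← mul_assoc, mul_inv_cancel_right]
      _ = _ := by rw [← h1]
  have hx0 : x = (0, 0, 0) := by
    set a := w (U x) * (w u)⁻¹
    apply uv_inj S x (0, 0, 0) (s * a) (t * a ^ 2)
    have : (uv (0, 0, 0)).ev θ ι = 1 := by
      rw [show uv (0, 0, 0) = zone from rfl]; simp [zone, Z6.ev]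
    rw [this, ← hU, h3, Units.val_mul, h, Units.val_pow_eq_pow_val]
    ring
  have hU1 : U x = 1 := by
    apply Units.ext
    rw [hU, hx0, show uv (0, 0, 0) = zone from rfl]; simp [zone, Z6.ev]
  refine ⟨(w (U x) * (w u)⁻¹)⁻¹, ?_⟩
  rw [inv_pow, eq_inv_iff_mul_eq_one, ← h3, hU1]
end S5

section S6
theorem val_aux {R : Type*} [CommRing R] [IsDomain R] (p : R) (hp : Prime p) (b e : R) (hb : ¬ p ∣ b) (he : ¬ p ∣ e)
    (k : ℕ) : ∀ w, p ^ (2 * k + 1) * b = w ^ 2 * e → False := by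
  induction k with
  | zero =>
    intro w h
    have h1 : p ∣ w ^ 2 * e := by rw [← h]; simp
    obtain ⟨w', rfl⟩ := hp.dvd_of_dvd_pow ((hp.dvd_or_dvd h1).resolve_right he)
    apply hb
    have : p * b = p * (p * (w' ^ 2 * e)) := by linear_combination h
    exact ⟨_, mul_left_cancel₀ hp.ne_zero this⟩
  | succ k ih =>
    intro w h
    have h1 : p ∣ w ^ 2 * e := by rw [← h, pow_succ]; exact ⟨p ^ (2 * (k + 1)) * b, by ring⟩
    obtain ⟨w', rfl⟩ := hp.dvd_of_dvd_pow ((hp.dvd_or_dvd h1).resolve_right he)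
    refine ih w' (mul_left_cancel₀ (pow_ne_zero 2 hp.ne_zero) ?_)
    linear_combination h

theorem val_sq {R : Type*} [CommRing R] [IsDomain R] (p : R) (hp : Prime p) (k : ℕ) (w e : R) (h : w ^ 2 = p ^ (2 * k + 1) * e) : p ∣ e := by
  by_contra he
  exact val_aux p hp e 1 he (fun h => hp.not_unit (isUnit_of_dvd_one h)) k w (by rw [mul_one, h])

theorem ufd_sq {R : Type*} [CommRing R] [IsDomain R] [UniqueFactorizationMonoid R] (a : R) : a ≠ 0 →
    (∀ p k b, Prime p → a = p ^ (2 * k + 1) * b → p ∣ b) → ∃ u : Rˣ, ∃ s, a = u * s ^ 2 := by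
  induction a using (wellFounded_dvdNotUnit (α := R)).induction with
  | _ a ih =>
  intro ha h
  by_cases hu : IsUnit a
  · exact ⟨hu.unit, 1, by simp⟩
  obtain ⟨p, hp, b, hb⟩ := WfDvdMonoid.exists_irreducible_factor hu ha
  have hp' : Prime p := hp.prime
  obtain ⟨c, rfl⟩ := h p 0 b hp' (by simpa using hb)
  have hc : c ≠ 0 := by rintro rfl; simp at hb; exact ha hb
  obtain ⟨u, s, hs⟩ := ih c ⟨hc, p * p, fun h => hp.not_isUnit (isUnit_of_mul_isUnit_left h), by rw [hb]; ring⟩ hc (by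
    intro r k b hr hcr
    by_cases hrp : r ∣ p
    · obtain ⟨v, hv⟩ := hrp
      have hvu : IsUnit v := (hp.isUnit_or_isUnit hv).resolve_left hr.not_unit
      have := h r (k + 1) (v ^ 2 * b) hr (by rw [hb, hcr, hv]; ring)
      rcases hr.dvd_or_dvd this with h1 | h1
      · exact absurd (isUnit_of_dvd_unit h1 (hvu.pow 2)) hr.not_unit
      · exact h1
    · have := h r k (p ^ 2 * b) hr (by rw [hb, hcr]; ring)
      rcases hr.dvd_or_dvd this with h1 | h1
      · exact absurd (hr.dvd_of_dvd_pow h1) hrp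
      · exact h1)
  exact ⟨u, p * s, by rw [hb, hs]; ring⟩

theorem C_dvd_of_map {ℓ : ℕ} (P : ℤ[X]) (h : P.map (Int.castRingHom (ZMod ℓ)) = 0) : C (ℓ : ℤ) ∣ P := by
  rw [C_dvd_iff_dvd_coeff]
  intro i
  have := congrArg (fun p => coeff p i) h
  simp only [coeff_map, coeff_zero, eq_intCast] at this
  exact (ZMod.intCast_zmod_eq_zero_iff_dvd _ _).1 this

theorem descend {R : Type*} [CommRing R] (p t : R) (hp : Prime p) (ℓ : ℕ) (hl : ℓ.Prime) (hpl : p ∣ (ℓ : R))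
    (q c r : ℤ[X]) (hq : q.natDegree ≤ 2) (hc : c.natDegree ≤ 3) (hr : r.natDegree ≤ 4) (d : ℤ) (g : ℤ[X])
    (h : c ^ 2 - C (ℓ * d) ^ 2 * g = q * r) (hpq : p ∣ aeval t q) (hpc : p ∣ aeval t c) (hpr : p ∣ aeval t r)
    (hprim : ¬ C (ℓ : ℤ) ∣ q) : ∃ c' r' : ℤ[X], c'.natDegree ≤ 3 ∧ r'.natDegree ≤ 4 ∧ c' ^ 2 - C d ^ 2 * g = q * r' := by
  haveI : Fact ℓ.Prime := ⟨hl⟩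
  have hI : (Ideal.span {p}).IsPrime := (Ideal.span_singleton_prime hp.ne_zero).2 hp
  let K := R ⧸ Ideal.span {p}
  have hl0 : ((ℓ : ℕ) : K) = 0 := by
    have : Ideal.Quotient.mk (Ideal.span {p}) (ℓ : R) = 0 := Ideal.Quotient.eq_zero_iff_mem.2 (Ideal.mem_span_singleton.2 hpl)
    simpa using this
  haveI : CharP K ℓ := (CharP.charP_iff_prime_eq_zero hl).2 hl0
  let φ : ZMod ℓ →+* K := ZMod.castHom dvd_rfl K
  let ψ : (ZMod ℓ)[X] →+* K := eval₂RingHom φ (Ideal.Quotient.mk _ t)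
  have hψ : ∀ P : ℤ[X], p ∣ aeval t P → ψ (P.map (Int.castRingHom (ZMod ℓ))) = 0 := by
    intro P hP
    have h1 : Ideal.Quotient.mk (Ideal.span {p}) (aeval t P) = 0 := Ideal.Quotient.eq_zero_iff_mem.2 (Ideal.mem_span_singleton.2 hP)
    rw [aeval_def, hom_eval₂] at h1
    simp only [ψ, coe_eval₂RingHom, eval₂_map]
    rw [← h1]
    congr 1
    exact RingHom.ext_int _ _
  set Q := q.map (Int.castRingHom (ZMod ℓ)) with hQ
  set D := c.map (Int.castRingHom (ZMod ℓ)) with hD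
  set T := r.map (Int.castRingHom (ZMod ℓ)) with hT
  have hQ0 : Q ≠ 0 := fun h => hprim (C_dvd_of_map _ h)
  have hDQ : D ^ 2 = Q * T := by
    have := congrArg (Polynomial.map (Int.castRingHom (ZMod ℓ))) h
    simpa [hQ, hD, hT] using this
  obtain ⟨μ, hμ⟩ : ∃ μ, RingHom.ker ψ = Ideal.span {μ} := (IsPrincipalIdealRing.principal (RingHom.ker ψ)).principal
  have hdv : ∀ P, ψ P = 0 → μ ∣ P := fun P hP => by
    rw [← Ideal.mem_span_singleton, ← hμ]; exact hP
  obtain ⟨s, hs⟩ := hdv _ (hψ q hpq)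
  obtain ⟨D1, hD1⟩ := hdv _ (hψ c hpc)
  obtain ⟨T1, hT1⟩ := hdv _ (hψ r hpr)
  rw [← hQ] at hs; rw [← hD] at hD1; rw [← hT] at hT1
  have hμ0 : μ ≠ 0 := by rintro rfl; simp at hs; exact hQ0 hs
  have hs0 : s ≠ 0 := by rintro rfl; simp at hs; exact hQ0 hs
  have hμu : ¬ IsUnit μ := by
    intro hu
    have : ψ 1 = 0 := by
      change (1 : (ZMod ℓ)[X]) ∈ RingHom.ker ψ
      rw [hμ, Ideal.mem_span_singleton]; exact hu.dvd
    simp at this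
  have hμd : 1 ≤ μ.natDegree := by
    by_contra hh
    apply hμu
    rw [Polynomial.isUnit_iff_degree_eq_zero, degree_eq_natDegree hμ0]
    simp; omega
  have hQd : Q.natDegree ≤ 2 := natDegree_map_le.trans hq
  have hDd : D.natDegree ≤ 3 := natDegree_map_le.trans hc
  have hTd : T.natDegree ≤ 4 := natDegree_map_le.trans hr
  have hQs : Q.natDegree = μ.natDegree + s.natDegree := by rw [hs, natDegree_mul hμ0 hs0]
  have e1 : D1 ^ 2 = s * T1 := by
    apply mul_left_cancel₀ (pow_ne_zero 2 hμ0)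
    rw [hs, hD1, hT1] at hDQ
    linear_combination hDQ
  have e2 : s ∣ D1 := by
    by_cases h0 : s.natDegree = 0
    · have : IsUnit s := by
        rw [Polynomial.isUnit_iff_degree_eq_zero, degree_eq_natDegree hs0, h0]; rfl
      exact this.dvd
    · have : Irreducible s := irreducible_of_degree_eq_one (by
        rw [degree_eq_natDegree hs0, show s.natDegree = 1 by omega]; rfl)
      exact this.prime.dvd_of_dvd_pow (Dvd.intro _ e1.symm)
  obtain ⟨m, hm⟩ := e2
  have hDm : D = Q * m := by rw [hD1, hm, hs]; ring
  have hmd : m.natDegree ≤ 1 := by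
    by_cases hm0 : m = 0
    · simp [hm0]
    have h1 : D.natDegree = Q.natDegree + m.natDegree := by rw [hDm, natDegree_mul hQ0 hm0]
    have hD0 : D ≠ 0 := by rw [hDm]; exact mul_ne_zero hQ0 hm0
    have hT0 : T ≠ 0 := by
      rintro h0
      rw [h0, mul_zero] at hDQ
      exact hD0 (pow_eq_zero_iff (two_ne_zero)|>.1 hDQ)
    have h2 : 2 * D.natDegree = Q.natDegree + T.natDegree := by rw [← natDegree_mul hQ0 hT0, ← hDQ, natDegree_pow]
    omega
  obtain ⟨M, hM, hMd⟩ : ∃ M : ℤ[X], M.map (Int.castRingHom (ZMod ℓ)) = m ∧ M.natDegree ≤ 1 := by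
    have h1 : m ∈ Polynomial.lifts (Int.castRingHom (ZMod ℓ)) := by
      obtain ⟨M, hM⟩ := Polynomial.map_surjective (Int.castRingHom (ZMod ℓ)) (fun z => ZMod.intCast_surjective z) m
      exact (mem_lifts _).2 ⟨M, hM⟩
    obtain ⟨M, hM, hd⟩ := exists_natDegree_eq_of_mem_lifts h1
    exact ⟨M, hM, by omega⟩
  obtain ⟨c', hc'⟩ := C_dvd_of_map (ℓ := ℓ) (c - q * M) (by
    rw [Polynomial.map_sub, Polynomial.map_mul, hM, ← hQ, ← hD, hDm, sub_self])
  have hprime : Prime (C (ℓ : ℤ)) := prime_C_iff.2 (Nat.prime_iff_prime_int.1 hl)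
  have hcd : c'.natDegree ≤ 3 := by
    have h1 : (C (ℓ : ℤ) * c').natDegree = c'.natDegree := natDegree_C_mul (by exact_mod_cast hl.ne_zero)
    rw [← h1, ← hc']
    refine (natDegree_sub_le _ _).trans (max_le hc ?_)
    exact natDegree_mul_le.trans (by omega)
  set r' := r - q * M ^ 2 - C (2 * ℓ : ℤ) * (M * c') with hr'
  have e3 : C (ℓ : ℤ) * (C (ℓ : ℤ) * (c' ^ 2 - C d ^ 2 * g)) = q * r' := by
    have : c = q * M + C (ℓ : ℤ) * c' := by linear_combination hc'
    rw [hr']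
    rw [this] at h
    simp only [map_mul, map_ofNat] at h ⊢
    linear_combination h
  have hr'd : r'.natDegree ≤ 4 := by
    refine (natDegree_sub_le _ _).trans (max_le ((natDegree_sub_le _ _).trans (max_le hr ?_)) ?_)
    · exact natDegree_mul_le.trans (by have := natDegree_pow_le (p := M) (n := 2); omega)
    · refine (natDegree_C_mul_le _ _).trans (natDegree_mul_le.trans (by omega))
  obtain ⟨r1, hr1⟩ := (hprime.dvd_or_dvd (Dvd.intro _ e3)).resolve_left hprim
  rw [hr1] at e3
  have e4 : C (ℓ : ℤ) * (c' ^ 2 - C d ^ 2 * g) = q * r1 := mul_left_cancel₀ hprime.ne_zero (by rw [e3]; ring)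
  obtain ⟨r2, hr2⟩ := (hprime.dvd_or_dvd (Dvd.intro _ e4)).resolve_left hprim
  rw [hr2] at e4
  have e5 : (c' ^ 2 - C d ^ 2 * g) = q * r2 := mul_left_cancel₀ hprime.ne_zero (by rw [e4]; ring)
  refine ⟨c', r2, hcd, ?_, e5⟩
  rw [hr1, hr2, natDegree_C_mul (by exact_mod_cast hl.ne_zero), natDegree_C_mul (by exact_mod_cast hl.ne_zero)] at hr'd
  exact hr'd
end S6

section S6b
variable {L : Type} [Field L] [NumberField L] {θ ι : 𝓞 L}

theorem exists_rat_prime {R : Type*} [CommRing R] (p : R) (hp : Prime p) (n : ℕ) : n ≠ 0 → p ∣ (n : R) →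
    ∃ ℓ : ℕ, ℓ.Prime ∧ ℓ ∣ n ∧ p ∣ (ℓ : R) := by
  induction n using Nat.recOnMul with
  | zero => simp
  | one => intro _ h; simp at h; exact absurd (isUnit_of_dvd_one h) hp.not_unit
  | prime q hq => intro _ h; exact ⟨q, hq, dvd_rfl, h⟩
  | mul a b ha hb =>
    intro h0 h
    push_cast at h
    rcases hp.dvd_or_dvd h with h | h
    · obtain ⟨l, h1, h2, h3⟩ := ha (by rintro rfl; simp at h0) h
      exact ⟨l, h1, h2.mul_right _, h3⟩
    · obtain ⟨l, h1, h2, h3⟩ := hb (by rintro rfl; simp at h0) h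
      exact ⟨l, h1, h2.mul_left _, h3⟩

theorem quad_form (q : ℤ[X]) (hq : q.natDegree ≤ 2) : q = C (q.coeff 0) + C (q.coeff 1) * X + C (q.coeff 2) * X ^ 2 := by
  conv_lhs => rw [q.as_sum_range_C_mul_X_pow' (n := 3) (by omega)]
  simp [Finset.sum_range_succ]

theorem fac_dp (S : Setup L θ ι) : ∃ w : 𝓞 L, (6 * θ ^ 5 + 10 * θ ^ 4 + 4 * θ ^ 3 + 6 * θ ^ 2 + 12 * θ + 4) * w = 4 * (3 + 2 * ι) := by
  refine ⟨(⟨6,8,0,-8,3,5⟩ : Z6).ev θ ι, ?_⟩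
  have e : (6 * θ ^ 5 + 10 * θ ^ 4 + 4 * θ ^ 3 + 6 * θ ^ 2 + 12 * θ + 4) =
      (⟨10, 12, 6, 0,0,0⟩ : Z6).ev θ ι - 6 + (⟨0,0,1,0,0,0⟩ : Z6).ev θ ι * (⟨0,4,10,0,0,0⟩ : Z6).ev θ ι +
      (⟨0,0,1,0,0,0⟩ : Z6).ev θ ι * (⟨0,0,1,0,0,0⟩ : Z6).ev θ ι * (⟨0,6,0,0,0,0⟩ : Z6).ev θ ι := by
    simp [Z6.ev]; ring
  rw [e]
  have e3 : (Z6.lin 1 (((⟨4, 12, 6, 0,0,0⟩ : Z6)).mul ⟨6,8,0,-8,3,5⟩) (Z6.lin 1 (((⟨0,0,1,0,0,0⟩ : Z6).mul ⟨0,4,10,0,0,0⟩).mul ⟨6,8,0,-8,3,5⟩)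
    ((((⟨0,0,1,0,0,0⟩ : Z6).mul ⟨0,0,1,0,0,0⟩).mul ⟨0,6,0,0,0,0⟩).mul ⟨6,8,0,-8,3,5⟩))) = ⟨12,0,0,8,0,0⟩ := by rfl
  have e4 := congrArg (Z6.ev θ ι) e3
  simp only [Z6.ev_lin, Z6.ev_mul S] at e4
  have e5 : (⟨4, 12, 6, 0,0,0⟩ : Z6).ev θ ι = (⟨10, 12, 6, 0,0,0⟩ : Z6).ev θ ι - 6 := by simp [Z6.ev]; ring
  have e6 : (⟨12,0,0,8,0,0⟩ : Z6).ev θ ι = 4 * (3 + 2 * ι) := by simp [Z6.ev]; ring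
  rw [e6, e5] at e4
  rw [← e4]; push_cast; ring

theorem fac_pi (S : Setup L θ ι) : ∃ ϖ η u v β : 𝓞 L, θ - 3 = ϖ * η ∧ 3 + 2 * ι = ϖ ^ 3 * u ∧ u * v = 1 ∧ ϖ * β - 4 * η = 1 := by
  have e1 : (⟨0,0,0,1,1,1⟩ : Z6).mul ⟨0,-4,-2,6,1,-2⟩ = ⟨-3,1,0,0,0,0⟩ := by rfl
  have e2 : (((⟨0,0,0,1,1,1⟩ : Z6).mul ⟨0,0,0,1,1,1⟩).mul ⟨0,0,0,1,1,1⟩).mul ⟨-8,-12,0,12,-4,-7⟩ = ⟨3,0,0,2,0,0⟩ := by rfl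
  have e3 : (⟨-8,-12,0,12,-4,-7⟩ : Z6).mul ⟨2,6,2,-1,1,2⟩ = ⟨1,0,0,0,0,0⟩ := by rfl
  have e4 : Z6.lin (-4) ⟨0,-4,-2,6,1,-2⟩ ((⟨0,0,0,1,1,1⟩ : Z6).mul ⟨38,12,-14,-3,30,13⟩) = ⟨1,0,0,0,0,0⟩ := by rfl
  refine ⟨Z6.ev θ ι ⟨0,0,0,1,1,1⟩, Z6.ev θ ι ⟨0,-4,-2,6,1,-2⟩, Z6.ev θ ι ⟨-8,-12,0,12,-4,-7⟩, Z6.ev θ ι ⟨2,6,2,-1,1,2⟩,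
    Z6.ev θ ι ⟨38,12,-14,-3,30,13⟩, ?_, ?_, ?_, ?_⟩
  · rw [← Z6.ev_mul S, e1]; simp [Z6.ev]; ring
  · rw [pow_succ, pow_two, ← Z6.ev_mul S, ← Z6.ev_mul S, ← Z6.ev_mul S, e2]; simp [Z6.ev]
  · rw [← Z6.ev_mul S, e3]; simp [Z6.ev]
  · have := congrArg (Z6.ev θ ι) e4
    rw [Z6.ev_lin, Z6.ev_mul S] at this
    have h : Z6.ev θ ι ⟨1,0,0,0,0,0⟩ = 1 := by simp [Z6.ev]
    rw [h] at this
    rw [← this]; push_cast; ring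

theorem cop13 {R : Type*} [CommRing R] (p : R) (hp : Prime p) (h13 : p ∣ 13) (n : ℤ) (hn : p ∣ (n : R)) : (13 : ℤ) ∣ n := by
  by_contra h
  have : IsCoprime (13 : ℤ) n := (Prime.coprime_iff_not_dvd (by norm_num)).2 h
  obtain ⟨a, b, hab⟩ := this
  apply hp.not_unit
  apply isUnit_of_dvd_one
  have e : (1 : R) = a * 13 + b * n := by
    have := congrArg (Int.cast : ℤ → R) hab.symm
    push_cast at this; exact this
  rw [e]
  exact dvd_add (h13.mul_left _) (hn.mul_left _)

theorem sel_aux (S : Setup L θ ι) (q : ℤ[X]) (hq : q.natDegree ≤ 2) (hprim : ∀ ℓ : ℕ, ℓ.Prime → ¬ C (ℓ : ℤ) ∣ q)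
    (p b : 𝓞 L) (hp : Prime p) (k : ℕ) (hpk : aeval θ q = p ^ (2 * k + 1) * b) (hpb : ¬ p ∣ b) (n : ℕ) :
    ∀ (c r : ℤ[X]) (d : ℤ), d.natAbs = n → d ≠ 0 → c.natDegree ≤ 3 → r.natDegree ≤ 4 →
      c ^ 2 - C d ^ 2 * fZ = q * r → False := by
  induction n using Nat.strong_induction_on with
  | _ n ih =>
  intro c r d hdn hd hc hr h
  have hf : aeval θ fZ = 0 := by
    rw [← S.froot, fZ]; simp [map_ofNat]
  have h1 : aeval θ c ^ 2 = aeval θ q * aeval θ r := by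
    have := congrArg (aeval θ) h
    simpa [hf] using this
  have hpr : p ∣ aeval θ r := by
    have := val_sq p hp k (aeval θ c) (b * aeval θ r) (by rw [h1, hpk]; ring)
    exact (hp.dvd_or_dvd this).resolve_left hpb
  have hpq : p ∣ aeval θ q := by rw [hpk, pow_succ]; exact ⟨p ^ (2 * k) * b, by ring⟩
  have hpc : p ∣ aeval θ c := hp.dvd_of_dvd_pow (n := 2) (by rw [h1]; exact hpq.mul_right _)
  by_cases hpd : p ∣ (d : 𝓞 L)
  · obtain ⟨ℓ, hl, hld, hpl⟩ := exists_rat_prime p hp d.natAbs (by simpa using hd) (by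
      rcases Int.natAbs_eq d with hh | hh
      · rw [hh] at hpd; simpa using hpd
      · rw [hh] at hpd; simpa using hpd)
    obtain ⟨e, rfl⟩ : (ℓ : ℤ) ∣ d := Int.natCast_dvd.2 hld
    obtain ⟨c', r', hc', hr', h'⟩ := descend p θ hp ℓ hl hpl q c r hq hc hr e fZ h hpq hpc hpr (hprim ℓ hl)
    have he : e ≠ 0 := by rintro rfl; simp at hd
    refine ih e.natAbs ?_ c' r' e rfl he hc' hr' h'
    rw [← hdn, Int.natAbs_mul]
    have h2 := hl.two_le
    have h3 : 0 < e.natAbs := Int.natAbs_pos.2 he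
    simp only [Int.natAbs_natCast]
    nlinarith
  -- p does not divide d
  have hder : p ∣ aeval θ (derivative fZ) := by
    have := congrArg (fun P => aeval θ (derivative P)) h
    simp only [derivative_sub, derivative_mul, derivative_pow, map_sub, map_mul, map_add, map_pow, derivative_C, aeval_C] at this
    simp at this
    have e : p ∣ (d : 𝓞 L) ^ 2 * aeval θ (derivative fZ) := by
      have : (d : 𝓞 L) ^ 2 * aeval θ (derivative fZ) = 2 * aeval θ c * aeval θ (derivative c) - aeval θ (derivative q) * aeval θ r - aeval θ q * aeval θ (derivative r) := by
        linear_combination -this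
      rw [this]
      refine dvd_sub (dvd_sub ?_ (hpr.mul_left _)) (hpq.mul_right _)
      exact (hpc.mul_left 2).mul_right _
    rcases hp.dvd_or_dvd e with h | h
    · exact absurd (hp.dvd_of_dvd_pow h) hpd
    · exact h
  have hq' : aeval θ q = (q.coeff 0 : 𝓞 L) + q.coeff 1 * θ + q.coeff 2 * θ ^ 2 := by
    conv_lhs => rw [quad_form q hq]
    simp
  have hprim' : ∀ ℓ : ℕ, ℓ.Prime → ¬ ((ℓ : ℤ) ∣ q.coeff 0 ∧ (ℓ : ℤ) ∣ q.coeff 1 ∧ (ℓ : ℤ) ∣ q.coeff 2) := by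
    rintro ℓ hl ⟨⟨x, hx⟩, ⟨y, hy⟩, ⟨z, hz⟩⟩
    apply hprim ℓ hl
    refine ⟨C x + C y * X + C z * X ^ 2, ?_⟩
    conv_lhs => rw [quad_form q hq, hx, hy, hz]
    simp only [C_mul]; ring
  have hnu := hp.not_unit
  obtain ⟨w, hw⟩ := fac_dp S
  have hdf : aeval θ (derivative fZ) = 6 * θ ^ 5 + 10 * θ ^ 4 + 4 * θ ^ 3 + 6 * θ ^ 2 + 12 * θ + 4 := by
    simp [fZ, map_ofNat]; ring
  rw [hdf] at hder
  have h2 : ¬ p ∣ 2 := by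
    intro h2
    obtain ⟨u, v, huv⟩ := inv_mod2 S (q.coeff 0) (q.coeff 1) (q.coeff 2) (by exact_mod_cast hprim' 2 Nat.prime_two)
    rw [← hq'] at huv
    apply hnu
    apply isUnit_of_dvd_one
    rw [show (1 : 𝓞 L) = aeval θ q * u - 2 * v by linear_combination -huv]
    exact dvd_sub (hpq.mul_right _) (h2.mul_right _)
  have h32 : p ∣ 3 + 2 * ι := by
    have := hder.mul_right w
    rw [hw] at this
    rcases hp.dvd_or_dvd this with h | h
    · rw [show (4 : 𝓞 L) = 2 ^ 2 by norm_num] at h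
      exact absurd (hp.dvd_of_dvd_pow h) h2
    · exact h
  have h13' : (13 : 𝓞 L) = (3 + 2 * ι) * (3 - 2 * ι) := by linear_combination (4 : 𝓞 L) * S.hι
  have h13 : p ∣ 13 := by rw [h13']; exact h32.mul_right _
  obtain ⟨ϖ, η, u, v, β, f1, f2, f3, f4⟩ := fac_pi S
  have hpi : p ∣ ϖ := by
    rw [f2] at h32
    rcases hp.dvd_or_dvd h32 with h | h
    · exact hp.dvd_of_dvd_pow h
    · exact absurd (isUnit_of_dvd_unit h (IsUnit.of_mul_eq_one _ f3)) hnu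
  generalize hq0 : q.coeff 0 = q0 at *
  generalize hq1 : q.coeff 1 = q1 at *
  generalize hq2 : q.coeff 2 = q2 at *
  have hexp : aeval θ q = ((q0 + 3 * q1 + 9 * q2 : ℤ) : 𝓞 L) + ((q1 + 6 * q2 : ℤ) : 𝓞 L) * (θ - 3) + q2 * (θ - 3) ^ 2 := by
    rw [hq']; push_cast; ring
  have hq3 : (13 : ℤ) ∣ q0 + 3 * q1 + 9 * q2 := by
    apply cop13 p hp h13
    rw [show ((q0 + 3 * q1 + 9 * q2 : ℤ) : 𝓞 L) = aeval θ q - (((q1 + 6 * q2 : ℤ) : 𝓞 L)  * η + q2 * ϖ * η ^ 2) * ϖ by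
      rw [hexp, f1]; ring]
    exact dvd_sub hpq (hpi.mul_left _)
  obtain ⟨e, he⟩ := hq3
  by_cases hq13 : (13 : ℤ) ∣ q1 + 6 * q2
  · obtain ⟨g, hg⟩ := hq13
    have hq2' : ¬ (13 : ℤ) ∣ q2 := by
      intro h
      have := hprim' 13 (by norm_num)
      push_cast at this
      omega
    rw [he, hg, f1] at hexp
    have key : p ^ (2 * k + 1) * b = ϖ ^ 2 * (ϖ * (u * (3 - 2 * ι) * (e + g * (ϖ * η))) + q2 * η ^ 2) := by
      rw [← hpk, hexp]; push_cast; rw [h13', f2]; ring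
    refine val_aux p hp b _ hpb ?_ k ϖ key
    intro hh
    have h3 : p ∣ q2 * η ^ 2 := (dvd_add_right (hpi.mul_right _)).1 hh
    rcases hp.dvd_or_dvd h3 with h | h
    · exact hq2' (cop13 p hp h13 _ h)
    · apply hnu
      apply isUnit_of_dvd_one
      rw [← f4]
      exact dvd_sub (hpi.mul_right _) ((hp.dvd_of_dvd_pow h).mul_left _)
  · have hp13 : Prime (13 : ℤ) := by norm_num
    obtain ⟨j, hj⟩ : ∃ j : ℤ, (13 : ℤ) ∣ e + j * (q1 + 6 * q2) := by
      obtain ⟨a, b, hab⟩ := (Prime.coprime_iff_not_dvd hp13).2 hq13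
      exact ⟨-e * b, a * e, by linear_combination (-e) * hab⟩
    obtain ⟨y, hy⟩ := hj
    have hqe : q.eval (3 + 13 * j) = 169 * (y + j ^ 2 * q2) := by
      rw [quad_form q hq, hq0, hq1, hq2]
      simp
      linear_combination he + 13 * hy
    have hfe : ∃ z : ℤ, fZ.eval (3 + 13 * j) = 13 * (109 + 13 * z) := by
      simp [fZ]
      exact ⟨190 * j + 1833 * j ^ 2 + 734 * 13 * j ^ 3 + 166 * 169 * j ^ 4 + 20 * 2197 * j ^ 5 + 28561 * j ^ 6, by ring⟩
    obtain ⟨z, hz⟩ := hfe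
    have hev := congrArg (Polynomial.eval (3 + 13 * j)) h
    simp [hqe, hz] at hev
    generalize c.eval (3 + 13 * j) = cc at *
    generalize r.eval (3 + 13 * j) = rr at *
    have h5 : (13 : ℤ) ∣ cc := hp13.dvd_of_dvd_pow (n := 2) ⟨d ^ 2 * (109 + 13 * z) + 13 * (y + j ^ 2 * q2) * rr, by linear_combination hev⟩
    obtain ⟨c5, rfl⟩ := h5
    have h6 : (13 : ℤ) ∣ d ^ 2 * (109 + 13 * z) := ⟨c5 ^ 2 - (y + j ^ 2 * q2) * rr, by linarith⟩
    rcases hp13.dvd_or_dvd h6 with h | h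
    · obtain ⟨t, ht⟩ := hp13.dvd_of_dvd_pow h
      apply hpd
      rw [ht]; push_cast; exact h13.mul_right _
    · omega
end S6b

section S6c
variable {L : Type} [Field L] [NumberField L] {θ ι : 𝓞 L}

structure Rel {R : Type*} [CommRing R] (q0 q1 q2 c0 c1 c2 c3 d r0 r1 r2 r3 r4 : R) : Prop where
  e0 : c0 ^ 2 + d * c0 = q0 * r0
  e1 : 2 * c0 * c1 + d * c1 - d ^ 2 = q0 * r1 + q1 * r0
  e2 : 2 * c0 * c2 + c1 ^ 2 + d * (c2 + c0) - d ^ 2 = q0 * r2 + q1 * r1 + q2 * r0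
  e3 : 2 * c0 * c3 + 2 * c1 * c2 + d * (c3 + c1 + c0) = q0 * r3 + q1 * r2 + q2 * r1
  e4 : 2 * c1 * c3 + c2 ^ 2 + d * (c2 + c1) = q0 * r4 + q1 * r3 + q2 * r2
  e5 : 2 * c2 * c3 + d * (c3 + c2) = q1 * r4 + q2 * r3
  e6 : c3 ^ 2 + d * c3 = q2 * r4

def Prim (q0 q1 q2 : ℤ) : Prop := ∀ ℓ : ℕ, ℓ.Prime → ¬ ((ℓ : ℤ) ∣ q0 ∧ (ℓ : ℤ) ∣ q1 ∧ (ℓ : ℤ) ∣ q2)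

def Val (q0 q1 q2 : ℤ) : Prop := Prim q0 q1 q2 ∧
  ∃ c0 c1 c2 c3 d r0 r1 r2 r3 r4 : ℤ, ¬ 2 ∣ d ∧ Rel q0 q1 q2 c0 c1 c2 c3 d r0 r1 r2 r3 r4

theorem Rel.map {R S : Type*} [CommRing R] [CommRing S] (φ : R →+* S) {q0 q1 q2 c0 c1 c2 c3 d r0 r1 r2 r3 r4 : R}
    (h : Rel q0 q1 q2 c0 c1 c2 c3 d r0 r1 r2 r3 r4) :
    Rel (φ q0) (φ q1) (φ q2) (φ c0) (φ c1) (φ c2) (φ c3) (φ d) (φ r0) (φ r1) (φ r2) (φ r3) (φ r4) := by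
  obtain ⟨e0, e1, e2, e3, e4, e5, e6⟩ := h
  constructor
  · simpa [map_ofNat] using congrArg φ e0
  · simpa [map_ofNat] using congrArg φ e1
  · simpa [map_ofNat] using congrArg φ e2
  · simpa [map_ofNat] using congrArg φ e3
  · simpa [map_ofNat] using congrArg φ e4
  · simpa [map_ofNat] using congrArg φ e5
  · simpa [map_ofNat] using congrArg φ e6

theorem Rel.iden {R : Type*} [CommRing R] {q0 q1 q2 c0 c1 c2 c3 d r0 r1 r2 r3 r4 : R}
    (h : Rel q0 q1 q2 c0 c1 c2 c3 d r0 r1 r2 r3 r4) (x z : R) :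
    (c0 * z ^ 3 + c1 * x * z ^ 2 + c2 * x ^ 2 * z + c3 * x ^ 3) ^ 2 + d * (z ^ 3 + x ^ 2 * z + x ^ 3) *
      (c0 * z ^ 3 + c1 * x * z ^ 2 + c2 * x ^ 2 * z + c3 * x ^ 3) - d ^ 2 * (x * z ^ 5 + x ^ 2 * z ^ 4) =
    (q0 * z ^ 2 + q1 * x * z + q2 * x ^ 2) * (r0 * z ^ 4 + r1 * x * z ^ 3 + r2 * x ^ 2 * z ^ 2 + r3 * x ^ 3 * z + r4 * x ^ 4) := by
  obtain ⟨e0, e1, e2, e3, e4, e5, e6⟩ := h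
  linear_combination z ^ 6 * e0 + x * z ^ 5 * e1 + x ^ 2 * z ^ 4 * e2 + x ^ 3 * z ^ 3 * e3 + x ^ 4 * z ^ 2 * e4 + x ^ 5 * z * e5 + x ^ 6 * e6

theorem odd_zmod {d : ℤ} (h : ¬ 2 ∣ d) : (d : ZMod 2) = 1 := by
  have : d = 2 * (d / 2) + 1 := by omega
  rw [this]; push_cast; rw [show (2 : ZMod 2) = 0 from rfl]; simp

set_option synthInstance.maxHeartbeats 400000 in
set_option synthInstance.maxSize 1000 in
theorem not111 : ∀ c0 c1 c2 c3 r0 r1 r2 r3 r4 : ZMod 2, 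
   c0 ^ 2 + 1 * c0 = 1 * r0 → 
   2 * c0 * c1 + 1 * c1 - 1 ^ 2 = 1 * r1 + 1 * r0 →
   2 * c0 * c2 + c1 ^ 2 + 1 * (c2 + c0) - 1 ^ 2 = 1 * r2 + 1 * r1 + 1 * r0 →
   2 * c0 * c3 + 2 * c1 * c2 + 1 * (c3 + c1 + c0) = 1 * r3 + 1 * r2 + 1 * r1 →
   2 * c1 * c3 + c2 ^ 2 + 1 * (c2 + c1) = 1 * r4 + 1 * r3 + 1 * r2 →
   2 * c2 * c3 + 1 * (c3 + c2) = 1 * r4 + 1 * r3 → 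
   c3 ^ 2 + 1 * c3 = 1 * r4 → False := by
  decide +kernel

theorem Val.not_odd {q0 q1 q2 : ℤ} (h : Val q0 q1 q2) : ¬ (¬ 2 ∣ q0 ∧ ¬ 2 ∣ q1 ∧ ¬ 2 ∣ q2) := by
  rintro ⟨h0, h1, h2⟩
  obtain ⟨-, c0, c1, c2, c3, d, r0, r1, r2, r3, r4, hd, hr⟩ := h
  have h := hr.map (Int.castRingHom (ZMod 2))
  simp only [eq_intCast, odd_zmod h0, odd_zmod h1, odd_zmod h2, odd_zmod hd] at h
  obtain ⟨e0, e1, e2, e3, e4, e5, e6⟩ := h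
  exact not111 _ _ _ _ _ _ _ _ _ e0 e1 e2 e3 e4 e5 e6

theorem sq_mod_two (S : Setup L θ ι) {q0 q1 q2 : ℤ} (h : Val q0 q1 q2) :
    ∃ g t : 𝓞 L, (q0 : 𝓞 L) + q1 * θ + q2 * θ ^ 2 = g ^ 2 + 2 * t := by
  have hp := h.1 2 Nat.prime_two
  have hn := h.not_odd
  have e1 : (Z6.ev θ ι ⟨0,1,0,-1,0,1⟩) ^ 2 = θ := by
    rw [pow_two, ← Z6.ev_mul S, show (⟨0,1,0,-1,0,1⟩ : Z6).mul ⟨0,1,0,-1,0,1⟩ = ⟨0,1,0,0,0,0⟩ from rfl]; simp [Z6.ev]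
  have e2 : (Z6.ev θ ι ⟨1,-1,-1,1,2,0⟩) ^ 2 = 1 + θ := by
    rw [pow_two, ← Z6.ev_mul S, show (⟨1,-1,-1,1,2,0⟩ : Z6).mul ⟨1,-1,-1,1,2,0⟩ = ⟨1,1,0,0,0,0⟩ from rfl]; simp [Z6.ev]
  generalize Z6.ev θ ι ⟨0,1,0,-1,0,1⟩ = a at e1
  generalize Z6.ev θ ι ⟨1,-1,-1,1,2,0⟩ = b at e2
  push_cast at hp
  rcases Int.even_or_odd' q0 with ⟨k0, h0 | h0⟩ <;> rcases Int.even_or_odd' q1 with ⟨k1, h1 | h1⟩ <;>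
    rcases Int.even_or_odd' q2 with ⟨k2, h2 | h2⟩
  · omega
  · exact ⟨θ, k0 + k1 * θ + k2 * θ ^ 2, by rw [h0, h1, h2]; push_cast; ring⟩
  · exact ⟨a, k0 + k1 * θ + k2 * θ ^ 2, by rw [h0, h1, h2, e1]; push_cast; ring⟩
  · exact ⟨a * b, k0 + k1 * θ + k2 * θ ^ 2, by rw [h0, h1, h2, mul_pow, e1, e2]; push_cast; ring⟩
  · exact ⟨1, k0 + k1 * θ + k2 * θ ^ 2, by rw [h0, h1, h2]; push_cast; ring⟩
  · exact ⟨1 + θ, k0 + k1 * θ + k2 * θ ^ 2 - θ, by rw [h0, h1, h2]; push_cast; ring⟩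
  · exact ⟨b, k0 + k1 * θ + k2 * θ ^ 2, by rw [h0, h1, h2, e2]; push_cast; ring⟩
  · omega

theorem selmer (S : Setup L θ ι) {q0 q1 q2 : ℤ} (h : Val q0 q1 q2) : ∃ s : 𝓞 L, (q0 : 𝓞 L) + q1 * θ + q2 * θ ^ 2 = s ^ 2 := by
  obtain ⟨g, t, hgt⟩ := sq_mod_two S h
  have hp2 := h.1 2 Nat.prime_two
  have hprim := h.1
  obtain ⟨-, c0, c1, c2, c3, d, r0, r1, r2, r3, r4, hd, hr⟩ := h
  have hd0 : d ≠ 0 := by rintro rfl; simp at hd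
  let q : ℤ[X] := C q0 + C q1 * X + C q2 * X ^ 2
  have hq : q.natDegree ≤ 2 := by simp only [q]; compute_degree
  have hev : aeval θ q = (q0 : 𝓞 L) + q1 * θ + q2 * θ ^ 2 := by simp [q]
  have hqc : q.coeff 0 = q0 ∧ q.coeff 1 = q1 ∧ q.coeff 2 = q2 := by
    simp only [q]
    refine ⟨?_, ?_, ?_⟩ <;> simp only [coeff_add, coeff_C_mul, coeff_X, coeff_C, coeff_X_pow] <;> norm_num
  have hqprim : ∀ ℓ : ℕ, ℓ.Prime → ¬ C (ℓ : ℤ) ∣ q := by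
    intro ℓ hl hd
    rw [C_dvd_iff_dvd_coeff] at hd
    apply hprim ℓ hl
    rw [← hqc.1, ← hqc.2.1, ← hqc.2.2]
    exact ⟨hd 0, hd 1, hd 2⟩
  haveI := S.pid
  have hne : aeval θ q ≠ 0 := by
    intro h0
    rw [hev] at h0
    have := congrArg (fun x : 𝓞 L => (x : L)) h0
    have h2 := S.hind q0 q1 q2 0 0 0 (by
      simp only [Rat.cast_zero, zero_mul, add_zero, Rat.cast_intCast]
      simpa using this)
    have := hprim 2 Nat.prime_two
    simp only [Int.cast_eq_zero] at h2
    simp [h2.1, h2.2.1, h2.2.2.1] at this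
  obtain ⟨u, s, hus⟩ := ufd_sq (aeval θ q) hne (by
    intro p k b hp hpk
    by_contra hpb
    have hC := hr.map (C : ℤ →+* ℤ[X])
    have hid := hC.iden X 1
    refine sel_aux S q hq hqprim p b hp k hpk hpb _
      (C (2 * c0 + d) + C (2 * c1) * X + C (2 * c2 + d) * X ^ 2 + C (2 * c3 + d) * X ^ 3)
      (C (4 * r0) + C (4 * r1) * X + C (4 * r2) * X ^ 2 + C (4 * r3) * X ^ 3 + C (4 * r4) * X ^ 4) d rfl hd0
      (by compute_degree) (by compute_degree) ?_
    simp only [map_add, map_mul, map_ofNat, fZ, q]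
    linear_combination 4 * hid)
  obtain ⟨v, w, hvw⟩ := inv_mod2 S q0 q1 q2 (by exact_mod_cast hp2)
  rw [← hev] at hvw hgt
  rw [hus] at hvw hgt
  obtain ⟨ω, hω⟩ := unit_sq S u (g * (u * s * v)) (t * (u * s * v) ^ 2 - u * (2 * w + 2 * w ^ 2)) (by
    linear_combination (u * s * v) ^ 2 * hgt - u * (u * s ^ 2 * v + 1 + 2 * w) * hvw)
  refine ⟨ω * s, ?_⟩
  rw [← hev, hus, hω]; push_cast; ring
end S6c

section S7a
variable {L : Type} [Field L] [NumberField L] {θ ι : 𝓞 L}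

structure Sqr {R : Type*} [CommRing R] (q0 q1 q2 a0 a1 a2 b0 b1 b2 b3 c κ : R) : Prop where
  e0 : b0 ^ 2 = c * (q0 * a0 ^ 2) + κ
  e1 : 2 * b0 * b1 = c * (q0 * (2 * a0 * a1) + q1 * a0 ^ 2) + 4 * κ
  e2 : 2 * b0 * b2 + b1 ^ 2 = c * (q0 * (2 * a0 * a2 + a1 ^ 2) + q1 * (2 * a0 * a1) + q2 * a0 ^ 2) + 6 * κ
  e3 : 2 * b0 * b3 + 2 * b1 * b2 = c * (q0 * (2 * a1 * a2) + q1 * (2 * a0 * a2 + a1 ^ 2) + q2 * (2 * a0 * a1)) + 2 * κ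
  e4 : 2 * b1 * b3 + b2 ^ 2 = c * (q0 * a2 ^ 2 + q1 * (2 * a1 * a2) + q2 * (2 * a0 * a2 + a1 ^ 2)) + κ
  e5 : 2 * b2 * b3 = c * (q1 * a2 ^ 2 + q2 * (2 * a1 * a2)) + 2 * κ
  e6 : b3 ^ 2 = c * (q2 * a2 ^ 2) + κ

theorem Sqr.map {R S : Type*} [CommRing R] [CommRing S] (φ : R →+* S) {q0 q1 q2 a0 a1 a2 b0 b1 b2 b3 c κ : R}
    (h : Sqr q0 q1 q2 a0 a1 a2 b0 b1 b2 b3 c κ) :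
    Sqr (φ q0) (φ q1) (φ q2) (φ a0) (φ a1) (φ a2) (φ b0) (φ b1) (φ b2) (φ b3) (φ c) (φ κ) := by
  obtain ⟨e0, e1, e2, e3, e4, e5, e6⟩ := h
  constructor
  · simpa [map_ofNat] using congrArg φ e0
  · simpa [map_ofNat] using congrArg φ e1
  · simpa [map_ofNat] using congrArg φ e2
  · simpa [map_ofNat] using congrArg φ e3
  · simpa [map_ofNat] using congrArg φ e4
  · simpa [map_ofNat] using congrArg φ e5
  · simpa [map_ofNat] using congrArg φ e6

theorem Sqr.iden {R : Type*} [CommRing R] {q0 q1 q2 a0 a1 a2 b0 b1 b2 b3 c κ : R}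
    (h : Sqr q0 q1 q2 a0 a1 a2 b0 b1 b2 b3 c κ) (x z : R) :
    (b0 * z ^ 3 + b1 * x * z ^ 2 + b2 * x ^ 2 * z + b3 * x ^ 3) ^ 2 =
    c * (a0 * z ^ 2 + a1 * x * z + a2 * x ^ 2) ^ 2 * (q0 * z ^ 2 + q1 * x * z + q2 * x ^ 2) +
    κ * (x ^ 6 + 2 * x ^ 5 * z + x ^ 4 * z ^ 2 + 2 * x ^ 3 * z ^ 3 + 6 * x ^ 2 * z ^ 4 + 4 * x * z ^ 5 + z ^ 6) := by
  obtain ⟨e0, e1, e2, e3, e4, e5, e6⟩ := h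
  linear_combination z ^ 6 * e0 + x * z ^ 5 * e1 + x ^ 2 * z ^ 4 * e2 + x ^ 3 * z ^ 3 * e3 + x ^ 4 * z ^ 2 * e4 + x ^ 5 * z * e5 + x ^ 6 * e6

theorem exists_sqr (S : Setup L θ ι) (q0 q1 q2 c : ℚ) (s : L) (hs : s ^ 2 = c * ((q0 : L) + q1 * θ + q2 * (θ : L) ^ 2)) :
    ∃ a0 a1 a2 b0 b1 b2 b3 κ : ℚ, ¬ (a0 = 0 ∧ a1 = 0 ∧ a2 = 0 ∧ b0 = 0 ∧ b1 = 0 ∧ b2 = 0 ∧ b3 = 0) ∧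
      Sqr q0 q1 q2 a0 a1 a2 b0 b1 b2 b3 c κ := by
  let t : L := θ
  let v : Fin 7 → L := ![s, s * t, s * t ^ 2, -1, -t, -t ^ 2, -t ^ 3]
  have hnl : ¬ LinearIndependent ℚ v := by
    intro hl
    have := hl.fintype_card_le_finrank
    rw [S.hfin] at this
    simp at this
  rw [Fintype.not_linearIndependent_iff] at hnl
  obtain ⟨g, hg, i, hi⟩ := hnl
  have hg' : (g 0 : L) * s + g 1 * (s * t) + g 2 * (s * t ^ 2) + g 3 * (-1) + g 4 * (-t) + g 5 * (-t ^ 2) + g 6 * (-t ^ 3) = 0 := by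
    rw [← hg, Fin.sum_univ_seven]
    simp only [v, Algebra.smul_def, eq_ratCast]
    rfl
  obtain ⟨g0, hg0⟩ : ∃ x, g 0 = x := ⟨_, rfl⟩
  obtain ⟨g1, hg1⟩ : ∃ x, g 1 = x := ⟨_, rfl⟩
  obtain ⟨g2, hg2⟩ : ∃ x, g 2 = x := ⟨_, rfl⟩
  obtain ⟨g3, hg3⟩ : ∃ x, g 3 = x := ⟨_, rfl⟩
  obtain ⟨g4, hg4⟩ : ∃ x, g 4 = x := ⟨_, rfl⟩
  obtain ⟨g5, hg5⟩ : ∃ x, g 5 = x := ⟨_, rfl⟩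
  obtain ⟨g6, hg6⟩ : ∃ x, g 6 = x := ⟨_, rfl⟩
  have hk : (g3 : L) + g4 * t + g5 * t ^ 2 + g6 * t ^ 3 = s * (g0 + g1 * t + g2 * t ^ 2) := by
    rw [← hg0, ← hg1, ← hg2, ← hg3, ← hg4, ← hg5, ← hg6]
    linear_combination -hg'
  have hf : t ^ 6 + 2 * t ^ 5 + t ^ 4 + 2 * t ^ 3 + 6 * t ^ 2 + 4 * t + 1 = 0 :=
    congrArg (fun x : 𝓞 L => (x : L)) S.froot
  have hsq : ((g3 : L) + g4 * t + g5 * t ^ 2 + g6 * t ^ 3) ^ 2 = c * ((q0 : L) + q1 * t + q2 * t ^ 2) * (g0 + g1 * t + g2 * t ^ 2) ^ 2 := by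
    rw [hk, mul_pow, hs]
  let κ : ℚ := g6 ^ 2 - c * (q2 * g2 ^ 2)
  refine ⟨g0, g1, g2, g3, g4, g5, g6, κ, ?_, ?_⟩
  · rintro ⟨h0, h1, h2, h3, h4, h5, h6⟩
    apply hi
    fin_cases i <;> simp_all
  · have := S.hind (g3 ^ 2 - (c * (q0 * g0 ^ 2) + κ))
      (2 * g3 * g4 - (c * (q0 * (2 * g0 * g1) + q1 * g0 ^ 2) + 4 * κ))
      (2 * g3 * g5 + g4 ^ 2 - (c * (q0 * (2 * g0 * g2 + g1 ^ 2) + q1 * (2 * g0 * g1) + q2 * g0 ^ 2) + 6 * κ))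
      (2 * g3 * g6 + 2 * g4 * g5 - (c * (q0 * (2 * g1 * g2) + q1 * (2 * g0 * g2 + g1 ^ 2) + q2 * (2 * g0 * g1)) + 2 * κ))
      (2 * g4 * g6 + g5 ^ 2 - (c * (q0 * g2 ^ 2 + q1 * (2 * g1 * g2) + q2 * (2 * g0 * g2 + g1 ^ 2)) + κ))
      (2 * g5 * g6 - (c * (q1 * g2 ^ 2 + q2 * (2 * g1 * g2)) + 2 * κ)) (by
        simp only [κ]
        push_cast
        change _ + _ * t + _ * t ^ 2 + _ * t ^ 3 + _ * t ^ 4 + _ * t ^ 5 = _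
        linear_combination hsq - ((g6 : L) ^ 2 - c * (q2 * g2 ^ 2)) * hf)
    obtain ⟨e0, e1, e2, e3, e4, e5⟩ := this
    exact ⟨sub_eq_zero.1 e0, sub_eq_zero.1 e1, sub_eq_zero.1 e2, sub_eq_zero.1 e3, sub_eq_zero.1 e4, sub_eq_zero.1 e5, by simp only [κ]; ring⟩

theorem f_pos (x z : ℝ) (h : ¬ (x = 0 ∧ z = 0)) :
    0 < x ^ 6 + 2 * x ^ 5 * z + x ^ 4 * z ^ 2 + 2 * x ^ 3 * z ^ 3 + 6 * x ^ 2 * z ^ 4 + 4 * x * z ^ 5 + z ^ 6 := by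
  have e : x ^ 6 + 2 * x ^ 5 * z + x ^ 4 * z ^ 2 + 2 * x ^ 3 * z ^ 3 + 6 * x ^ 2 * z ^ 4 + 4 * x * z ^ 5 + z ^ 6 =
    (x ^ 3 + x ^ 2 * z - x * z ^ 2 / 2) ^ 2 + z ^ 2 * (x ^ 2 + 3 / 2 * x * z + 4 / 5 * z ^ 2) ^ 2 +
      z ^ 4 * (19 / 10 * (x + 8 / 19 * z) ^ 2 + (9 / 25 - 32 / 95) * z ^ 2) := by ring
  by_cases hz : z = 0
  · subst hz
    have hx : x ≠ 0 := fun hx => h ⟨hx, rfl⟩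
    have : 0 < x ^ 6 := by positivity
    simpa using this
  · rw [e]
    have : 0 < z ^ 4 * (19 / 10 * (x + 8 / 19 * z) ^ 2 + (9 / 25 - 32 / 95) * z ^ 2) := by
      norm_num
      positivity
    positivity
end S7a

section S7b
theorem kpos_of_interval (u v q2 a0 a1 a2 b0 b1 b2 b3 c κ l r : ℝ)
    (hS : Sqr (q2 * v) (q2 * u) q2 a0 a1 a2 b0 b1 b2 b3 c κ)
    (hne : ¬ (a0 = 0 ∧ a1 = 0 ∧ a2 = 0 ∧ b0 = 0 ∧ b1 = 0 ∧ b2 = 0 ∧ b3 = 0))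
    (hlr : l < r) (hneg : ∀ x, l < x → x < r → c * q2 * (x ^ 2 + u * x + v) < 0) : 0 < κ := by
  have hid := fun x => hS.iden x 1
  have hf := fun x : ℝ => f_pos x 1 (by simp)
  have hk : 0 ≤ κ := by
    obtain ⟨x, hx1, hx2⟩ := exists_between hlr
    have h1 := hid x
    have h2 := hf x
    have h3 := hneg x hx1 hx2
    by_contra hk
    push Not at hk
    have h4 := mul_neg_of_neg_of_pos hk h2
    have h5 : c * (a0 * 1 ^ 2 + a1 * x * 1 + a2 * x ^ 2) ^ 2 * (q2 * v * 1 ^ 2 + q2 * u * x * 1 + q2 * x ^ 2) ≤ 0 := by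
      have h7 := mul_nonpos_of_nonpos_of_nonneg h3.le (sq_nonneg (a0 * 1 ^ 2 + a1 * x * 1 + a2 * x ^ 2))
      calc _ = c * q2 * (x ^ 2 + u * x + v) * (a0 * 1 ^ 2 + a1 * x * 1 + a2 * x ^ 2) ^ 2 := by ring
        _ ≤ 0 := h7
    have h6 := sq_nonneg (b0 * 1 ^ 3 + b1 * x * 1 ^ 2 + b2 * x ^ 2 * 1 + b3 * x ^ 3)
    linarith
  rcases hk.lt_or_eq with h | h
  · exact h
  exfalso
  have key : ∀ x, l < x → x < r → (a0 + a1 * x + a2 * x ^ 2 = 0 ∧ b0 + b1 * x + b2 * x ^ 2 + b3 * x ^ 3 = 0) := by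
    intro x hx1 hx2
    have h1 := hid x
    have h3 := hneg x hx1 hx2
    rw [← h, zero_mul, add_zero] at h1
    have e : (b0 + b1 * x + b2 * x ^ 2 + b3 * x ^ 3) ^ 2 = (a0 + a1 * x + a2 * x ^ 2) ^ 2 * (c * q2 * (x ^ 2 + u * x + v)) := by
      linear_combination h1
    have h7 : a0 + a1 * x + a2 * x ^ 2 = 0 := by
      by_contra hh
      have : 0 < (a0 + a1 * x + a2 * x ^ 2) ^ 2 := by positivity
      nlinarith [sq_nonneg (b0 + b1 * x + b2 * x ^ 2 + b3 * x ^ 3), mul_neg_of_pos_of_neg this h3]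
    refine ⟨h7, ?_⟩
    rw [h7] at e
    simpa using e
  have hinf := Set.Ioo_infinite hlr
  have hA : (C a0 + C a1 * X + C a2 * X ^ 2 : ℝ[X]) = 0 := by
    apply Polynomial.eq_zero_of_infinite_isRoot
    refine hinf.mono fun x hx => ?_
    simpa using (key x hx.1 hx.2).1
  have hB : (C b0 + C b1 * X + C b2 * X ^ 2 + C b3 * X ^ 3 : ℝ[X]) = 0 := by
    apply Polynomial.eq_zero_of_infinite_isRoot
    refine hinf.mono fun x hx => ?_
    simpa using (key x hx.1 hx.2).2
  apply hne
  have ca := fun i => congrArg (fun p => coeff p i) hA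
  have cb := fun i => congrArg (fun p => coeff p i) hB
  simp only [coeff_add, coeff_C_mul, coeff_X, coeff_C, coeff_X_pow, coeff_zero] at ca cb
  have x0 := ca 0; have x1 := ca 1; have x2 := ca 2
  have y0 := cb 0; have y1 := cb 1; have y2 := cb 2; have y3 := cb 3
  norm_num at x0 x1 x2 y0 y1 y2 y3
  exact ⟨x0, x1, x2, y0, y1, y2, y3⟩

theorem ivt_sign (α α' q2 a0 a1 a2 b0 b1 b2 b3 c κ ε : ℝ) (hα : α < α')
    (hS : Sqr (q2 * (α * α')) (q2 * (-(α + α'))) q2 a0 a1 a2 b0 b1 b2 b3 c κ)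
    (hk : 0 < κ) (hε : ε ^ 2 = 1) (hc : c * q2 * ε ≤ 0) :
    0 ≤ ε * ((b0 + b1 * α + b2 * α ^ 2 + b3 * α ^ 3) * (b0 + b1 * α' + b2 * α' ^ 2 + b3 * α' ^ 3)) := by
  by_contra hneg
  push Not at hneg
  let F : ℝ → ℝ := fun t => b0 * ((1 - t) + ε * t) ^ 3 + b1 * ((1 - t) * α + ε * t * α') * ((1 - t) + ε * t) ^ 2 +
    b2 * ((1 - t) * α + ε * t * α') ^ 2 * ((1 - t) + ε * t) + b3 * ((1 - t) * α + ε * t * α') ^ 3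
  have hF : Continuous F := by simp only [F]; fun_prop
  have h0 : F 0 = (b0 + b1 * α + b2 * α ^ 2 + b3 * α ^ 3) := by simp only [F]; ring
  have h1 : F 1 = ε * (b0 + b1 * α' + b2 * α' ^ 2 + b3 * α' ^ 3) := by
    simp only [F]
    linear_combination (ε * (b0 + b1 * α' + b2 * α' ^ 2 + b3 * α' ^ 3)) * hε
  have hp : F 0 * F 1 < 0 := by rw [h0, h1]; linarith
  have hz : (0 : ℝ) ∈ Set.uIcc (F 0) (F 1) := by
    rw [Set.mem_uIcc]
    rcases mul_neg_iff.1 hp with ⟨h, h'⟩ | ⟨h, h'⟩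
    · right; exact ⟨h'.le, h.le⟩
    · left; exact ⟨h.le, h'.le⟩
  obtain ⟨t, ht, hFt⟩ := intermediate_value_uIcc hF.continuousOn hz
  rw [Set.uIcc_of_le zero_le_one] at ht
  have hFt' : b0 * ((1 - t) + ε * t) ^ 3 + b1 * ((1 - t) * α + ε * t * α') * ((1 - t) + ε * t) ^ 2 +
    b2 * ((1 - t) * α + ε * t * α') ^ 2 * ((1 - t) + ε * t) + b3 * ((1 - t) * α + ε * t * α') ^ 3 = 0 := hFt
  obtain ⟨x, hx⟩ : ∃ x, x = (1 - t) * α + ε * t * α' := ⟨_, rfl⟩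
  obtain ⟨z, hz'⟩ : ∃ z, z = (1 - t) + ε * t := ⟨_, rfl⟩
  rw [← hx, ← hz'] at hFt'
  have hid := hS.iden x z
  rw [hFt'] at hid
  have hf := f_pos x z (by
    rintro ⟨hx0, hz0⟩
    have h2 : ε * t * (α' - α) = 0 := by linear_combination hx0 - α * hz0 - hx + α * hz'
    have h3 : (1 - t) * (α - α') = 0 := by linear_combination hx0 - α' * hz0 - hx + α' * hz'
    have hd : α' - α ≠ 0 := by intro h; linarith
    have hd' : α - α' ≠ 0 := by intro h; linarith
    have hε0 : ε ≠ 0 := by rintro rfl; norm_num at hε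
    have h4 := (mul_eq_zero.1 h2).resolve_right hd
    have h5 := (mul_eq_zero.1 h3).resolve_right hd'
    have h6 := (mul_eq_zero.1 h4).resolve_left hε0
    linarith)
  have hkf := mul_pos hk hf
  have hq : (q2 * (α * α')) * z ^ 2 + (q2 * (-(α + α'))) * x * z + q2 * x ^ 2
     = - q2 * ε * (t * (1 - t)) * (α - α') ^ 2 := by rw [hx, hz']; ring
  rw [hq] at hid
  have hpos : 0 ≤ (- (c * q2 * ε)) * ((t * (1 - t)) * (α - α') ^ 2 *
     (a0 * z ^ 2 + a1 * x * z + a2 * x ^ 2) ^ 2) := by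
    have h7 : 0 ≤ t * (1 - t) := mul_nonneg ht.1 (by linarith [ht.2])
    have h8 : 0 ≤ -(c * q2 * ε) := by linarith
    positivity
  have h9 : (- (c * q2 * ε)) * ((t * (1 - t)) * (α - α') ^ 2 *
     (a0 * z ^ 2 + a1 * x * z + a2 * x ^ 2) ^ 2) = c * (a0 * z ^ 2 + a1 * x * z + a2 * x ^ 2) ^ 2 * (- q2 * ε * (t * (1 - t)) * (α - α') ^ 2) := by ring
  rw [h9] at hpos
  linarith

theorem real_main (u v q2 a0 a1 a2 b0 b1 b2 b3 c κ NY : ℝ)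
    (hS : Sqr (q2 * v) (q2 * u) q2 a0 a1 a2 b0 b1 b2 b3 c κ)
    (hne : ¬ (a0 = 0 ∧ a1 = 0 ∧ a2 = 0 ∧ b0 = 0 ∧ b1 = 0 ∧ b2 = 0 ∧ b3 = 0))
    (hNY : u ^ 2 - 4 * v ≤ 0 → 0 < NY) (hc : c * q2 * NY < 0) (β0 β1 : ℝ)
    (hβ1 : β1 = b1 - b2 * u + b3 * (u ^ 2 - v)) (hβ0 : β0 = b0 - b2 * v + b3 * u * v) :
    0 < κ ∧ 0 ≤ (β0 ^ 2 - u * β0 * β1 + v * β1 ^ 2) * NY := by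
  have hbig : c * q2 < 0 → 0 < κ := by
    intro h
    refine kpos_of_interval u v q2 a0 a1 a2 b0 b1 b2 b3 c κ (|u| + |v| + 1) (|u| + |v| + 2) hS hne (by linarith) ?_
    intro x hx _
    apply mul_neg_of_neg_of_pos h
    have h1 := neg_abs_le u
    have h2 := neg_abs_le v
    have h3 := abs_nonneg u
    have h4 := abs_nonneg v
    nlinarith [mul_nonneg h4 (by linarith : 0 ≤ x - 1), mul_nonneg (by linarith : 0 ≤ u + |u|) (by linarith : 0 ≤ x), mul_pos (by linarith : 0 < x - |u| - |v| - 1) (by linarith : 0 < x)]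
  by_cases hD : u ^ 2 - 4 * v ≤ 0
  · have hN := hNY hD
    have hq : c * q2 < 0 := by
      by_contra h
      push Not at h
      nlinarith [mul_nonneg h hN.le]
    refine ⟨hbig hq, mul_nonneg ?_ hN.le⟩
    nlinarith [sq_nonneg (2 * β0 - u * β1), mul_nonneg (by linarith : 0 ≤ 4 * v - u ^ 2) (sq_nonneg β1)]
  · push Not at hD
    obtain ⟨s, hs0, hs⟩ : ∃ s : ℝ, 0 < s ∧ s ^ 2 = u ^ 2 - 4 * v := ⟨√(u ^ 2 - 4 * v), Real.sqrt_pos.2 hD, Real.sq_sqrt hD.le⟩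
    obtain ⟨α, hα⟩ : ∃ α, α = (-u - s) / 2 := ⟨_, rfl⟩
    obtain ⟨α', hα'⟩ : ∃ α', α' = (-u + s) / 2 := ⟨_, rfl⟩
    have hlt : α < α' := by rw [hα, hα']; linarith
    have hu : u = -(α + α') := by rw [hα, hα']; ring
    have hv : v = α * α' := by rw [hα, hα']; linear_combination hs / 4
    have hNB : β0 ^ 2 - u * β0 * β1 + v * β1 ^ 2 = (b0 + b1 * α + b2 * α ^ 2 + b3 * α ^ 3) * (b0 + b1 * α' + b2 * α' ^ 2 + b3 * α' ^ 3) := by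
      rw [hβ0, hβ1, hu, hv]; ring
    rw [hNB]
    clear hNB hα hα' hNY
    subst hu hv
    rcases lt_trichotomy (c * q2) 0 with h | h | h
    · have hk := hbig h
      refine ⟨hk, ?_⟩
      have h1 := ivt_sign α α' q2 a0 a1 a2 b0 b1 b2 b3 c κ 1 hlt hS hk (by norm_num) (by linarith)
      have h2 : 0 < NY := by
        by_contra hh
        push Not at hh
        nlinarith [mul_nonneg_of_nonpos_of_nonpos h.le hh]
      rw [one_mul] at h1
      exact mul_nonneg h1 h2.le
    · rw [h] at hc; simp at hc
    · have hk : 0 < κ := by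
        refine kpos_of_interval _ _ q2 a0 a1 a2 b0 b1 b2 b3 c κ α α' hS hne hlt ?_
        intro x h1 h2
        apply mul_neg_of_pos_of_neg h
        nlinarith [mul_pos (sub_pos.2 h1) (sub_pos.2 h2)]
      refine ⟨hk, ?_⟩
      have h1 := ivt_sign α α' q2 a0 a1 a2 b0 b1 b2 b3 c κ (-1) hlt hS hk (by norm_num) (by linarith)
      have h2 : NY < 0 := by
        by_contra hh
        push Not at hh
        nlinarith [mul_nonneg h.le hh]
      apply mul_nonneg_of_nonpos_of_nonpos _ h2.le
      linarith
end S7b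

section S7c
theorem NY_ne (u v q2 c0 c1 c2 c3 d r0 r1 r2 r3 r4 : ℚ) (hd : d ≠ 0) 
    (hR : Rel (q2 * v) (q2 * u) q2 c0 c1 c2 c3 d r0 r1 r2 r3 r4) (y0 y1 : ℚ)
    (hy1 : y1 = 2 * c1 - (2 * c2 + d) * u + (2 * c3 + d) * (u ^ 2 - v))
    (hy0 : y0 = (2 * c0 + d) - (2 * c2 + d) * v + (2 * c3 + d) * u * v) :
    y0 ^ 2 - u * y0 * y1 + v * y1 ^ 2 ≠ 0 := by
  intro h0
  obtain ⟨s, hs⟩ := IsAlgClosed.exists_pow_nat_eq ((u : ℂ) ^ 2 - 4 * v) (n := 2) (by norm_num)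
  have key : ∀ α : ℂ, α ^ 2 + u * α + v = 0 → (y0 : ℂ) + y1 * α = 0 → False := by
    intro α hα hy
    have hid := (hR.map (algebraMap ℚ ℂ)).iden α 1
    simp only [map_mul, eq_ratCast] at hid
    rw [hy0, hy1] at hy
    push_cast at hy
    have hY : ((2 * c0 + d) + 2 * c1 * α + (2 * c2 + d) * α ^ 2 + (2 * c3 + d) * α ^ 3 : ℂ) = 0 := by
      linear_combination hy + ((2 * c2 + d) + (2 * c3 + d) * (α - u)) * hα
    have hf0 : (d : ℂ) ^ 2 * (α ^ 6 + 2 * α ^ 5 + α ^ 4 + 2 * α ^ 3 + 6 * α ^ 2 + 4 * α + 1) = 0 := by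
      linear_combination (-4) * hid + ((2 * c0 + d) + 2 * c1 * α + (2 * c2 + d) * α ^ 2 + (2 * c3 + d) * α ^ 3 : ℂ) * hY
        - 4 * q2 * (r0 + r1 * α + r2 * α ^ 2 + r3 * α ^ 3 + r4 * α ^ 4) * hα
    have hf := (mul_eq_zero.1 hf0).resolve_left (pow_ne_zero 2 (by exact_mod_cast hd))
    have hm : fQ = minpoly ℚ α := minpoly.eq_of_irreducible_of_monic fQ_irr (by
      simp only [fQ, map_add, map_mul, map_pow, aeval_X, map_one, map_ofNat]
      exact hf) fQ_monic
    have hq : (X ^ 2 + C u * X + C v : ℚ[X]).natDegree = 2 := by compute_degree!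
    have hdeg := natDegree_le_of_dvd (minpoly.dvd ℚ α (p := X ^ 2 + C u * X + C v) (by simpa using hα))
      (by intro h; rw [h] at hq; simp at hq)
    rw [← hm, hq, fQ_natDegree] at hdeg
    omega
  have hprod : ((y0 : ℂ) + y1 * ((-u + s) / 2)) * ((y0 : ℂ) + y1 * ((-u - s) / 2)) = 0 := by
    have : ((y0 ^ 2 - u * y0 * y1 + v * y1 ^ 2 : ℚ) : ℂ) = 0 := by rw [h0]; simp
    push_cast at this
    linear_combination this - y1 ^ 2 / 4 * hs
  rcases mul_eq_zero.1 hprod with h | h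
  · exact key _ (by linear_combination hs / 4) h
  · exact key _ (by linear_combination hs / 4) h

theorem alg1 {K : Type*} [Field K] (u v q2 c0 c1 c2 c3 d r0 r1 r2 r3 r4 : K) 
    (hR : Rel (q2 * v) (q2 * u) q2 c0 c1 c2 c3 d r0 r1 r2 r3 r4) (y0 y1 : K)
    (hy1 : y1 = 2 * c1 - (2 * c2 + d) * u + (2 * c3 + d) * (u ^ 2 - v))
    (hy0 : y0 = (2 * c0 + d) - (2 * c2 + d) * v + (2 * c3 + d) * u * v)
    (a0 a1 a2 b0 b1 b2 b3 c κ β0 β1 : K) (hS : Sqr (q2 * v) (q2 * u) q2 a0 a1 a2 b0 b1 b2 b3 c κ)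
    (hβ1 : β1 = b1 - b2 * u + b3 * (u ^ 2 - v)) (hβ0 : β0 = b0 - b2 * v + b3 * u * v) :
    d ^ 2 * (2 * β0 * β1 - u * β1 ^ 2) = κ * (2 * y0 * y1 - u * y1 ^ 2) ∧
    d ^ 2 * (β0 ^ 2 - v * β1 ^ 2) = κ * (y0 ^ 2 - v * y1 ^ 2) := by
  obtain ⟨e0, e1, e2, e3, e4, e5, e6⟩ := hR
  obtain ⟨g0, g1, g2, g3, g4, g5, g6⟩ := hS
  subst hy1 hy0 hβ1 hβ0
  constructor
  · linear_combination ((1) * u ^ 0 * v ^ 0) * (d ^ 2 * g1 - 4 * κ * e1) + ((-1) * u ^ 1 * v ^ 0) * (d ^ 2 * g2 - 4 * κ * e2) + ((-1) * u ^ 0 * v ^ 1 + (1) * u ^ 2 * v ^ 0) * (d ^ 2 * g3 - 4 * κ * e3) + ((2) * u ^ 1 * v ^ 1 + (-1) * u ^ 3 * v ^ 0) * (d ^ 2 * g4 - 4 * κ * e4) + ((1) * u ^ 0 * v ^ 2 + (-3) * u ^ 2 * v ^ 1 + (1) * u ^ 4 * v ^ 0) * (d ^ 2 * g5 - 4 *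 κ * e5) + ((-3) * u ^ 1 * v ^ 2 + (4) * u ^ 3 * v ^ 1 + (-1) * u ^ 5 * v ^ 0) * (d ^ 2 * g6 - 4 * κ * e6)
  · linear_combination ((1) * u ^ 0 * v ^ 0) * (d ^ 2 * g0 - 4 * κ * e0) + ((-1) * u ^ 0 * v ^ 1) * (d ^ 2 * g2 - 4 * κ * e2) + ((1) * u ^ 1 * v ^ 1) * (d ^ 2 * g3 - 4 * κ * e3) + ((1) * u ^ 0 * v ^ 2 + (-1) * u ^ 2 * v ^ 1) * (d ^ 2 * g4 - 4 * κ * e4) + ((-2) * u ^ 1 * v ^ 2 + (1) * u ^ 3 * v ^ 1) * (d ^ 2 * g5 - 4 * κ * e5) + ((-1) * u ^ 0 * v ^ 3 + (3) * u ^ 2 * v ^ 2 + (-1) * u ^ 4 * v ^ 1) * (d ^ 2 * g6 - 4 * κ * e6)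

theorem alg2 (u v d κ y0 y1 β0 β1 : ℚ) (h1 : d ^ 2 * (2 * β0 * β1 - u * β1 ^ 2) = κ * (2 * y0 * y1 - u * y1 ^ 2))
    (h0 : d ^ 2 * (β0 ^ 2 - v * β1 ^ 2) = κ * (y0 ^ 2 - v * y1 ^ 2)) (hd : d ≠ 0) (hk : 0 < κ)
    (hN : y0 ^ 2 - u * y0 * y1 + v * y1 ^ 2 ≠ 0) 
    (hpos : 0 ≤ (β0 ^ 2 - u * β0 * β1 + v * β1 ^ 2) * (y0 ^ 2 - u * y0 * y1 + v * y1 ^ 2)) :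
    ∃ μ, β0 = μ * y0 ∧ β1 = μ * y1 ∧ κ = μ ^ 2 * d ^ 2 := by
  obtain ⟨N, hNd⟩ : ∃ N, N = y0 ^ 2 - u * y0 * y1 + v * y1 ^ 2 := ⟨_, rfl⟩
  rw [← hNd] at hN hpos
  obtain ⟨m0, hm0⟩ : ∃ m0, m0 = (β0 * (y0 - u * y1) + v * β1 * y1) / N := ⟨_, rfl⟩
  obtain ⟨m1, hm1⟩ : ∃ m1, m1 = (β1 * y0 - β0 * y1) / N := ⟨_, rfl⟩
  rw [eq_div_iff hN] at hm0 hm1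
  have hb0 : β0 = m0 * y0 - v * m1 * y1 := by
    apply mul_right_cancel₀ hN
    linear_combination -y0 * hm0 + v * y1 * hm1 + β0 * hNd
  have hb1 : β1 = m0 * y1 + m1 * y0 - u * m1 * y1 := by
    apply mul_right_cancel₀ hN
    linear_combination -y1 * hm0 - y0 * hm1 + u * y1 * hm1 + β1 * hNd
  clear hm0 hm1
  subst hb0 hb1
  have hN2 : N ^ 2 ≠ 0 := pow_ne_zero 2 hN
  have P : d ^ 2 * (m0 ^ 2 - v * m1 ^ 2) - κ = 0 := by
    apply (mul_eq_zero.1 (_ : N ^ 2 * _ = 0)).resolve_left hN2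
    rw [hNd]
    linear_combination (y0 ^ 2 - v * y1 ^ 2 - u * (2 * y0 * y1 - u * y1 ^ 2)) * h0 + v * (2 * y0 * y1 - u * y1 ^ 2) * h1
  have Q : d ^ 2 * (2 * m0 * m1 - u * m1 ^ 2) = 0 := by
    apply (mul_eq_zero.1 (_ : N ^ 2 * _ = 0)).resolve_left hN2
    rw [hNd]
    linear_combination (y0 ^ 2 - v * y1 ^ 2) * h1 - (2 * y0 * y1 - u * y1 ^ 2) * h0
  have Q' := (mul_eq_zero.1 Q).resolve_left (pow_ne_zero 2 hd)
  have Q'' : m1 * (2 * m0 - u * m1) = 0 := by linear_combination Q'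
  rcases mul_eq_zero.1 Q'' with hm | hm
  · subst hm
    exact ⟨m0, by ring, by ring, by linear_combination -P⟩
  · exfalso
    have hm0 : m0 = u * m1 / 2 := by linear_combination hm / 2
    subst hm0
    have e : ((u * m1 / 2 * y0 - v * m1 * y1) ^ 2 - u * (u * m1 / 2 * y0 - v * m1 * y1) * (u * m1 / 2 * y1 + m1 * y0 - u * m1 * y1) +
       v * (u * m1 / 2 * y1 + m1 * y0 - u * m1 * y1) ^ 2) * N = (v * m1 ^ 2 - u ^ 2 * m1 ^ 2 / 4) * N ^ 2 := by rw [hNd]; ring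
    rw [e] at hpos
    have hNp : 0 < N ^ 2 := by positivity
    have h3 : 0 ≤ v * m1 ^ 2 - u ^ 2 * m1 ^ 2 / 4 := by
      by_contra h
      push Not at h
      linarith [mul_neg_of_neg_of_pos h hNp]
    have h4 := mul_nonneg (sq_nonneg d) h3
    linarith

theorem alg3 {K : Type*} [Field K] (u v q2 c0 c1 c2 c3 d : K) (hq2 : q2 ≠ 0) (y0 y1 : K)
    (hy1 : y1 = 2 * c1 - (2 * c2 + d) * u + (2 * c3 + d) * (u ^ 2 - v))
    (hy0 : y0 = (2 * c0 + d) - (2 * c2 + d) * v + (2 * c3 + d) * u * v)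
    (a0 a1 a2 b0 b1 b2 b3 c κ μ : K) (hS : Sqr (q2 * v) (q2 * u) q2 a0 a1 a2 b0 b1 b2 b3 c κ)
    (hβ1 : b1 - b2 * u + b3 * (u ^ 2 - v) = μ * y1) (hβ0 : b0 - b2 * v + b3 * u * v = μ * y0)
    (hκ : κ = μ ^ 2 * d ^ 2) :
    ∃ e0 e1 e2 e3 V t0 t1, V = -2 * μ * d ∧ Rel a0 a1 a2 e0 e1 e2 e3 V (c * (a0 * (q2 * v))) (c * (a0 * (q2 * u) + a1 * (q2 * v)))
      (c * (a0 * q2 + a1 * (q2 * u) + a2 * (q2 * v))) (c * (a1 * q2 + a2 * (q2 * u))) (c * (a2 * q2)) ∧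
      d * e0 = V * c0 + q2 * v * t0 ∧ d * e1 = V * c1 + q2 * u * t0 + q2 * v * t1 ∧
      d * e2 = V * c2 + q2 * t0 + q2 * u * t1 ∧ d * e3 = V * c3 + q2 * t1 := by
  obtain ⟨g0, g1, g2, g3, g4, g5, g6⟩ := hS
  obtain ⟨t1, ht1⟩ : ∃ t1, t1 = (b3 - μ * (2 * c3 + d)) / q2 := ⟨_, rfl⟩
  obtain ⟨t0, ht0⟩ : ∃ t0, t0 = ((b2 - μ * (2 * c2 + d)) - (b3 - μ * (2 * c3 + d)) * u) / q2 := ⟨_, rfl⟩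
  rw [eq_div_iff hq2] at ht0 ht1
  subst hy1 hy0 hκ
  refine ⟨μ * d - b0, -b1, μ * d - b2, μ * d - b3, -2 * μ * d, -d * t0, -d * t1, rfl, ?_, ?_, ?_, ?_, ?_⟩
  · constructor
    · linear_combination g0
    · linear_combination g1
    · linear_combination g2
    · linear_combination g3
    · linear_combination g4
    · linear_combination g5
    · linear_combination g6
  · linear_combination d * v * ht0 - d * hβ0
  · linear_combination d * u * ht0 + d * v * ht1 - d * hβ1
  · linear_combination d * ht0 + d * u * ht1
  · linear_combination d * ht1
end S7c

section S7d
variable {L : Type} [Field L] [NumberField L] {θ ι : 𝓞 L}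

theorem half_rat (S : Setup L θ ι) {q0 q1 q2 : ℤ} (hv : Val q0 q1 q2) (hq2 : q2 ≠ 0) 
    {c0 c1 c2 c3 d r0 r1 r2 r3 r4 : ℤ} (hd : d ≠ 0) (hR : Rel q0 q1 q2 c0 c1 c2 c3 d r0 r1 r2 r3 r4) :
    ∃ c : ℤ, (c = 1 ∨ c = -1) ∧ ∃ a0 a1 a2 e0 e1 e2 e3 V t0 t1 : ℚ, V ≠ 0 ∧ 
      Rel a0 a1 a2 e0 e1 e2 e3 V (c * (a0 * q0)) (c * (a0 * q1 + a1 * q0))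
      (c * (a0 * q2 + a1 * q1 + a2 * q0)) (c * (a1 * q2 + a2 * q1)) (c * (a2 * q2)) ∧
      d * e0 = V * c0 + q0 * t0 ∧ d * e1 = V * c1 + q1 * t0 + q0 * t1 ∧
      d * e2 = V * c2 + q2 * t0 + q1 * t1 ∧ d * e3 = V * c3 + q2 * t1 := by
  have hR' := hR.map (Int.castRingHom ℚ)
  simp only [eq_intCast] at hR'
  have hq : (q2 : ℚ) ≠ 0 := by exact_mod_cast hq2
  have hd' : (d : ℚ) ≠ 0 := by exact_mod_cast hd
  obtain ⟨u, hu⟩ : ∃ u : ℚ, u = q1 / q2 := ⟨_, rfl⟩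
  obtain ⟨v, hvv⟩ : ∃ v : ℚ, v = q0 / q2 := ⟨_, rfl⟩
  have hu' : (q1 : ℚ) = q2 * u := by rw [hu]; field_simp
  have hv' : (q0 : ℚ) = q2 * v := by rw [hvv]; field_simp
  rw [hu', hv'] at hR'
  obtain ⟨y1, hy1⟩ : ∃ y1 : ℚ, y1 = 2 * c1 - (2 * c2 + d) * u + (2 * c3 + d) * (u ^ 2 - v) := ⟨_, rfl⟩
  obtain ⟨y0, hy0⟩ : ∃ y0 : ℚ, y0 = (2 * c0 + d) - (2 * c2 + d) * v + (2 * c3 + d) * u * v := ⟨_, rfl⟩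
  have hNY := NY_ne u v q2 c0 c1 c2 c3 d r0 r1 r2 r3 r4 hd' hR' y0 y1 hy1 hy0
  obtain ⟨s, hs⟩ := selmer S hv
  have hs' : (s : L) ^ 2 = (q0 : L) + q1 * θ + q2 * (θ : L) ^ 2 := by
    have := congrArg (fun x : 𝓞 L => (x : L)) hs
    simpa using this.symm
  have hι : (ι : L) ^ 2 = -1 := by
    have := congrArg (fun x : 𝓞 L => (x : L)) S.hι
    simpa using this
  obtain ⟨c, hc, hcn, s', hss⟩ : ∃ c : ℤ, (c = 1 ∨ c = -1) ∧ (c : ℚ) * q2 * (y0 ^ 2 - u * y0 * y1 + v * y1 ^ 2) < 0 ∧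
      ∃ s' : L, s' ^ 2 = ((c : ℚ) : L) * (((q0 : ℚ) : L) + ((q1 : ℚ) : L) * θ + ((q2 : ℚ) : L) * (θ : L) ^ 2) := by
    rcases lt_or_gt_of_ne (mul_ne_zero hq hNY) with h | h
    · refine ⟨1, Or.inl rfl, by push_cast; linarith, s, ?_⟩
      push_cast
      linear_combination hs'
    · refine ⟨-1, Or.inr rfl, by push_cast; linarith, ι * s, ?_⟩
      push_cast
      linear_combination (s : L) ^ 2 * hι - hs'
  obtain ⟨a0, a1, a2, b0, b1, b2, b3, κ, hne, hS⟩ := exists_sqr S q0 q1 q2 c s' hss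
  rw [hu', hv'] at hS
  have hSR := hS.map (Rat.castHom ℝ)
  simp only [Rat.coe_castHom, Rat.cast_mul, Rat.cast_intCast] at hSR
  have hm := real_main u v q2 a0 a1 a2 b0 b1 b2 b3 c κ ((y0 ^ 2 - u * y0 * y1 + v * y1 ^ 2 : ℚ) : ℝ) hSR 
    (by exact_mod_cast hne) (by
      intro h
      have h' : u ^ 2 - 4 * v ≤ 0 := by exact_mod_cast h
      have h2 : 0 ≤ y0 ^ 2 - u * y0 * y1 + v * y1 ^ 2 := by
        nlinarith [sq_nonneg (2 * y0 - u * y1), mul_nonneg (by linarith : 0 ≤ 4 * v - u ^ 2) (sq_nonneg y1)]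
      exact_mod_cast lt_of_le_of_ne h2 hNY.symm) (by exact_mod_cast hcn) 
    ((b0 - b2 * v + b3 * u * v : ℚ) : ℝ) ((b1 - b2 * u + b3 * (u ^ 2 - v) : ℚ) : ℝ) (by push_cast; ring) (by push_cast; ring)
  obtain ⟨hk, hpos⟩ := hm
  have hk' : 0 < κ := by exact_mod_cast hk
  have hE := alg1 u v q2 c0 c1 c2 c3 d r0 r1 r2 r3 r4 hR' y0 y1 hy1 hy0 a0 a1 a2 b0 b1 b2 b3 c κ _ _ hS rfl rfl
  obtain ⟨μ, m0, m1, hκ⟩ := alg2 u v d κ y0 y1 _ _ hE.1 hE.2 hd' hk' hNY (by exact_mod_cast hpos)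
  obtain ⟨e0, e1, e2, e3, V, t0, t1, hV, hRel, k0, k1, k2, k3⟩ := alg3 u v q2 c0 c1 c2 c3 d hq y0 y1 hy1 hy0 a0 a1 a2 b0 b1 b2 b3 c κ μ hS m1 m0 hκ
  rw [← hu', ← hv'] at hRel
  rw [← hv'] at k0
  rw [← hv', ← hu'] at k1
  rw [← hu'] at k2
  refine ⟨c, hc, a0, a1, a2, e0, e1, e2, e3, V, t0, t1, ?_, hRel, k0, k1, k2, k3⟩
  rw [hV]
  have : μ ≠ 0 := by rintro rfl; simp at hκ; linarith
  simp [this, hd']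

def HR (q0 q1 q2 c c0 c1 c2 c3 d a0 a1 a2 e0 e1 e2 e3 V t0 t1 : ℤ) : Prop :=
  Rel a0 a1 a2 e0 e1 e2 e3 V (c * (a0 * q0)) (c * (a0 * q1 + a1 * q0))
      (c * (a0 * q2 + a1 * q1 + a2 * q0)) (c * (a1 * q2 + a2 * q1)) (c * (a2 * q2)) ∧
      d * e0 = V * c0 + q0 * t0 ∧ d * e1 = V * c1 + q1 * t0 + q0 * t1 ∧
      d * e2 = V * c2 + q2 * t0 + q1 * t1 ∧ d * e3 = V * c3 + q2 * t1

theorem HR_descend (q0 q1 q2 c c0 c1 c2 c3 d : ℤ) (n : ℕ) : ∀ a0 a1 a2 e0 e1 e2 e3 V t0 t1 : ℤ, V ≠ 0 → V.natAbs ≤ n →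
    HR q0 q1 q2 c c0 c1 c2 c3 d a0 a1 a2 e0 e1 e2 e3 V t0 t1 → 
    ∃ a0 a1 a2 e0 e1 e2 e3 V t0 t1 : ℤ, V ≠ 0 ∧ HR q0 q1 q2 c c0 c1 c2 c3 d a0 a1 a2 e0 e1 e2 e3 V t0 t1 ∧ 
     ¬ (2 ∣ a0 ∧ 2 ∣ a1 ∧ 2 ∣ a2 ∧ 2 ∣ e0 ∧ 2 ∣ e1 ∧ 2 ∣ e2 ∧ 2 ∣ e3 ∧ 2 ∣ V ∧ 2 ∣ t0 ∧ 2 ∣ t1) := by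
  induction n with
  | zero => intro a0 a1 a2 e0 e1 e2 e3 V t0 t1 hV hn; omega
  | succ n ih =>
    intro a0 a1 a2 e0 e1 e2 e3 V t0 t1 hV hn h
    by_cases hall : (2 ∣ a0 ∧ 2 ∣ a1 ∧ 2 ∣ a2 ∧ 2 ∣ e0 ∧ 2 ∣ e1 ∧ 2 ∣ e2 ∧ 2 ∣ e3 ∧ 2 ∣ V ∧ 2 ∣ t0 ∧ 2 ∣ t1)
    · obtain ⟨⟨a0, rfl⟩, ⟨a1, rfl⟩, ⟨a2, rfl⟩, ⟨e0, rfl⟩, ⟨e1, rfl⟩, ⟨e2, rfl⟩, ⟨e3, rfl⟩, ⟨V, rfl⟩, ⟨t0, rfl⟩, ⟨t1, rfl⟩⟩ := hall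
      obtain ⟨⟨g0, g1, g2, g3, g4, g5, g6⟩, k0, k1, k2, k3⟩ := h
      refine ih a0 a1 a2 e0 e1 e2 e3 V t0 t1 (by omega) (by omega) ⟨⟨?_, ?_, ?_, ?_, ?_, ?_, ?_⟩, ?_, ?_, ?_, ?_⟩
      · linarith
      · linarith
      · linarith
      · linarith
      · linarith
      · linarith
      · linarith
      · linarith
      · linarith
      · linarith
      · linarith
    · exact ⟨a0, a1, a2, e0, e1, e2, e3, V, t0, t1, hV, h, hall⟩

theorem HR_of_rat (q0 q1 q2 c c0 c1 c2 c3 d : ℤ) (a0 a1 a2 e0 e1 e2 e3 V t0 t1 : ℚ) (hV : V ≠ 0)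
    (h : Rel a0 a1 a2 e0 e1 e2 e3 V (c * (a0 * q0)) (c * (a0 * q1 + a1 * q0))
      (c * (a0 * q2 + a1 * q1 + a2 * q0)) (c * (a1 * q2 + a2 * q1)) (c * (a2 * q2)))
    (k0 : d * e0 = V * c0 + q0 * t0) (k1 : d * e1 = V * c1 + q1 * t0 + q0 * t1) 
    (k2 : d * e2 = V * c2 + q2 * t0 + q1 * t1) (k3 : d * e3 = V * c3 + q2 * t1) :
    ∃ a0 a1 a2 e0 e1 e2 e3 V t0 t1 : ℤ, V ≠ 0 ∧ HR q0 q1 q2 c c0 c1 c2 c3 d a0 a1 a2 e0 e1 e2 e3 V t0 t1 := by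
  obtain ⟨N, hN⟩ := IsLocalization.exist_integer_multiples_of_finset (nonZeroDivisors ℤ) ({a0, a1, a2, e0, e1, e2, e3, V, t0, t1} : Finset ℚ)
  have hN0 : (N : ℤ) ≠ 0 := nonZeroDivisors.ne_zero N.2
  generalize (N : ℤ) = N at hN hN0
  have hq : ∀ x ∈ ({a0, a1, a2, e0, e1, e2, e3, V, t0, t1} : Finset ℚ), ∃ y : ℤ, (y : ℚ) = N * x := by
    intro x hx
    obtain ⟨y, hy⟩ := hN x hx
    exact ⟨y, by simpa using hy⟩
  obtain ⟨A0, hA0⟩ := hq a0 (by simp)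
  obtain ⟨A1, hA1⟩ := hq a1 (by simp)
  obtain ⟨A2, hA2⟩ := hq a2 (by simp)
  obtain ⟨E0, hE0⟩ := hq e0 (by simp)
  obtain ⟨E1, hE1⟩ := hq e1 (by simp)
  obtain ⟨E2, hE2⟩ := hq e2 (by simp)
  obtain ⟨E3, hE3⟩ := hq e3 (by simp)
  obtain ⟨V', hV'⟩ := hq V (by simp)
  obtain ⟨T0, hT0⟩ := hq t0 (by simp)
  obtain ⟨T1, hT1⟩ := hq t1 (by simp)
  have hN' : (N : ℚ) ≠ 0 := by exact_mod_cast hN0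
  obtain ⟨g0, g1, g2, g3, g4, g5, g6⟩ := h
  refine ⟨A0, A1, A2, E0, E1, E2, E3, V', T0, T1, ?_, ⟨?_, ?_, ?_, ?_, ?_, ?_, ?_⟩, ?_, ?_, ?_, ?_⟩
  · have : (V' : ℚ) ≠ 0 := by rw [hV']; exact mul_ne_zero hN' hV
    exact_mod_cast this
  all_goals (apply Int.cast_injective (α := ℚ); push_cast; simp only [hA0, hA1, hA2, hE0, hE1, hE2, hE3, hV', hT0, hT1])
  · linear_combination (N : ℚ) ^ 2 * g0
  · linear_combination (N : ℚ) ^ 2 * g1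
  · linear_combination (N : ℚ) ^ 2 * g2
  · linear_combination (N : ℚ) ^ 2 * g3
  · linear_combination (N : ℚ) ^ 2 * g4
  · linear_combination (N : ℚ) ^ 2 * g5
  · linear_combination (N : ℚ) ^ 2 * g6
  · linear_combination (N : ℚ) * k0
  · linear_combination (N : ℚ) * k1
  · linear_combination (N : ℚ) * k2
  · linear_combination (N : ℚ) * k3
end S7d

section S7e
variable {L : Type} [Field L] [NumberField L] {θ ι : 𝓞 L}

theorem even_zmod {n : ℤ} : (n : ZMod 2) = 0 ↔ 2 ∣ n := ZMod.intCast_zmod_eq_zero_iff_dvd n 2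

set_option synthInstance.maxHeartbeats 400000 in
set_option synthInstance.maxSize 1000 in
theorem dec_A : ∀ e0 e1 e2 e3 V : ZMod 2, 
  e0 ^ 2 + V * e0 = 0 → 2 * e0 * e1 + V * e1 - V ^ 2 = 0 → 2 * e0 * e2 + e1 ^ 2 + V * (e2 + e0) - V ^ 2 = 0 →
  2 * e0 * e3 + 2 * e1 * e2 + V * (e3 + e1 + e0) = 0 → 2 * e1 * e3 + e2 ^ 2 + V * (e2 + e1) = 0 →
  2 * e2 * e3 + V * (e3 + e2) = 0 → e3 ^ 2 + V * e3 = 0 → e0 = 0 ∧ e1 = 0 ∧ e2 = 0 ∧ e3 = 0 ∧ V = 0 := by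
  decide +kernel

set_option synthInstance.maxHeartbeats 400000 in
set_option synthInstance.maxSize 1000 in
theorem dec_t : ∀ q0 q1 q2 t0 t1 : ZMod 2, ¬ (q0 = 0 ∧ q1 = 0 ∧ q2 = 0) → 
  q0 * t0 = 0 → q1 * t0 + q0 * t1 = 0 → q2 * t0 + q1 * t1 = 0 → q2 * t1 = 0 → t0 = 0 ∧ t1 = 0 := by
  decide +kernel

set_option synthInstance.maxHeartbeats 400000 in
set_option synthInstance.maxSize 1000 in
theorem dec_V : ∀ a0 a1 a2 q0 q1 q2 : ZMod 2, ¬ (q0 = 0 ∧ q1 = 0 ∧ q2 = 0) → 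
  0 = a0 * (a0 * q0) → 0 = a0 * (a0 * q1 + a1 * q0) + a1 * (a0 * q0) → 
  0 = a0 * (a0 * q2 + a1 * q1 + a2 * q0) + a1 * (a0 * q1 + a1 * q0) + a2 * (a0 * q0) →
  0 = a0 * (a1 * q2 + a2 * q1) + a1 * (a0 * q2 + a1 * q1 + a2 * q0) + a2 * (a0 * q1 + a1 * q0) →
  0 = a0 * (a2 * q2) + a1 * (a1 * q2 + a2 * q1) + a2 * (a0 * q2 + a1 * q1 + a2 * q0) →
  0 = a1 * (a2 * q2) + a2 * (a1 * q2 + a2 * q1) → 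
  0 = a2 * (a2 * q2) → a0 = 0 ∧ a1 = 0 ∧ a2 = 0 := by
  decide +kernel

theorem dec_h : ∀ t0 t1 : ZMod 2, t0 * ((t1 ^ 3 + (-t0) ^ 2 * t1 + (-t0) ^ 3)) = 0 → t1 * ((t1 ^ 3 + (-t0) ^ 2 * t1 + (-t0) ^ 3)) = 0 → t0 = 0 ∧ t1 = 0 := by
  decide +kernel

theorem cancelq {q0 q1 q2 g0 g1 g2 g3 g4 : ℤ} (hq : q2 ≠ 0) (h6 : q2 * g4 = 0) (h5 : q2 * g3 + q1 * g4 = 0)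
   (h4 : q2 * g2 + q1 * g3 + q0 * g4 = 0) (h3 : q2 * g1 + q1 * g2 + q0 * g3 = 0) (h2 : q2 * g0 + q1 * g1 + q0 * g2 = 0) :
   g0 = 0 ∧ g1 = 0 ∧ g2 = 0 ∧ g3 = 0 ∧ g4 = 0 := by
  have a4 := (mul_eq_zero.1 h6).resolve_left hq
  subst a4
  have a3 := (mul_eq_zero.1 (by linarith : q2 * g3 = 0)).resolve_left hq
  subst a3
  have a2 := (mul_eq_zero.1 (by linarith : q2 * g2 = 0)).resolve_left hq
  subst a2
  have a1 := (mul_eq_zero.1 (by linarith : q2 * g1 = 0)).resolve_left hq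
  subst a1
  have a0 := (mul_eq_zero.1 (by linarith : q2 * g0 = 0)).resolve_left hq
  subst a0
  simp

theorem Vpart {q0 q1 q2 c c0 c1 c2 c3 d a0 a1 a2 e0 e1 e2 e3 V t0 t1 r0 r1 r2 r3 r4 : ℤ} (hq2 : q2 ≠ 0) (hV : V ≠ 0)
    (hc : c = 1 ∨ c = -1) (hd : ¬ 2 ∣ d) (hR : Rel q0 q1 q2 c0 c1 c2 c3 d r0 r1 r2 r3 r4)
    (hH : HR q0 q1 q2 c c0 c1 c2 c3 d a0 a1 a2 e0 e1 e2 e3 V t0 t1) (hVe : 2 ∣ V) : 2 ∣ t0 ∧ 2 ∣ t1 := by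
  obtain ⟨⟨g0, g1, g2, g3, g4, g5, g6⟩, k0, k1, k2, k3⟩ := hH
  obtain ⟨s0, s1, s2, s3, s4, s5, s6⟩ := hR
  -- the quotient identity
  obtain ⟨G0, G1, G2, G3, G4⟩ := cancelq (q0 := q0) (q1 := q1) (q2 := q2)
    (g0 := q0 * t0 ^ 2 + V * (t0 * (2 * c0 + d)) + V ^ 2 * r0 - c * d ^ 2 * a0 ^ 2)
    (g1 := 2 * q0 * t0 * t1 + q1 * t0 ^ 2 + V * (t0 * (2 * c1) + t1 * (2 * c0 + d)) + V ^ 2 * r1 - c * d ^ 2 * (2 * a0 * a1))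
    (g2 := q0 * t1 ^ 2 + 2 * q1 * t0 * t1 + q2 * t0 ^ 2 + V * (t0 * (2 * c2 + d) + t1 * (2 * c1)) + V ^ 2 * r2 - c * d ^ 2 * (2 * a0 * a2 + a1 ^ 2))
    (g3 := q1 * t1 ^ 2 + 2 * q2 * t0 * t1 + V * (t0 * (2 * c3 + d) + t1 * (2 * c2 + d)) + V ^ 2 * r3 - c * d ^ 2 * (2 * a1 * a2))
    (g4 := q2 * t1 ^ 2 + V * (t1 * (2 * c3 + d)) + V ^ 2 * r4 - c * d ^ 2 * a2 ^ 2) hq2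
    (by linear_combination d ^ 2 * g6 - V ^ 2 * s6 - (d * e3 + V * c3 + q2 * t1 + V * d) * k3)
    (by linear_combination d ^ 2 * g5 - V ^ 2 * s5 - (2 * d * e3 + V * d) * k2 - (2 * (V * c2 + q2 * t0 + q1 * t1) + V * d) * k3)
    (by linear_combination d ^ 2 * g4 - V ^ 2 * s4 - (2 * d * e3 + V * d) * k1 - (2 * (V * c1 + q1 * t0 + q0 * t1)) * k3 - (d * e2 + (V * c2 + q2 * t0 + q1 * t1) + V * d) * k2)
    (by linear_combination d ^ 2 * g3 - V ^ 2 * s3 - (2 * d * e3 + V * d) * k0 - (2 * (V * c0 + q0 * t0) + V * d) * k3 - (2 * d * e2 + V * d) * k1 - 2 * (V * c1 + q1 * t0 + q0 * t1) * k2)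
    (by linear_combination d ^ 2 * g2 - V ^ 2 * s2 - (2 * d * e2 + V * d) * k0 - (2 * (V * c0 + q0 * t0) + V * d) * k2 - (d * e1 + (V * c1 + q1 * t0 + q0 * t1)) * k1)
  clear g0 g1 g2 g3 g4 g5 g6 s0 s1 s2 s3 s4 s5 s6 k0 k1 k2 k3
  have hE : V ^ 2 * (r0 * t1 ^ 4 + r1 * (-t0) * t1 ^ 3 + r2 * (-t0) ^ 2 * t1 ^ 2 + r3 * (-t0) ^ 3 * t1 + r4 * (-t0) ^ 4) =
      c * (d * (a0 * t1 ^ 2 + a1 * (-t0) * t1 + a2 * (-t0) ^ 2)) ^ 2 := by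
    linear_combination t1 ^ 4 * G0 + (-t0) * t1 ^ 3 * G1 + (-t0) ^ 2 * t1 ^ 2 * G2 + (-t0) ^ 3 * t1 * G3 + (-t0) ^ 4 * G4
  have hdv : V ∣ d * (a0 * t1 ^ 2 + a1 * (-t0) * t1 + a2 * (-t0) ^ 2) := by
    rw [← Int.pow_dvd_pow_iff (n := 2) (by norm_num)]
    rcases hc with rfl | rfl
    · exact ⟨r0 * t1 ^ 4 + r1 * (-t0) * t1 ^ 3 + r2 * (-t0) ^ 2 * t1 ^ 2 + r3 * (-t0) ^ 3 * t1 + r4 * (-t0) ^ 4, by linarith [hE]⟩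
    · exact ⟨-(r0 * t1 ^ 4 + r1 * (-t0) * t1 ^ 3 + r2 * (-t0) ^ 2 * t1 ^ 2 + r3 * (-t0) ^ 3 * t1 + r4 * (-t0) ^ 4), by linarith [hE]⟩
  obtain ⟨ρ, hρ⟩ := hdv
  obtain ⟨V', hV'⟩ := hVe
  have hx : t1 * (2 * (c0 * t1 ^ 3 + c1 * (-t0) * t1 ^ 2 + c2 * (-t0) ^ 2 * t1 + c3 * (-t0) ^ 3) + d * (t1 ^ 3 + (-t0) ^ 2 * t1 + (-t0) ^ 3))
     + V * (r1 * t1 ^ 3 + 2 * r2 * (-t0) * t1 ^ 2 + 3 * r3 * (-t0) ^ 2 * t1 + 4 * r4 * (-t0) ^ 3) = 2 * c * d * ρ * (a1 * t1 + 2 * a2 * (-t0)) := by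
    apply mul_left_cancel₀ hV
    linear_combination t1 ^ 3 * G1 + 2 * (-t0) * t1 ^ 2 * G2 + 3 * (-t0) ^ 2 * t1 * G3 + 4 * (-t0) ^ 3 * G4 + 2 * c * d * (a1 * t1 + 2 * a2 * (-t0)) * hρ
  have hz : t0 * (2 * (c0 * t1 ^ 3 + c1 * (-t0) * t1 ^ 2 + c2 * (-t0) ^ 2 * t1 + c3 * (-t0) ^ 3) + d * (t1 ^ 3 + (-t0) ^ 2 * t1 + (-t0) ^ 3))
     + V * (4 * r0 * t1 ^ 3 + 3 * r1 * (-t0) * t1 ^ 2 + 2 * r2 * (-t0) ^ 2 * t1 + r3 * (-t0) ^ 3) = 2 * c * d * ρ * (2 * a0 * t1 + a1 * (-t0)) := by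
    apply mul_left_cancel₀ hV
    linear_combination 4 * t1 ^ 3 * G0 + 3 * (-t0) * t1 ^ 2 * G1 + 2 * (-t0) ^ 2 * t1 * G2 + (-t0) ^ 3 * G3 + 2 * c * d * (2 * a0 * t1 + a1 * (-t0)) * hρ
  have hx' := congrArg (fun n : ℤ => (n : ZMod 2)) hx
  have hz' := congrArg (fun n : ℤ => (n : ZMod 2)) hz
  have h2 : (2 : ZMod 2) = 0 := rfl
  have hV2 : (V : ZMod 2) = 0 := by rw [hV']; push_cast; rw [h2]; ring
  push_cast at hx' hz'
  simp only [hV2, h2, odd_zmod hd, zero_mul, add_zero, zero_add, one_mul] at hx' hz'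
  have := dec_h _ _ hz' hx'
  exact ⟨even_zmod.1 this.1, even_zmod.1 this.2⟩

theorem half (S : Setup L θ ι) {q0 q1 q2 : ℤ} (hv : Val q0 q1 q2) (hq2 : q2 ≠ 0) :
    ∃ a0 a1 a2 e0 e1 e2 e3 V k : ℤ, Prim a0 a1 a2 ∧ ¬ 2 ∣ V ∧ ¬ 2 ∣ k ∧ 
     Rel a0 a1 a2 e0 e1 e2 e3 V (k * (a0 * q0)) (k * (a0 * q1 + a1 * q0))
      (k * (a0 * q2 + a1 * q1 + a2 * q0)) (k * (a1 * q2 + a2 * q1)) (k * (a2 * q2)) := by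
  have hp2 := hv.1 2 Nat.prime_two
  have hv' := hv
  obtain ⟨-, c0, c1, c2, c3, d, r0, r1, r2, r3, r4, hd, hR⟩ := hv'
  have hd0 : d ≠ 0 := by rintro rfl; simp at hd
  obtain ⟨c, hc, a0, a1, a2, e0, e1, e2, e3, V, t0, t1, hV, hRel, k0, k1, k2, k3⟩ := half_rat S hv hq2 hd0 hR
  obtain ⟨a0, a1, a2, e0, e1, e2, e3, V, t0, t1, hV, hH⟩ := HR_of_rat q0 q1 q2 c c0 c1 c2 c3 d a0 a1 a2 e0 e1 e2 e3 V t0 t1 hV hRel k0 k1 k2 k3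
  obtain ⟨a0, a1, a2, e0, e1, e2, e3, V, t0, t1, hV, hH, hne⟩ := HR_descend q0 q1 q2 c c0 c1 c2 c3 d _ a0 a1 a2 e0 e1 e2 e3 V t0 t1 hV le_rfl hH
  have hVp := Vpart hq2 hV hc hd hR hH
  obtain ⟨hRl, k0, k1, k2, k3⟩ := hH
  have hR2 := hRl.map (Int.castRingHom (ZMod 2))
  simp only [map_mul, map_add, eq_intCast] at hR2
  have z0 := congrArg (fun n : ℤ => (n : ZMod 2)) k0
  have z1 := congrArg (fun n : ℤ => (n : ZMod 2)) k1
  have z2 := congrArg (fun n : ℤ => (n : ZMod 2)) k2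
  have z3 := congrArg (fun n : ℤ => (n : ZMod 2)) k3
  push_cast at z0 z1 z2 z3 hp2
  have hq' : ¬ ((q0 : ZMod 2) = 0 ∧ (q1 : ZMod 2) = 0 ∧ (q2 : ZMod 2) = 0) := by simpa only [even_zmod] using hp2
  have hc2 : (c : ZMod 2) = 1 := by rcases hc with rfl | rfl <;> decide
  have hA : ¬ (2 ∣ a0 ∧ 2 ∣ a1 ∧ 2 ∣ a2) := by
    intro hA
    apply hne
    simp only [← even_zmod] at hA ⊢
    obtain ⟨h0, h1, h2⟩ := hA
    rw [h0, h1, h2] at hR2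
    obtain ⟨g0, g1, g2, g3, g4, g5, g6⟩ := hR2
    simp only [zero_mul, add_zero] at g0 g1 g2 g3 g4 g5 g6
    obtain ⟨x0, x1, x2, x3, x4⟩ := dec_A _ _ _ _ _ g0 g1 g2 g3 g4 g5 g6
    rw [x0, x4] at z0
    rw [x1, x4] at z1
    rw [x2, x4] at z2
    rw [x3, x4] at z3
    simp only [zero_mul, mul_zero, zero_add] at z0 z1 z2 z3
    have := dec_t _ _ _ _ _ hq' z0.symm z1.symm z2.symm z3.symm
    exact ⟨h0, h1, h2, x0, x1, x2, x3, x4, this.1, this.2⟩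
  have hVo : ¬ 2 ∣ V := by
    intro hVe
    apply hA
    have ht := hVp hVe
    have h20 : (2 : ZMod 2) = 0 := rfl
    simp only [← even_zmod] at hVe ht ⊢
    rw [hVe, ht.1] at z0
    rw [hVe, ht.1, ht.2] at z1 z2
    rw [hVe, ht.2] at z3
    simp only [odd_zmod hd, zero_mul, mul_zero, zero_add, one_mul] at z0 z1 z2 z3
    obtain ⟨g0, g1, g2, g3, g4, g5, g6⟩ := hR2
    simp only [z0, z1, z2, z3, hVe, hc2, h20, zero_mul, mul_zero, one_mul, add_zero, zero_add, ne_eq, OfNat.ofNat_ne_zero, not_false_eq_true, zero_pow, sub_zero] at g0 g1 g2 g3 g4 g5 g6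
    exact dec_V _ _ _ _ _ _ hq' g0 g1 g2 g3 g4 g5 g6
  -- remove the content
  obtain ⟨g, b0, b1, b2, rfl, rfl, rfl, hg⟩ : ∃ g b0 b1 b2 : ℤ, a0 = g * b0 ∧ a1 = g * b1 ∧ a2 = g * b2 ∧ Prim b0 b1 b2 := by
    obtain ⟨b, hb, hgcd⟩ := Finset.extract_gcd (s := Finset.univ) ![a0, a1, a2] (Finset.univ_nonempty)
    refine ⟨_, b 0, b 1, b 2, hb 0 (by simp), hb 1 (by simp), hb 2 (by simp), ?_⟩
    rintro ℓ hl ⟨h0, h1, h2⟩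
    have : (ℓ : ℤ) ∣ Finset.univ.gcd b := Finset.dvd_gcd (by
      intro i _
      fin_cases i
      · exact h0
      · exact h1
      · exact h2)
    rw [hgcd] at this
    exact hl.one_lt.ne' (by exact_mod_cast Int.eq_one_of_dvd_one (by positivity) this)
  have hg2 : ¬ 2 ∣ g := by
    intro h
    exact hA ⟨h.mul_right _, h.mul_right _, h.mul_right _⟩
  refine ⟨b0, b1, b2, e0, e1, e2, e3, V, c * g ^ 2, hg, hVo, ?_, ?_⟩
  · rcases hc with rfl | rfl
    · rw [one_mul, Int.prime_two.dvd_pow_iff_dvd (by norm_num)]; exact hg2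
    · rw [neg_one_mul, dvd_neg, Int.prime_two.dvd_pow_iff_dvd (by norm_num)]; exact hg2
  · obtain ⟨g0, g1, g2, g3, g4, g5, g6⟩ := hRl
    constructor
    · linear_combination g0
    · linear_combination g1
    · linear_combination g2
    · linear_combination g3
    · linear_combination g4
    · linear_combination g5
    · linear_combination g6
end S7e

section S8
variable {L : Type} [Field L] [NumberField L] {θ ι : 𝓞 L}

theorem Rel.sig {R : Type*} [CommRing R] {q0 q1 q2 c0 c1 c2 c3 d r0 r1 r2 r3 r4 : R}
    (h : Rel q0 q1 q2 c0 c1 c2 c3 d r0 r1 r2 r3 r4) :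
    Rel (q0 - q1 + q2) (2 * q0 - q1) q0 (c0 - c1 + c2 - c3) (3 * c0 - 2 * c1 + c2 + 2 * d) (3 * c0 - c1 + d) c0 d
     (r0 - r1 + r2 - r3 + r4) (4 * r0 - 3 * r1 + 2 * r2 - r3) (6 * r0 - 3 * r1 + r2) (4 * r0 - r1) r0 := by
  obtain ⟨h0, h1, h2, h3, h4, h5, h6⟩ := h
  constructor
  · linear_combination (1) * h0 + (-1) * h1 + (1) * h2 + (-1) * h3 + (1) * h4 + (-1) * h5 + (1) * h6
  · linear_combination (6) * h0 + (-5) * h1 + (4) * h2 + (-3) * h3 + (2) * h4 + (-1) * h5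
  · linear_combination (15) * h0 + (-10) * h1 + (6) * h2 + (-3) * h3 + (1) * h4
  · linear_combination (20) * h0 + (-10) * h1 + (4) * h2 + (-1) * h3
  · linear_combination (15) * h0 + (-5) * h1 + (1) * h2
  · linear_combination (6) * h0 + (-1) * h1
  · linear_combination (1) * h0

def Kn {R : Type*} [CommRing R] (q0 q1 q2 : R) : Prop :=
  (q1 = 0 ∧ q2 = 0) ∨ (q0 = 0 ∧ q1 = 0) ∨ (q0 = q2 ∧ q1 = 2 * q0) ∨ (q0 = 0 ∧ q2 = 0) ∨ (q0 = q1 ∧ q2 = 0) ∨ (q0 = 0 ∧ q1 = q2)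

theorem Kn.unsig {R : Type*} [CommRing R] {q0 q1 q2 : R} (h : Kn (q0 - q1 + q2) (2 * q0 - q1) q0) : Kn q0 q1 q2 := by
  rcases h with ⟨h, h'⟩ | ⟨h, h'⟩ | ⟨h, h'⟩ | ⟨h, h'⟩ | ⟨h, h'⟩ | ⟨h, h'⟩
  · right; left; exact ⟨h', by linear_combination 2 * h' - h⟩
  · right; right; left; exact ⟨by linear_combination h' - h, by linear_combination -h'⟩
  · left; exact ⟨by linear_combination -h' - 2 * h, by linear_combination -h' - h⟩
  · right; right; right; right; right; exact ⟨h', by linear_combination h' - h⟩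
  · right; right; right; left; exact ⟨h', by linear_combination h + h'⟩
  · right; right; right; right; left; exact ⟨by linear_combination h', by linear_combination h - h'⟩

-- A = Z ^ 2
theorem fin_Z {R : Type*} [CommRing R] (hl : ∀ x : R, x ^ 2 + x = 0 → x = 0 ∨ x = -1) {e0 e1 e2 e3 g0 g1 g2 : R}
    (h : Rel 1 0 0 e0 e1 e2 e3 1 (1 * g0) (1 * g1 + 0 * g0) (1 * g2 + 0 * g1 + 0 * g0) (0 * g2 + 0 * g1) (0 * g2)) : Kn g0 g1 g2 := by
  obtain ⟨h0, h1, h2, h3, h4, h5, h6⟩ := h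
  simp only [zero_mul, one_mul, mul_zero, add_zero, zero_add, one_pow] at h0 h1 h2 h3 h4 h5 h6
  right; right; right; right; right
  rcases hl e3 h6 with rfl | rfl
  · have a2 : e2 = 0 := by linear_combination h5
    subst a2
    have a1 : e1 = 0 := by linear_combination h4
    subst a1
    have a0 : e0 = 0 := by linear_combination h3
    subst a0
    exact ⟨by linear_combination -h0, by linear_combination h2 - h1⟩
  · have a2 : e2 = -1 := by linear_combination -h5
    subst a2
    have a1 : e1 = 0 := by linear_combination -h4
    subst a1
    have a0 : e0 = -1 := by linear_combination -h3
    subst a0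
    exact ⟨by linear_combination -h0, by linear_combination h2 - h1⟩

-- A = X * Z
theorem fin_XZ {R : Type*} [CommRing R] (hl : ∀ x : R, x ^ 2 + x = 0 → x = 0 ∨ x = -1) {e0 e1 e2 e3 g0 g1 g2 : R}
    (h : Rel 0 1 0 e0 e1 e2 e3 1 (0 * g0) (0 * g1 + 1 * g0) (0 * g2 + 1 * g1 + 0 * g0) (1 * g2 + 0 * g1) (0 * g2)) : Kn g0 g1 g2 := by
  obtain ⟨h0, h1, h2, h3, h4, h5, h6⟩ := h
  simp only [zero_mul, one_mul, mul_zero, add_zero, zero_add, one_pow] at h0 h1 h2 h3 h4 h5 h6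
  rcases hl e0 h0 with rfl | rfl
  · have a1 : e1 = 1 := by linear_combination h1
    subst a1
    rcases hl e3 h6 with rfl | rfl
    · have a2 : e2 = 0 := by linear_combination h5
      subst a2
      right; right; right; right; right
      exact ⟨by linear_combination -h2, by linear_combination h4 - h3⟩
    · have a2 : e2 = -1 := by linear_combination -h5
      subst a2
      right; right; left
      exact ⟨by linear_combination h4 - h2, by linear_combination 2 * h2 - h3⟩
  · have a1 : e1 = -1 := by linear_combination -h1
    subst a1
    rcases hl e3 h6 with rfl | rfl
    · have a2 : e2 = 0 := by linear_combination h5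
      subst a2
      right; right; left
      exact ⟨by linear_combination h4 - h2, by linear_combination 2 * h2 - h3⟩
    · have a2 : e2 = -1 := by linear_combination -h5
      subst a2
      right; right; right; right; right
      exact ⟨by linear_combination -h2, by linear_combination h4 - h3⟩

def PR {R : Type*} [CommRing R] (a0 a1 a2 e0 e1 e2 e3 V k q0 q1 q2 : R) : Prop :=
  Rel a0 a1 a2 e0 e1 e2 e3 V (k * (a0 * q0)) (k * (a0 * q1 + a1 * q0))
      (k * (a0 * q2 + a1 * q1 + a2 * q0)) (k * (a1 * q2 + a2 * q1)) (k * (a2 * q2))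

theorem PR.sig {R : Type*} [CommRing R] {a0 a1 a2 e0 e1 e2 e3 V k q0 q1 q2 : R} (h : PR a0 a1 a2 e0 e1 e2 e3 V k q0 q1 q2) :
    PR (a0 - a1 + a2) (2 * a0 - a1) a0 (e0 - e1 + e2 - e3) (3 * e0 - 2 * e1 + e2 + 2 * V) (3 * e0 - e1 + V) e0 V k (q0 - q1 + q2) (2 * q0 - q1) q0 := by
  unfold PR at *
  convert h.sig using 1 <;> ring

theorem fin_all {R : Type*} [CommRing R] (hl : ∀ x : R, x ^ 2 + x = 0 → x = 0 ∨ x = -1) {e0 e1 e2 e3 g0 g1 g2 a0 a1 a2 : R}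
    (hA : (a0 = 1 ∧ a1 = 0 ∧ a2 = 0) ∨ (a0 = 0 ∧ a1 = 0 ∧ a2 = 1) ∨ (a0 = 1 ∧ a1 = 2 ∧ a2 = 1) ∨ 
      (a0 = 0 ∧ a1 = 1 ∧ a2 = 0) ∨ (a0 = 1 ∧ a1 = 1 ∧ a2 = 0) ∨ (a0 = 0 ∧ a1 = 1 ∧ a2 = 1))
    (h : PR a0 a1 a2 e0 e1 e2 e3 1 1 g0 g1 g2) : Kn g0 g1 g2 := by
  have hneg : ∀ {a0 a1 a2 e0 e1 e2 e3 g0 g1 g2 : R}, PR a0 a1 a2 e0 e1 e2 e3 1 1 g0 g1 g2 → PR (-a0) (-a1) (-a2) e0 e1 e2 e3 1 1 g0 g1 g2 := by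
    intro a0 a1 a2 e0 e1 e2 e3 g0 g1 g2 h
    obtain ⟨h0, h1, h2, h3, h4, h5, h6⟩ := h
    refine ⟨?_, ?_, ?_, ?_, ?_, ?_, ?_⟩
    · linear_combination h0
    · linear_combination h1
    · linear_combination h2
    · linear_combination h3
    · linear_combination h4
    · linear_combination h5
    · linear_combination h6
  have hz : ∀ {a0 a1 a2 e0 e1 e2 e3 g0 g1 g2 : R}, PR a0 a1 a2 e0 e1 e2 e3 1 1 g0 g1 g2 → a0 = 1 → a1 = 0 → a2 = 0 → Kn g0 g1 g2 := by
    intro a0 a1 a2 e0 e1 e2 e3 g0 g1 g2 h h0 h1 h2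
    subst h0 h1 h2
    apply fin_Z hl (e0 := e0) (e1 := e1) (e2 := e2) (e3 := e3)
    unfold PR at h
    convert h using 1 <;> ring
  have hxz : ∀ {a0 a1 a2 e0 e1 e2 e3 g0 g1 g2 : R}, PR a0 a1 a2 e0 e1 e2 e3 1 1 g0 g1 g2 → a0 = 0 → a1 = 1 → a2 = 0 → Kn g0 g1 g2 := by
    intro a0 a1 a2 e0 e1 e2 e3 g0 g1 g2 h h0 h1 h2
    subst h0 h1 h2
    apply fin_XZ hl (e0 := e0) (e1 := e1) (e2 := e2) (e3 := e3)
    unfold PR at h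
    convert h using 1 <;> ring
  rcases hA with ⟨rfl, rfl, rfl⟩ | ⟨rfl, rfl, rfl⟩ | ⟨rfl, rfl, rfl⟩ | ⟨rfl, rfl, rfl⟩ | ⟨rfl, rfl, rfl⟩ | ⟨rfl, rfl, rfl⟩
  · exact hz h rfl rfl rfl
  · apply Kn.unsig; exact hz h.sig (by ring) (by ring) (by ring)
  · apply Kn.unsig; apply Kn.unsig; exact hz h.sig.sig (by ring) (by ring) (by ring)
  · exact hxz h rfl rfl rfl
  · apply Kn.unsig; apply Kn.unsig; exact hxz (hneg h.sig.sig) (by ring) (by ring) (by ring)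
  · apply Kn.unsig; exact hxz (hneg h.sig) (by ring) (by ring) (by ring)
end S8

section S8b
variable {L : Type} [Field L] [NumberField L] {θ ι : 𝓞 L}

theorem PR.scale {R : Type*} [CommRing R] {a0 a1 a2 e0 e1 e2 e3 V k q0 q1 q2 : R} (h : PR a0 a1 a2 e0 e1 e2 e3 V k q0 q1 q2)
    (w l k0 k1 k2 d0 d1 d2 V' : R) (hw : 2 * w = 0) (hw2 : w ^ 2 = 0) (h0 : a0 = l * k0 + w * d0) (h1 : a1 = l * k1 + w * d1)
    (h2 : a2 = l * k2 + w * d2) (hV : V * V' = 1) :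
    PR k0 k1 k2 (e0 * V') (e1 * V') (e2 * V') (e3 * V') 1 1 (k * l ^ 2 * V' ^ 2 * q0) (k * l ^ 2 * V' ^ 2 * q1) (k * l ^ 2 * V' ^ 2 * q2) := by
  have s0 : a0 ^ 2 = l ^ 2 * k0 ^ 2 := by rw [h0]; linear_combination l * k0 * d0 * hw + d0 ^ 2 * hw2
  have s1 : 2 * a0 * a1 = l ^ 2 * (2 * k0 * k1) := by rw [h0, h1]; linear_combination l * (k0 * d1 + k1 * d0) * hw + 2 * d0 * d1 * hw2
  have s2 : 2 * a0 * a2 + a1 ^ 2 = l ^ 2 * (2 * k0 * k2 + k1 ^ 2) := by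
    rw [h0, h1, h2]; linear_combination l * (k0 * d2 + k2 * d0 + k1 * d1) * hw + (2 * d0 * d2 + d1 ^ 2) * hw2
  have s3 : 2 * a1 * a2 = l ^ 2 * (2 * k1 * k2) := by rw [h2, h1]; linear_combination l * (k2 * d1 + k1 * d2) * hw + 2 * d2 * d1 * hw2
  have s4 : a2 ^ 2 = l ^ 2 * k2 ^ 2 := by rw [h2]; linear_combination l * k2 * d2 * hw + d2 ^ 2 * hw2
  clear h0 h1 h2 hw hw2
  obtain ⟨g0, g1, g2, g3, g4, g5, g6⟩ := h
  refine ⟨?_, ?_, ?_, ?_, ?_, ?_, ?_⟩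
  · linear_combination V' ^ 2 * g0 - V' * e0 * hV + k * V' ^ 2 * (q0 * s0)
  · linear_combination V' ^ 2 * g1 - V' * e1 * hV + (V * V' + 1) * hV + k * V' ^ 2 * (q0 * s1 + q1 * s0)
  · linear_combination V' ^ 2 * g2 - V' * (e2 + e0) * hV + (V * V' + 1) * hV + k * V' ^ 2 * (q0 * s2 + q1 * s1 + q2 * s0)
  · linear_combination V' ^ 2 * g3 - V' * (e3 + e1 + e0) * hV + k * V' ^ 2 * (q0 * s3 + q1 * s2 + q2 * s1)
  · linear_combination V' ^ 2 * g4 - V' * (e2 + e1) * hV + k * V' ^ 2 * (q0 * s4 + q1 * s3 + q2 * s2)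
  · linear_combination V' ^ 2 * g5 - V' * (e3 + e2) * hV + k * V' ^ 2 * (q1 * s4 + q2 * s3)
  · linear_combination V' ^ 2 * g6 - V' * e3 * hV + k * V' ^ 2 * (q2 * s4)

theorem Kn.unscale {R : Type*} [CommRing R] {k q0 q1 q2 : R} (hk : IsUnit k) (h : Kn (k * q0) (k * q1) (k * q2)) : Kn q0 q1 q2 := by
  have e : ∀ a b, k * a = k * b → a = b := fun a b h => hk.mul_left_cancel h
  have z : ∀ a, k * a = 0 → a = 0 := fun a h => e a 0 (by rw [h, mul_zero])
  rcases h with ⟨h, h'⟩ | ⟨h, h'⟩ | ⟨h, h'⟩ | ⟨h, h'⟩ | ⟨h, h'⟩ | ⟨h, h'⟩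
  · left; exact ⟨z _ h, z _ h'⟩
  · right; left; exact ⟨z _ h, z _ h'⟩
  · right; right; left; exact ⟨e _ _ h, e _ _ (by rw [h']; ring)⟩
  · right; right; right; left; exact ⟨z _ h, z _ h'⟩
  · right; right; right; right; left; exact ⟨e _ _ h, z _ h'⟩
  · right; right; right; right; right; exact ⟨z _ h, e _ _ h'⟩

theorem zmod_local (N : ℕ) (x : ZMod (2 ^ N)) (h : x ^ 2 + x = 0) : x = 0 ∨ x = -1 := by
  obtain ⟨x, rfl⟩ := ZMod.intCast_surjective x
  have h1 : ((x ^ 2 + x : ℤ) : ZMod (2 ^ N)) = 0 := by push_cast; exact h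
  rw [ZMod.intCast_zmod_eq_zero_iff_dvd] at h1
  push_cast at h1
  rw [show x ^ 2 + x = x * (x + 1) by ring] at h1
  by_cases h2 : (2 : ℤ) ∣ x
  · left
    rw [ZMod.intCast_zmod_eq_zero_iff_dvd]; push_cast
    exact Int.prime_two.pow_dvd_of_dvd_mul_right N (by omega) h1
  · right
    have := Int.prime_two.pow_dvd_of_dvd_mul_left N h2 h1
    have h3 : ((x + 1 : ℤ) : ZMod (2 ^ N)) = 0 := by rw [ZMod.intCast_zmod_eq_zero_iff_dvd]; push_cast; exact this
    push_cast at h3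
    linear_combination h3

theorem zmod_unit (N : ℕ) (x : ℤ) (h : ¬ 2 ∣ x) : IsUnit (x : ZMod (2 ^ N)) := by
  have h1 : IsCoprime x ((2 : ℤ) ^ N) := (Int.prime_two.coprime_iff_not_dvd.2 h).symm.pow_right
  obtain ⟨a, b, hab⟩ := h1
  have := congrArg (fun n : ℤ => (n : ZMod (2 ^ N))) hab
  push_cast at this
  have h2 : (2 : ZMod (2 ^ N)) ^ N = 0 := by exact_mod_cast ZMod.natCast_self (2 ^ N)
  rw [h2, mul_zero, add_zero] at this
  exact IsUnit.of_mul_eq_one _ (by rw [mul_comm]; exact this)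

def Cl (n : ℕ) (q0 q1 q2 : ℤ) : Prop := Kn (q0 : ZMod (2 ^ n)) (q1 : ZMod (2 ^ n)) (q2 : ZMod (2 ^ n))

theorem Cl_split {n : ℕ} (hn : 1 ≤ n) {a0 a1 a2 : ℤ} (hp : Prim a0 a1 a2) (h : Cl n a0 a1 a2) :
    ∃ l k0 k1 k2 d0 d1 d2 : ℤ, ¬ 2 ∣ l ∧ ((k0 = 1 ∧ k1 = 0 ∧ k2 = 0) ∨ (k0 = 0 ∧ k1 = 0 ∧ k2 = 1) ∨ (k0 = 1 ∧ k1 = 2 ∧ k2 = 1) ∨ 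
      (k0 = 0 ∧ k1 = 1 ∧ k2 = 0) ∨ (k0 = 1 ∧ k1 = 1 ∧ k2 = 0) ∨ (k0 = 0 ∧ k1 = 1 ∧ k2 = 1)) ∧
      a0 = l * k0 + 2 ^ n * d0 ∧ a1 = l * k1 + 2 ^ n * d1 ∧ a2 = l * k2 + 2 ^ n * d2 := by
  have hp2 := hp 2 Nat.prime_two
  push_cast at hp2
  have h2 : (2 : ℤ) ∣ 2 ^ n := dvd_pow_self 2 (by omega)
  have hz : ∀ a : ℤ, (a : ZMod (2 ^ n)) = 0 → ∃ d, a = 2 ^ n * d := by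
    intro a h
    rw [ZMod.intCast_zmod_eq_zero_iff_dvd] at h
    push_cast at h
    exact h
  have he : ∀ a b : ℤ, (a : ZMod (2 ^ n)) = b → ∃ d, a = b + 2 ^ n * d := by
    intro a b h
    obtain ⟨d, hd⟩ := hz (a - b) (by push_cast; rw [h]; ring)
    exact ⟨d, by linarith⟩
  have hm : ∀ l k d : ℤ, 2 ∣ l → 2 ∣ l * k + 2 ^ n * d := fun l k d hl => dvd_add (hl.mul_right _) (h2.mul_right _)
  have fin : ∀ l k0 k1 k2 d0 d1 d2 : ℤ, a0 = l * k0 + 2 ^ n * d0 → a1 = l * k1 + 2 ^ n * d1 → a2 = l * k2 + 2 ^ n * d2 → ¬ 2 ∣ l := by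
    intro l k0 k1 k2 d0 d1 d2 e0 e1 e2 hl
    apply hp2
    rw [e0, e1, e2]
    exact ⟨hm _ _ _ hl, hm _ _ _ hl, hm _ _ _ hl⟩
  suffices H : ∃ l k0 k1 k2 d0 d1 d2 : ℤ, ((k0 = 1 ∧ k1 = 0 ∧ k2 = 0) ∨ (k0 = 0 ∧ k1 = 0 ∧ k2 = 1) ∨ (k0 = 1 ∧ k1 = 2 ∧ k2 = 1) ∨ 
      (k0 = 0 ∧ k1 = 1 ∧ k2 = 0) ∨ (k0 = 1 ∧ k1 = 1 ∧ k2 = 0) ∨ (k0 = 0 ∧ k1 = 1 ∧ k2 = 1)) ∧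
      a0 = l * k0 + 2 ^ n * d0 ∧ a1 = l * k1 + 2 ^ n * d1 ∧ a2 = l * k2 + 2 ^ n * d2 by
    obtain ⟨l, k0, k1, k2, d0, d1, d2, hk, e0, e1, e2⟩ := H
    exact ⟨l, k0, k1, k2, d0, d1, d2, fin _ _ _ _ _ _ _ e0 e1 e2, hk, e0, e1, e2⟩
  rcases h with ⟨h, h'⟩ | ⟨h, h'⟩ | ⟨h, h'⟩ | ⟨h, h'⟩ | ⟨h, h'⟩ | ⟨h, h'⟩
  · obtain ⟨d, hd⟩ := hz _ h; obtain ⟨d', hd'⟩ := hz _ h'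
    exact ⟨a0, 1, 0, 0, 0, d, d', by simp, by ring, by rw [hd]; ring, by rw [hd']; ring⟩
  · obtain ⟨d, hd⟩ := hz _ h; obtain ⟨d', hd'⟩ := hz _ h'
    exact ⟨a2, 0, 0, 1, d, d', 0, by simp, by rw [hd]; ring, by rw [hd']; ring, by ring⟩
  · obtain ⟨d, hd⟩ := he _ _ h.symm; obtain ⟨d', hd'⟩ := he a1 (2 * a0) (by push_cast; exact h')
    exact ⟨a0, 1, 2, 1, 0, d', d, by simp, by ring, by rw [hd']; ring, by rw [hd]; ring⟩
  · obtain ⟨d, hd⟩ := hz _ h; obtain ⟨d', hd'⟩ := hz _ h'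
    exact ⟨a1, 0, 1, 0, d, 0, d', by simp, by rw [hd]; ring, by ring, by rw [hd']; ring⟩
  · obtain ⟨d, hd⟩ := he _ _ h.symm; obtain ⟨d', hd'⟩ := hz _ h'
    exact ⟨a0, 1, 1, 0, 0, d, d', by simp, by ring, by rw [hd]; ring, by rw [hd']; ring⟩
  · obtain ⟨d, hd⟩ := hz _ h; obtain ⟨d', hd'⟩ := he _ _ h'.symm
    exact ⟨a1, 0, 1, 1, d, 0, d', by simp, by rw [hd]; ring, by ring, by rw [hd']; ring⟩

theorem step1 (S : Setup L θ ι) {n : ℕ} (hn : 1 ≤ n) (ih : ∀ q0 q1 q2 : ℤ, Val q0 q1 q2 → Cl n q0 q1 q2)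
    {q0 q1 q2 : ℤ} (hv : Val q0 q1 q2) (hq2 : q2 ≠ 0) : Cl (n + 1) q0 q1 q2 := by
  obtain ⟨a0, a1, a2, e0, e1, e2, e3, V, k, hp, hV, hk, hR⟩ := half S hv hq2
  have hc := ih a0 a1 a2 ⟨hp, _, _, _, _, _, _, _, _, _, _, hV, hR⟩
  obtain ⟨l, k0, k1, k2, d0, d1, d2, hl, hkk, h0, h1, h2⟩ := Cl_split hn hp hc
  have hP := hR.map (Int.castRingHom (ZMod (2 ^ (n + 1))))
  simp only [map_mul, map_add, eq_intCast] at hP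
  have hVu := zmod_unit (n + 1) V hV
  have hku := zmod_unit (n + 1) k hk
  have hlu := zmod_unit (n + 1) l hl
  obtain ⟨V', hV'⟩ := hVu.exists_right_inv
  have h20 : (2 : ZMod (2 ^ (n + 1))) ^ (n + 1) = 0 := by exact_mod_cast ZMod.natCast_self (2 ^ (n + 1))
  have hsc := PR.scale (k := (k : ZMod (2 ^ (n + 1)))) (q0 := (q0 : ZMod (2 ^ (n + 1)))) (q1 := (q1 : ZMod (2 ^ (n + 1)))) (q2 := (q2 : ZMod (2 ^ (n + 1)))) hP (2 ^ n) l k0 k1 k2 d0 d1 d2 V'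
    (by rw [← pow_succ', h20]) 
    (by rw [← pow_mul, show n * 2 = (n + 1) + (n - 1) by omega, pow_add (2 : ZMod (2 ^ (n + 1))) (n + 1) (n - 1), h20, zero_mul])
    (by rw [h0]; push_cast; ring) (by rw [h1]; push_cast; ring) (by rw [h2]; push_cast; ring) hV'
  have hf := fin_all (zmod_local (n + 1)) (by
    rcases hkk with ⟨rfl, rfl, rfl⟩ | ⟨rfl, rfl, rfl⟩ | ⟨rfl, rfl, rfl⟩ | ⟨rfl, rfl, rfl⟩ | ⟨rfl, rfl, rfl⟩ | ⟨rfl, rfl, rfl⟩ <;> simp) hsc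
  apply Kn.unscale _ hf
  refine (hku.mul (hlu.pow 2)).mul (IsUnit.pow 2 ?_)
  exact IsUnit.of_mul_eq_one _ (by rw [mul_comm]; exact hV')

theorem Val.sig {q0 q1 q2 : ℤ} (hv : Val q0 q1 q2) : Val (q0 - q1 + q2) (2 * q0 - q1) q0 := by
  obtain ⟨hp, c0, c1, c2, c3, d, r0, r1, r2, r3, r4, hd, hR⟩ := hv
  refine ⟨?_, _, _, _, _, _, _, _, _, _, _, hd, hR.sig⟩
  rintro ℓ hl ⟨h0, h1, h2⟩
  have h1' : (ℓ : ℤ) ∣ q1 := by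
    have := dvd_sub (h2.mul_left 2) h1
    simpa using this
  refine hp ℓ hl ⟨h2, h1', ?_⟩
  have := dvd_add (dvd_sub h0 h2) h1'
  rwa [show q0 - q1 + q2 - q0 + q1 = q2 by ring] at this

theorem main_cl (S : Setup L θ ι) (n : ℕ) : ∀ q0 q1 q2 : ℤ, Val q0 q1 q2 → Cl (n + 1) q0 q1 q2 := by
  induction n with
  | zero =>
    intro q0 q1 q2 hv
    have h1 := hv.not_odd
    have h2 := hv.1 2 Nat.prime_two
    push_cast at h2
    have key : ∀ a b c : ZMod (2 ^ (0 + 1)), ¬ (a = 0 ∧ b = 0 ∧ c = 0) → ¬ (¬ a = 0 ∧ ¬ b = 0 ∧ ¬ c = 0) → Kn a b c := by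
      unfold Kn
      decide
    apply key
    · rintro ⟨x, y, z⟩
      exact h2 ⟨even_zmod.1 x, even_zmod.1 y, even_zmod.1 z⟩
    · rintro ⟨x, y, z⟩
      exact h1 ⟨fun h => x (even_zmod.2 h), fun h => y (even_zmod.2 h), fun h => z (even_zmod.2 h)⟩
  | succ n ih =>
    intro q0 q1 q2 hv
    by_cases h2 : q2 = 0
    · by_cases h0 : q0 = 0
      · subst h2 h0
        right; right; right; left; simp
      · have := step1 S (by omega) ih hv.sig h0
        unfold Cl at this ⊢
        push_cast at this
        exact this.unsig
    · exact step1 S (by omega) ih hv h2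

theorem main_claim {q0 q1 q2 : ℤ} (hv : Val q0 q1 q2) : Kn q0 q1 q2 := by
  obtain ⟨L, _, _, θ, ι, S⟩ := exists_setup
  obtain ⟨n, hn⟩ : ∃ n : ℕ, n = (2 * |q0| + |q1| + |q2|).toNat := ⟨_, rfl⟩
  have hlt : 2 * |q0| + |q1| + |q2| < 2 ^ (n + 1) := by
    have h1 : (n : ℤ) < 2 ^ n := by exact_mod_cast n.lt_two_pow_self
    have h2 : (2 : ℤ) ^ n ≤ 2 ^ (n + 1) := pow_le_pow_right₀ (by norm_num) (by omega)
    omega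
  have h := main_cl S n q0 q1 q2 hv
  have hz : ∀ a : ℤ, (a : ZMod (2 ^ (n + 1))) = 0 → |a| ≤ 2 * |q0| + |q1| + |q2| → a = 0 := by
    intro a h hb
    rw [ZMod.intCast_zmod_eq_zero_iff_dvd] at h
    push_cast at h
    exact Int.eq_zero_of_abs_lt_dvd h (by omega)
  have he : ∀ a b : ℤ, (a : ZMod (2 ^ (n + 1))) = b → |a - b| ≤ 2 * |q0| + |q1| + |q2| → a = b := by
    intro a b h hb
    have := hz (a - b) (by push_cast; rw [h]; ring) hb
    omega
  have n0 := abs_nonneg q0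
  have n1 := abs_nonneg q1
  have n2 := abs_nonneg q2
  rcases h with ⟨h, h'⟩ | ⟨h, h'⟩ | ⟨h, h'⟩ | ⟨h, h'⟩ | ⟨h, h'⟩ | ⟨h, h'⟩
  · left; exact ⟨hz _ h (by omega), hz _ h' (by omega)⟩
  · right; left; exact ⟨hz _ h (by omega), hz _ h' (by omega)⟩
  · right; right; left; exact ⟨he _ _ h (by have := abs_sub q0 q2; omega), he q1 (2 * q0) (by push_cast; exact h') (by
      have := abs_sub q1 (2 * q0); rw [abs_mul, abs_two] at this; omega)⟩
  · right; right; right; left; exact ⟨hz _ h (by omega), hz _ h' (by omega)⟩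
  · right; right; right; right; left; exact ⟨he _ _ h (by have := abs_sub q0 q1; omega), hz _ h' (by omega)⟩
  · right; right; right; right; right; exact ⟨hz _ h (by omega), he _ _ h' (by have := abs_sub q1 q2; omega)⟩
end S8b

section S9

set_option synthInstance.maxHeartbeats 400000 in
set_option synthInstance.maxSize 1000 in
theorem dec_r : ∀ q0 q1 q2 r0 r1 r2 r3 r4 : ZMod 2, ¬ (q0 = 0 ∧ q1 = 0 ∧ q2 = 0) →
    q0 * r0 = 0 → q0 * r1 + q1 * r0 = 0 → q0 * r2 + q1 * r1 + q2 * r0 = 0 → q0 * r3 + q1 * r2 + q2 * r1 = 0 →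
    q0 * r4 + q1 * r3 + q2 * r2 = 0 → q1 * r4 + q2 * r3 = 0 → q2 * r4 = 0 →
    r0 = 0 ∧ r1 = 0 ∧ r2 = 0 ∧ r3 = 0 ∧ r4 = 0 := by
  decide +kernel

set_option synthInstance.maxHeartbeats 400000 in
set_option synthInstance.maxSize 1000 in
theorem dec_m : ∀ q0 q2 c0 c1 c2 c3 r0 r1 r2 r3 r4 : ZMod 2, 
    c0 ^ 2 = q0 * r0 → 0 = q0 * r1 + 1 * r0 → c1 ^ 2 = q0 * r2 + 1 * r1 + q2 * r0 → 0 = q0 * r3 + 1 * r2 + q2 * r1 →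
    c2 ^ 2 = q0 * r4 + 1 * r3 + q2 * r2 → 0 = 1 * r4 + q2 * r3 → c3 ^ 2 = q2 * r4 →
    ∃ m0 m1 : ZMod 2, c0 = q0 * m0 ∧ c1 = 1 * m0 + q0 * m1 ∧ c2 = q2 * m0 + 1 * m1 ∧ c3 = q2 * m1 := by
  decide +kernel

theorem conv_even {q0 q1 q2 r0 r1 r2 r3 r4 : ℤ} (hp : Prim q0 q1 q2) (h0 : 2 ∣ q0 * r0) (h1 : 2 ∣ q0 * r1 + q1 * r0)
    (h2 : 2 ∣ q0 * r2 + q1 * r1 + q2 * r0) (h3 : 2 ∣ q0 * r3 + q1 * r2 + q2 * r1)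
    (h4 : 2 ∣ q0 * r4 + q1 * r3 + q2 * r2) (h5 : 2 ∣ q1 * r4 + q2 * r3) (h6 : 2 ∣ q2 * r4) :
    2 ∣ r0 ∧ 2 ∣ r1 ∧ 2 ∣ r2 ∧ 2 ∣ r3 ∧ 2 ∣ r4 := by
  have hp2 := hp 2 Nat.prime_two
  push_cast at hp2
  simp only [← even_zmod] at *
  push_cast at *
  exact dec_r _ _ _ _ _ _ _ _ hp2 h0 h1 h2 h3 h4 h5 h6

theorem lemmaM (n : ℕ) : ∀ q0 q1 q2 c0 c1 c2 c3 d r0 r1 r2 r3 r4 : ℤ, Prim q0 q1 q2 → ¬ 2 ∣ q1 → d ≠ 0 → d.natAbs ≤ n →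
    Rel q0 q1 q2 c0 c1 c2 c3 d r0 r1 r2 r3 r4 → Val q0 q1 q2 := by
  induction n with
  | zero => intro q0 q1 q2 c0 c1 c2 c3 d r0 r1 r2 r3 r4 hp h1 hd hn; omega
  | succ n ih =>
    intro q0 q1 q2 c0 c1 c2 c3 d r0 r1 r2 r3 r4 hp h1 hd hn hR
    by_cases hdo : 2 ∣ d
    · have h2 := hR.map (Int.castRingHom (ZMod 2))
      have h20 : (2 : ZMod 2) = 0 := rfl
      simp only [eq_intCast, even_zmod.2 hdo, odd_zmod h1] at h2
      obtain ⟨f0, f1, f2, f3, f4, f5, f6⟩ := h2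
      simp only [h20, zero_mul, add_zero, zero_add, sub_zero, ne_eq, OfNat.ofNat_ne_zero, not_false_eq_true, zero_pow] at f0 f1 f2 f3 f4 f5 f6
      obtain ⟨m0, m1, e0, e1, e2, e3⟩ := dec_m _ _ _ _ _ _ _ _ _ _ _ f0 f1 f2 f3 f4 f5 f6
      obtain ⟨m0, rfl⟩ := ZMod.intCast_surjective m0
      obtain ⟨m1, rfl⟩ := ZMod.intCast_surjective m1
      obtain ⟨d', rfl⟩ := hdo
      obtain ⟨x0, hx0⟩ : 2 ∣ c0 - q0 * m0 := by rw [← even_zmod]; push_cast; rw [e0]; ring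
      obtain ⟨x1, hx1⟩ : 2 ∣ c1 - (q1 * m0 + q0 * m1) := by rw [← even_zmod]; push_cast; rw [e1, odd_zmod h1]; ring
      obtain ⟨x2, hx2⟩ : 2 ∣ c2 - (q2 * m0 + q1 * m1) := by rw [← even_zmod]; push_cast; rw [e2, odd_zmod h1]; ring
      obtain ⟨x3, hx3⟩ : 2 ∣ c3 - q2 * m1 := by rw [← even_zmod]; push_cast; rw [e3]; ring
      have hc0 : c0 = q0 * m0 + 2 * x0 := by linarith
      have hc1 : c1 = q1 * m0 + q0 * m1 + 2 * x1 := by linarith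
      have hc2 : c2 = q2 * m0 + q1 * m1 + 2 * x2 := by linarith
      have hc3 : c3 = q2 * m1 + 2 * x3 := by linarith
      clear hx0 hx1 hx2 hx3 e0 e1 e2 e3 f0 f1 f2 f3 f4 f5 f6
      obtain ⟨g0, g1, g2, g3, g4, g5, g6⟩ := hR
      subst hc0 hc1 hc2 hc3
      obtain ⟨s0, hs0⟩ : ∃ s, s = r0 - q0 * m0 ^ 2 - 4 * m0 * x0 - 2 * d' * m0 := ⟨_, rfl⟩
      obtain ⟨s1, hs1⟩ : ∃ s, s = r1 - (2 * q0 * m0 * m1 + q1 * m0 ^ 2) - 4 * (m0 * x1 + m1 * x0) - 2 * d' * m1 := ⟨_, rfl⟩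
      obtain ⟨s2, hs2⟩ : ∃ s, s = r2 - (q0 * m1 ^ 2 + 2 * q1 * m0 * m1 + q2 * m0 ^ 2) - 4 * (m0 * x2 + m1 * x1) - 2 * d' * m0 := ⟨_, rfl⟩
      obtain ⟨s3, hs3⟩ : ∃ s, s = r3 - (q1 * m1 ^ 2 + 2 * q2 * m0 * m1) - 4 * (m0 * x3 + m1 * x2) - 2 * d' * (m0 + m1) := ⟨_, rfl⟩
      obtain ⟨s4, hs4⟩ : ∃ s, s = r4 - q2 * m1 ^ 2 - 4 * m1 * x3 - 2 * d' * m1 := ⟨_, rfl⟩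
      have k0 : q0 * s0 = 2 * (2 * (x0 ^ 2 + d' * x0)) := by rw [hs0]; linear_combination -g0
      have k1 : q0 * s1 + q1 * s0 = 2 * (2 * (2 * x0 * x1 + d' * x1 - d' ^ 2)) := by rw [hs0, hs1]; linear_combination -g1
      have k2 : q0 * s2 + q1 * s1 + q2 * s0 = 2 * (2 * (2 * x0 * x2 + x1 ^ 2 + d' * (x2 + x0) - d' ^ 2)) := by rw [hs0, hs1, hs2]; linear_combination -g2
      have k3 : q0 * s3 + q1 * s2 + q2 * s1 = 2 * (2 * (2 * x0 * x3 + 2 * x1 * x2 + d' * (x3 + x1 + x0))) := by rw [hs3, hs1, hs2]; linear_combination -g3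
      have k4 : q0 * s4 + q1 * s3 + q2 * s2 = 2 * (2 * (2 * x1 * x3 + x2 ^ 2 + d' * (x2 + x1))) := by rw [hs3, hs4, hs2]; linear_combination -g4
      have k5 : q1 * s4 + q2 * s3 = 2 * (2 * (2 * x2 * x3 + d' * (x3 + x2))) := by rw [hs3, hs4]; linear_combination -g5
      have k6 : q2 * s4 = 2 * (2 * (x3 ^ 2 + d' * x3)) := by rw [hs4]; linear_combination -g6
      clear hs0 hs1 hs2 hs3 hs4 g0 g1 g2 g3 g4 g5 g6
      obtain ⟨⟨s0, rfl⟩, ⟨s1, rfl⟩, ⟨s2, rfl⟩, ⟨s3, rfl⟩, ⟨s4, rfl⟩⟩ := conv_even hp ⟨_, k0⟩ ⟨_, k1⟩ ⟨_, k2⟩ ⟨_, k3⟩ ⟨_, k4⟩ ⟨_, k5⟩ ⟨_, k6⟩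
      replace k0 : q0 * s0 = (2 * (x0 ^ 2 + d' * x0)) := by linarith
      replace k1 : q0 * s1 + q1 * s0 = (2 * (2 * x0 * x1 + d' * x1 - d' ^ 2)) := by linarith
      replace k2 : q0 * s2 + q1 * s1 + q2 * s0 = (2 * (2 * x0 * x2 + x1 ^ 2 + d' * (x2 + x0) - d' ^ 2)) := by linarith
      replace k3 : q0 * s3 + q1 * s2 + q2 * s1 = (2 * (2 * x0 * x3 + 2 * x1 * x2 + d' * (x3 + x1 + x0))) := by linarith
      replace k4 : q0 * s4 + q1 * s3 + q2 * s2 = (2 * (2 * x1 * x3 + x2 ^ 2 + d' * (x2 + x1))) := by linarith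
      replace k5 : q1 * s4 + q2 * s3 = (2 * (2 * x2 * x3 + d' * (x3 + x2))) := by linarith
      replace k6 : q2 * s4 = (2 * (x3 ^ 2 + d' * x3)) := by linarith
      obtain ⟨⟨s0, rfl⟩, ⟨s1, rfl⟩, ⟨s2, rfl⟩, ⟨s3, rfl⟩, ⟨s4, rfl⟩⟩ := conv_even hp ⟨_, k0⟩ ⟨_, k1⟩ ⟨_, k2⟩ ⟨_, k3⟩ ⟨_, k4⟩ ⟨_, k5⟩ ⟨_, k6⟩
      refine ih q0 q1 q2 x0 x1 x2 x3 d' s0 s1 s2 s3 s4 hp h1 (by omega) (by omega) ⟨?_, ?_, ?_, ?_, ?_, ?_, ?_⟩ <;> linarith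
    · exact ⟨hp, c0, c1, c2, c3, d, r0, r1, r2, r3, r4, hdo, hR⟩

structure Fin5 {R : Type*} [CommRing R] (u1 u2 V κ q0 q1 q2 p0 p1 p2 : R) : Prop where
  f0 : V * u1 - V ^ 2 = κ * (q0 * p0)
  f1 : u1 ^ 2 + V * u2 - V ^ 2 = κ * (q0 * p1 + q1 * p0)
  f2 : 2 * u1 * u2 + V * u1 = κ * (q0 * p2 + q1 * p1 + q2 * p0)
  f3 : u2 ^ 2 + V * u1 + V * u2 = κ * (q1 * p2 + q2 * p1)
  f4 : V * u2 = κ * (q2 * p2)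

theorem Fin5.rel {R : Type*} [CommRing R] {u1 u2 V κ q0 q1 q2 p0 p1 p2 : R} (h : Fin5 u1 u2 V κ q0 q1 q2 p0 p1 p2) :
    Rel q0 q1 q2 0 u1 u2 0 V 0 (κ * p0) (κ * p1) (κ * p2) 0 := by
  obtain ⟨f0, f1, f2, f3, f4⟩ := h
  constructor
  · ring
  · linear_combination f0
  · linear_combination f1
  · linear_combination f2
  · linear_combination f3
  · linear_combination f4
  · ring

theorem Fin5.symm {R : Type*} [CommRing R] {u1 u2 V κ q0 q1 q2 p0 p1 p2 : R} (h : Fin5 u1 u2 V κ q0 q1 q2 p0 p1 p2) :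
    Fin5 u1 u2 V κ p0 p1 p2 q0 q1 q2 := by
  obtain ⟨f0, f1, f2, f3, f4⟩ := h
  constructor
  · linear_combination f0
  · linear_combination f1
  · linear_combination f2
  · linear_combination f3
  · linear_combination f4

theorem kappa_even {q0 q1 q2 p0 p1 p2 κ : ℤ} (hq : Prim q0 q1 q2) (hp : Prim p0 p1 p2) (h0 : 2 ∣ κ * (q0 * p0)) 
    (h1 : 2 ∣ κ * (q0 * p1 + q1 * p0)) (h2 : 2 ∣ κ * (q0 * p2 + q1 * p1 + q2 * p0)) (h3 : 2 ∣ κ * (q1 * p2 + q2 * p1))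
    (h4 : 2 ∣ κ * (q2 * p2)) : 2 ∣ κ := by
  by_contra hk
  have c := fun {a : ℤ} (h : 2 ∣ κ * a) => (Int.prime_two.dvd_or_dvd h).resolve_left hk
  have := conv_even hq (r0 := p0) (r1 := p1) (r2 := p2) (r3 := 0) (r4 := 0) (c h0) (c h1) (c h2) (by simpa [add_comm] using c h3) (by simpa using c h4) (by simp) (by simp)
  have hp2 := hp 2 Nat.prime_two
  push_cast at hp2
  exact hp2 ⟨this.1, this.2.1, this.2.2.1⟩

theorem Fin5_descend {q0 q1 q2 p0 p1 p2 : ℤ} (hq : Prim q0 q1 q2) (hp : Prim p0 p1 p2) (n : ℕ) : ∀ u1 u2 V κ : ℤ, V ≠ 0 → V.natAbs ≤ n →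
    Fin5 u1 u2 V κ q0 q1 q2 p0 p1 p2 → ∃ u1 u2 V κ : ℤ, V ≠ 0 ∧ Fin5 u1 u2 V κ q0 q1 q2 p0 p1 p2 ∧ ¬ (2 ∣ u1 ∧ 2 ∣ u2 ∧ 2 ∣ V) := by
  induction n with
  | zero => intro u1 u2 V κ hV hn; omega
  | succ n ih =>
    intro u1 u2 V κ hV hn h
    by_cases hall : (2 ∣ u1 ∧ 2 ∣ u2 ∧ 2 ∣ V)
    · obtain ⟨⟨u1, rfl⟩, ⟨u2, rfl⟩, ⟨V, rfl⟩⟩ := hall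
      obtain ⟨f0, f1, f2, f3, f4⟩ := h
      obtain ⟨κ, rfl⟩ := kappa_even (κ := κ) hq hp ⟨2 * (V * u1 - V ^ 2), by rw [← f0]; ring⟩ ⟨2 * (u1 ^ 2 + V * u2 - V ^ 2), by rw [← f1]; ring⟩
        ⟨2 * (2 * u1 * u2 + V * u1), by rw [← f2]; ring⟩ ⟨2 * (u2 ^ 2 + V * u1 + V * u2), by rw [← f3]; ring⟩ ⟨2 * (V * u2), by rw [← f4]; ring⟩
      obtain ⟨κ, rfl⟩ := kappa_even (κ := κ) hq hp ⟨(V * u1 - V ^ 2), by linarith⟩ ⟨(u1 ^ 2 + V * u2 - V ^ 2), by linarith⟩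
        ⟨(2 * u1 * u2 + V * u1), by linarith⟩ ⟨(u2 ^ 2 + V * u1 + V * u2), by linarith⟩ ⟨(V * u2), by linarith⟩
      refine ih u1 u2 V κ (by omega) (by omega) ⟨?_, ?_, ?_, ?_, ?_⟩ <;> linarith
    · exact ⟨u1, u2, V, κ, hV, h, hall⟩

theorem int_final {u1 u2 V κ q0 q1 q2 p0 p1 p2 : ℤ} (hq : Prim q0 q1 q2) (hp : Prim p0 p1 p2) (hV : V ≠ 0)
    (h : Fin5 u1 u2 V κ q0 q1 q2 p0 p1 p2) : Kn q0 q1 q2 ∨ Kn p0 p1 p2 := by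
  obtain ⟨u1, u2, V, κ, hV, h, hne⟩ := Fin5_descend hq hp _ u1 u2 V κ hV le_rfl h
  by_cases hVo : 2 ∣ V
  · by_cases hq1 : 2 ∣ q1
    · by_cases hp1 : 2 ∣ p1
      · exfalso
        apply hne
        refine ⟨?_, ?_, hVo⟩
        · apply Int.prime_two.dvd_of_dvd_pow (n := 2)
          have h1 : u1 ^ 2 = κ * (q0 * p1 + q1 * p0) - V * (u2 - V) := by linarith [h.f1]
          rw [h1]
          exact dvd_sub ((dvd_add (hp1.mul_left _) (hq1.mul_right _)).mul_left _) (hVo.mul_right _)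
        · apply Int.prime_two.dvd_of_dvd_pow (n := 2)
          have h1 : u2 ^ 2 = κ * (q1 * p2 + q2 * p1) - V * (u1 + u2) := by linarith [h.f3]
          rw [h1]
          exact dvd_sub ((dvd_add (hq1.mul_right _) (hp1.mul_left _)).mul_left _) (hVo.mul_right _)
      · right
        exact main_claim (lemmaM _ _ _ _ _ _ _ _ _ _ _ _ _ _ hp hp1 hV le_rfl h.symm.rel)
    · left
      exact main_claim (lemmaM _ _ _ _ _ _ _ _ _ _ _ _ _ _ hq hq1 hV le_rfl h.rel)
  · left
    exact main_claim ⟨hq, _, _, _, _, _, _, _, _, _, _, hVo, h.rel⟩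

theorem prim_of_rat (q0 q1 q2 : ℚ) (h : ¬ (q0 = 0 ∧ q1 = 0 ∧ q2 = 0)) : ∃ (α : ℚ) (p0 p1 p2 : ℤ), α ≠ 0 ∧ Prim p0 p1 p2 ∧
    q0 = α * p0 ∧ q1 = α * p1 ∧ q2 = α * p2 := by
  obtain ⟨N, hN⟩ := IsLocalization.exist_integer_multiples_of_finset (nonZeroDivisors ℤ) ({q0, q1, q2} : Finset ℚ)
  have hN0 : (N : ℤ) ≠ 0 := nonZeroDivisors.ne_zero N.2
  generalize (N : ℤ) = N at hN hN0
  have hq : ∀ x ∈ ({q0, q1, q2} : Finset ℚ), ∃ y : ℤ, (y : ℚ) = N * x := by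
    intro x hx
    obtain ⟨y, hy⟩ := hN x hx
    exact ⟨y, by simpa using hy⟩
  obtain ⟨a0, h0⟩ := hq q0 (by simp)
  obtain ⟨a1, h1⟩ := hq q1 (by simp)
  obtain ⟨a2, h2⟩ := hq q2 (by simp)
  have hN' : (N : ℚ) ≠ 0 := by exact_mod_cast hN0
  obtain ⟨g, b0, b1, b2, e0, e1, e2, hg⟩ : ∃ g b0 b1 b2 : ℤ, a0 = g * b0 ∧ a1 = g * b1 ∧ a2 = g * b2 ∧ Prim b0 b1 b2 := by
    obtain ⟨b, hb, hgcd⟩ := Finset.extract_gcd (s := Finset.univ) ![a0, a1, a2] (Finset.univ_nonempty)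
    refine ⟨_, b 0, b 1, b 2, hb 0 (by simp), hb 1 (by simp), hb 2 (by simp), ?_⟩
    rintro ℓ hl ⟨h0, h1, h2⟩
    have : (ℓ : ℤ) ∣ Finset.univ.gcd b := Finset.dvd_gcd (by
      intro i _
      fin_cases i
      · exact h0
      · exact h1
      · exact h2)
    rw [hgcd] at this
    exact hl.one_lt.ne' (by exact_mod_cast Int.eq_one_of_dvd_one (by positivity) this)
  have f0 : q0 = (g / N) * b0 := by rw [e0] at h0; push_cast at h0; field_simp; linarith
  have f1 : q1 = (g / N) * b1 := by rw [e1] at h1; push_cast at h1; field_simp; linarith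
  have f2 : q2 = (g / N) * b2 := by rw [e2] at h2; push_cast at h2; field_simp; linarith
  refine ⟨g / N, b0, b1, b2, ?_, hg, f0, f1, f2⟩
  intro hz
  rw [hz, zero_mul] at f0 f1 f2
  exact h ⟨f0, f1, f2⟩

theorem rat_final {c1 c2 q0 q1 q2 p0 p1 p2 : ℚ} (hq : ¬ (q0 = 0 ∧ q1 = 0 ∧ q2 = 0)) (hp : ¬ (p0 = 0 ∧ p1 = 0 ∧ p2 = 0))
    (h : Fin5 c1 c2 1 1 q0 q1 q2 p0 p1 p2) : Kn q0 q1 q2 ∨ Kn p0 p1 p2 := by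
  obtain ⟨α, a0, a1, a2, hα, hA, e0, e1, e2⟩ := prim_of_rat q0 q1 q2 hq
  obtain ⟨β, b0, b1, b2, hβ, hB, f0, f1, f2⟩ := prim_of_rat p0 p1 p2 hp
  obtain ⟨N, hN⟩ := IsLocalization.exist_integer_multiples_of_finset (nonZeroDivisors ℤ) ({c1, c2, α * β} : Finset ℚ)
  have hN0 : (N : ℤ) ≠ 0 := nonZeroDivisors.ne_zero N.2
  generalize (N : ℤ) = N at hN hN0
  have hz : ∀ x ∈ ({c1, c2, α * β} : Finset ℚ), ∃ y : ℤ, (y : ℚ) = N * x := by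
    intro x hx
    obtain ⟨y, hy⟩ := hN x hx
    exact ⟨y, by simpa using hy⟩
  obtain ⟨u1, h1⟩ := hz c1 (by simp)
  obtain ⟨u2, h2⟩ := hz c2 (by simp)
  obtain ⟨κ, h3⟩ := hz (α * β) (by simp)
  obtain ⟨g0, g1, g2, g3, g4⟩ := h
  subst e0 e1 e2 f0 f1 f2
  have key : Kn a0 a1 a2 ∨ Kn b0 b1 b2 := by
    refine int_final (u1 := u1) (u2 := u2) (V := N) (κ := N * κ) hA hB hN0 ⟨?_, ?_, ?_, ?_, ?_⟩ <;>
      (apply Int.cast_injective (α := ℚ); push_cast; simp only [h1, h2, h3])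
    · linear_combination (N : ℚ) ^ 2 * g0
    · linear_combination (N : ℚ) ^ 2 * g1
    · linear_combination (N : ℚ) ^ 2 * g2
    · linear_combination (N : ℚ) ^ 2 * g3
    · linear_combination (N : ℚ) ^ 2 * g4
  have sc : ∀ (α : ℚ) (a0 a1 a2 : ℤ), Kn a0 a1 a2 → Kn (α * a0) (α * a1) (α * a2) := by
    intro α a0 a1 a2 h
    rcases h with ⟨h, h'⟩ | ⟨h, h'⟩ | ⟨h, h'⟩ | ⟨h, h'⟩ | ⟨h, h'⟩ | ⟨h, h'⟩
    · left; simp [h, h']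
    · right; left; simp [h, h']
    · right; right; left; rw [h', h]; exact ⟨rfl, by push_cast; ring⟩
    · right; right; right; left; simp [h, h']
    · right; right; right; right; left; simp [h, h']
    · right; right; right; right; right; simp [h, h']
  exact key.imp (sc _ _ _ _) (sc _ _ _ _)

theorem cases_final {c1 c2 u v n0 n1 n2 : ℚ} (h : Fin5 c1 c2 1 1 v u 1 n0 n1 n2) (hv : v ≠ 0) (hu : ¬ (v = 1 ∧ u = 2)) : False := by
  have hp : ¬ (n0 = 0 ∧ n1 = 0 ∧ n2 = 0) := by
    rintro ⟨rfl, rfl, rfl⟩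
    obtain ⟨g0, g1, g2, g3, g4⟩ := h
    have e1 : c1 = 1 := by linarith
    have e2 : c2 = 0 := by linarith
    subst e1 e2
    norm_num at g2
  have hK := rat_final (by simp) hp h
  obtain ⟨g0, g1, g2, g3, g4⟩ := h
  rcases hK with hK | hK
  · rcases hK with ⟨h, h'⟩ | ⟨h, h'⟩ | ⟨h, h'⟩ | ⟨h, h'⟩ | ⟨h, h'⟩ | ⟨h, h'⟩
    · norm_num at h'
    · exact hv h
    · exact hu ⟨h, by rw [h', h]; norm_num⟩
    · exact hv h
    · norm_num at h'
    · exact hv h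
  · have hn2 : n2 = c2 := by linarith
    subst hn2
    rcases hK with ⟨h, h'⟩ | ⟨h, h'⟩ | ⟨h, h'⟩ | ⟨h, h'⟩ | ⟨h, h'⟩ | ⟨h, h'⟩
    · subst h h'
      have e : c1 = 0 := by linarith
      subst e
      have e : n0 = 0 := by linarith
      subst e
      norm_num at g0
    · subst h h'
      have e : c1 = 1 := by linarith
      subst e
      have e : n2 = 0 := by linarith
      subst e
      norm_num at g2
    · subst h h'
      have a0 : v * n0 = c1 - 1 := by linarith
      have a1 : u * n0 = n0 ^ 2 + c1 - n0 := by linarith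
      have k1 : (2 * (n0 - c1) + 1) * (n0 - 1) = 0 := by linear_combination -g2 - a0 - 2 * a1
      have k2 : (n0 - c1) * (2 * n0 - (n0 - c1)) + n0 - 3 * (n0 - c1) - 1 = 0 := by linear_combination -g1 - 2 * a0 - a1
      rcases mul_eq_zero.1 k1 with k | k
      · have : c1 = n0 + 1 / 2 := by linarith
        subst this
        ring_nf at k2
        norm_num at k2
      · have : n0 = 1 := by linarith
        subst this
        have : (c1 - 1) * (c1 - 2) = 0 := by linear_combination -k2
        rcases mul_eq_zero.1 this with k | k
        · apply hv; linarith
        · apply hu; constructor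
          · linarith
          · linarith
    · subst h h'
      have e : c1 = 1 := by linarith
      subst e
      have e : n1 = 1 := by linarith
      subst e
      apply hv; linarith
    · subst h h'
      have e : n0 = c1 := by linarith
      subst e
      have : n0 * (n0 - 1) = 0 := by linear_combination g1 - g0 - g2
      rcases mul_eq_zero.1 this with k | k
      · subst k; norm_num at g0
      · have : n0 = 1 := by linarith
        subst this
        apply hv; linarith
    · subst h h'
      have e : c1 = 1 := by linarith
      subst e
      have : n1 * (n1 - 1) = 0 := by linear_combination g3 + g1 - g2
      rcases mul_eq_zero.1 this with k | k
      · subst k; norm_num at g3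
      · have : n1 = 1 := by linarith
        subst this
        apply hu; constructor
        · linarith
        · linarith
end S9

theorem lin_zero {x : ℂ} (hirr : ¬ ∃ r : ℚ, x = (r : ℂ)) {a b : ℚ} (h : (a : ℂ) + b * x = 0) :
    a = 0 ∧ b = 0 := by
  have hb : b = 0 := by
    by_contra hb
    apply hirr
    refine ⟨-a / b, ?_⟩
    have : (b : ℂ) ≠ 0 := by exact_mod_cast hb
    push_cast
    rw [eq_div_iff this]
    linear_combination h
  subst hb
  refine ⟨?_, rfl⟩
  simpa using h

theorem final_case (x y : ℂ)
    (hcurve : y ^ 2 = x ^ 6 + 2 * x ^ 5 + x ^ 4 + 2 * x ^ 3 + 6 * x ^ 2 + 4 * x + 1)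
    (u v s t : ℚ) (hx : x ^ 2 + u * x + v = 0) (hy : y = s + t * x)
    (hirr : ¬ ∃ r : ℚ, x = (r : ℂ)) : False := by
  have hx0 : x ≠ 0 := by
    rintro rfl; exact hirr ⟨0, by simp⟩
  have hv : v ≠ 0 := by
    rintro rfl
    have : x * (x + u) = 0 := by push_cast at hx; linear_combination hx
    rcases mul_eq_zero.1 this with h | h
    · exact hx0 h
    · exact hirr ⟨-u, by push_cast; linear_combination h⟩
  have hu : ¬ (v = 1 ∧ u = 2) := by
    rintro ⟨rfl, rfl⟩
    have : (x + 1) ^ 2 = 0 := by push_cast at hx; linear_combination hx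
    have := pow_eq_zero_iff (two_ne_zero) |>.1 this
    exact hirr ⟨-1, by push_cast; linear_combination this⟩
  obtain ⟨c2, hc2⟩ : ∃ c2 : ℚ, c2 * v = -((s - u * v + v - 1) / 2) :=
    ⟨-((s - u * v + v - 1) / 2) / v, div_mul_cancel₀ _ hv⟩
  obtain ⟨c1, hc1⟩ : ∃ c1 : ℚ, c1 = (t - u ^ 2 + v + u) / 2 + u * c2 := ⟨_, rfl⟩
  have hc2C : (c2 : ℂ) * v = -((s - u * v + v - 1) / 2) := by exact_mod_cast hc2
  have hc1C : (c1 : ℂ) = (t - u ^ 2 + v + u) / 2 + u * c2 := by exact_mod_cast hc1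
  have hz : y = 2 * (c2 * x ^ 2 + c1 * x) + (x ^ 3 + x ^ 2 + 1) := by
    have e2 : x ^ 2 = -u * x - v := by linear_combination hx
    have e3 : x ^ 3 = (u ^ 2 - v) * x + u * v := by linear_combination (x - u) * hx
    rw [e3, e2, hy, hc1C]
    linear_combination 2 * hc2C
  have hT : (c2 : ℂ) * x ^ 4 + (c2 ^ 2 + c1 + c2) * x ^ 3 + (2 * c1 * c2 + c1) * x ^ 2
      + (c1 ^ 2 + c2 - 1) * x + (c1 - 1) = 0 := by
    have : x * ((c2 : ℂ) * x ^ 4 + (c2 ^ 2 + c1 + c2) * x ^ 3 + (2 * c1 * c2 + c1) * x ^ 2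
      + (c1 ^ 2 + c2 - 1) * x + (c1 - 1)) = 0 := by
      rw [hz] at hcurve
      linear_combination hcurve / 4
    exact (mul_eq_zero.1 this).resolve_left hx0
  obtain ⟨n1, hn1⟩ : ∃ n1 : ℚ, n1 = c2 ^ 2 + c1 + c2 - u * c2 := ⟨_, rfl⟩
  obtain ⟨n0, hn0⟩ : ∃ n0 : ℚ, n0 = 2 * c1 * c2 + c1 - v * c2 - u * n1 := ⟨_, rfl⟩
  have hn1C : (n1 : ℂ) = c2 ^ 2 + c1 + c2 - u * c2 := by exact_mod_cast hn1
  have hn0C : (n0 : ℂ) = 2 * c1 * c2 + c1 - v * c2 - u * n1 := by exact_mod_cast hn0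
  have hr : (((c1 - 1) - v * n0 : ℚ) : ℂ) + (((c1 ^ 2 + c2 - 1) - v * n1 - u * n0 : ℚ) : ℂ) * x = 0 := by
    push_cast
    rw [hn0C, hn1C]
    linear_combination hT - (c2 * x ^ 2 + n1 * x + n0) * hx + (x ^ 2 + u * x + v) * x * hn1C
      + (x ^ 2 + u * x + v) * hn0C + (x ^ 2 + u * x + v) * (-u) * hn1C
  obtain ⟨r0, r1⟩ := lin_zero hirr hr
  refine cases_final (c1 := c1) (c2 := c2) (u := u) (v := v) (n0 := n0) (n1 := n1) (n2 := c2) ⟨?_, ?_, ?_, ?_, ?_⟩ hv hu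
  · linear_combination r0
  · linear_combination r1
  · linear_combination -hn0
  · linear_combination -hn1
  · ring

open IntermediateField in
theorem basis_extract (x y : ℂ) (hdeg : Module.finrank ℚ ℚ⟮x, y⟯ = 2)
    (hirr : ¬ ∃ r : ℚ, x = (r : ℂ)) (w : ℂ) (hw : w ∈ ℚ⟮x, y⟯) : ∃ a b : ℚ, w = a + b * x := by
  have hxm : x ∈ ℚ⟮x, y⟯ := subset_adjoin ℚ _ (by simp)
  let X : ℚ⟮x, y⟯ := ⟨x, hxm⟩
  have hli : LinearIndependent ℚ ![(1 : ℚ⟮x, y⟯), X] := by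
    rw [LinearIndependent.pair_iff]
    intro a b h
    apply lin_zero hirr
    have := congrArg (fun z : ℚ⟮x, y⟯ => (z : ℂ)) h
    simpa [X, Algebra.smul_def] using this
  have hsp := hli.span_eq_top_of_card_eq_finrank (by simp [hdeg])
  have hm : (⟨w, hw⟩ : ℚ⟮x, y⟯) ∈ Submodule.span ℚ (Set.range ![(1 : ℚ⟮x, y⟯), X]) := by
    rw [hsp]; trivial
  rw [Matrix.range_cons, Matrix.range_cons, Matrix.range_empty, Set.union_empty,
    Set.singleton_union, Submodule.mem_span_pair] at hm
  obtain ⟨a, b, h⟩ := hm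
  refine ⟨a, b, ?_⟩
  have := congrArg (fun z : ℚ⟮x, y⟯ => (z : ℂ)) h
  simpa [X, Algebra.smul_def] using this.symm

open IntermediateField in
theorem final_thm (x y : ℂ)
    (hcurve : y ^ 2 = x ^ 6 + 2 * x ^ 5 + x ^ 4 + 2 * x ^ 3 + 6 * x ^ 2 + 4 * x + 1)
    (hdeg : Module.finrank ℚ ℚ⟮x, y⟯ = 2) :
    ∃ r : ℚ, x = (r : ℂ) := by
  by_contra hirr
  have hxm : x ∈ ℚ⟮x, y⟯ := subset_adjoin ℚ _ (by simp)
  have hym : y ∈ ℚ⟮x, y⟯ := subset_adjoin ℚ _ (by simp)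
  obtain ⟨a, b, h⟩ := basis_extract x y hdeg hirr (x ^ 2) (pow_mem hxm 2)
  obtain ⟨s, t, h'⟩ := basis_extract x y hdeg hirr y hym
  exact final_case x y hcurve (-b) (-a) s t (by push_cast; linear_combination h) h' hirr

end X113
end

open IntermediateField

/-- Every quadratic point on the affine model `y² = x⁶ + 2x⁵ + x⁴ + 2x³ + 6x² + 4x + 1`
of the modular curve `X₁(13)` is an obvious quadratic point: its `x`-coordinate is rational. -/
theorem X1_13_quadratic_points_obvious (x y : ℂ)
    (hcurve : y ^ 2 = x ^ 6 + 2 * x ^ 5 + x ^ 4 + 2 * x ^ 3 + 6 * x ^ 2 + 4 * x + 1)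
    (hdeg : Module.finrank ℚ ℚ⟮x, y⟯ = 2) :
    ∃ r : ℚ, x = (r : ℂ) := by
  exact X113.final_thm x y hcurve hdeg
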